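/- The coefficients of the formal series sdet S(u) (the Sklyanin determinant) belong to the center of the twisted q-Yangian; that is, every coefficient of sdet S(u) commutes with all elements of Y^tw_q(o_N) in the orthogonal case (G = identity), and with all elements of Y^tw_q(sp_2n) in the symplectic case (N = 2n). -/

import Mathlib

noncomputable section

open scoped TensorProduct

abbrev FF : Type := RatFunc ℂ

def qq : FF := RatFunc.X

/-! Constant R-matrices acting in `ℂ^N ⊗ ℂ^N`, written as matrices indexed by pairs. -/

def Rc (F : Type) [Field F] (q : F) (N : ℕ) :
    Matrix (Fin N × Fin N) (Fin N × Fin N) F := Matrix.of fun p r =>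
  (if p = r then (if p.1 = p.2 then q else 1) else 0)
  + (if p.1 = r.2 ∧ p.2 = r.1 ∧ p.1 < p.2 then q - q⁻¹ else 0)

/-- `R` transposed in the first tensor factor. -/
def Rct (F : Type) [Field F] (q : F) (N : ℕ) :
    Matrix (Fin N × Fin N) (Fin N × Fin N) F :=
  Matrix.of fun p r => Rc F q N (r.1, p.2) (p.1, r.2)

def Rtil (F : Type) [Field F] (q : F) (N : ℕ) :
    Matrix (Fin N × Fin N) (Fin N × Fin N) F := Matrix.of fun p r =>
  (if p = r then (if p.1 = p.2 then q⁻¹ else 1) else 0)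
  + (if p.1 = r.2 ∧ p.2 = r.1 ∧ p.2 < p.1 then q⁻¹ - q else 0)

def Rtilt (F : Type) [Field F] (q : F) (N : ℕ) :
    Matrix (Fin N × Fin N) (Fin N × Fin N) F :=
  Matrix.of fun p r => Rtil F q N (r.1, p.2) (p.1, r.2)

/-- `S ↦ S ⊗ 1` (action in the first copy of `End ℂ^N`). -/
def amp1 {A : Type} [Ring A] {N : ℕ} (M : Matrix (Fin N) (Fin N) A) :
    Matrix (Fin N × Fin N) (Fin N × Fin N) A :=
  Matrix.of fun p r => if p.2 = r.2 then M p.1 r.1 else 0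

/-- `S ↦ 1 ⊗ S` (action in the second copy of `End ℂ^N`). -/
def amp2 {A : Type} [Ring A] {N : ℕ} (M : Matrix (Fin N) (Fin N) A) :
    Matrix (Fin N × Fin N) (Fin N × Fin N) A :=
  Matrix.of fun p r => if p.1 = r.1 then M p.2 r.2 else 0

/-- A scalar matrix viewed as a matrix over an `F`-algebra `A`. -/
def liftF (F : Type) [Field F] {A : Type} [Ring A] [Algebra F A] {m : Type}
    (M : Matrix m m F) : Matrix m m A := M.map (algebraMap F A)

/-- Left hand side `R S₁ Rᵗ S₂` of the reflection equation. -/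
def reflLHS (F : Type) [Field F] (q : F) {N : ℕ} {A : Type} [Ring A] [Algebra F A]
    (S : Matrix (Fin N) (Fin N) A) : Matrix (Fin N × Fin N) (Fin N × Fin N) A :=
  liftF F (Rc F q N) * amp1 S * liftF F (Rct F q N) * amp2 S

/-- Right hand side `S₂ Rᵗ S₁ R` of the reflection equation. -/
def reflRHS (F : Type) [Field F] (q : F) {N : ℕ} {A : Type} [Ring A] [Algebra F A]
    (S : Matrix (Fin N) (Fin N) A) : Matrix (Fin N × Fin N) (Fin N × Fin N) A :=
  amp2 S * liftF F (Rct F q N) * amp1 S * liftF F (Rc F q N)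

/-- The list of index pairs `(i,j)` in lexicographic order. -/
def lexPairs (N : ℕ) : List (Fin N × Fin N) :=
  (List.finRange N).flatMap fun i => (List.finRange N).map fun j => (i, j)

/-! The generic matrix of generators. -/

def Sfree (F : Type) [Field F] (N : ℕ) :
    Matrix (Fin N) (Fin N) (FreeAlgebra F (Fin N × Fin N)) :=
  Matrix.of fun i j => FreeAlgebra.ι F (i, j)

/-- Defining relations: only the reflection equation. -/
inductive Rel0 (F : Type) [Field F] (q : F) (N : ℕ) :
    FreeAlgebra F (Fin N × Fin N) → FreeAlgebra F (Fin N × Fin N) → Prop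
  | refl (p r : Fin N × Fin N) :
      Rel0 F q N (reflLHS F q (Sfree F N) p r) (reflRHS F q (Sfree F N) p r)

/-- The algebra with generators `s_ij` and the reflection equation as defining relations. -/
abbrev Alg0 (F : Type) [Field F] (q : F) (N : ℕ) := RingQuot (Rel0 F q N)

def s0 (F : Type) [Field F] (q : F) (N : ℕ) (i j : Fin N) : Alg0 F q N :=
  RingQuot.mkAlgHom F (Rel0 F q N) (FreeAlgebra.ι F (i, j))

/-- Defining relations of the presented algebra `𝒮` of the orthogonal case. -/
inductive OSRel (F : Type) [Field F] (q : F) (N : ℕ) :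
    FreeAlgebra F (Fin N × Fin N) → FreeAlgebra F (Fin N × Fin N) → Prop
  | tri (i j : Fin N) (h : i < j) : OSRel F q N (FreeAlgebra.ι F (i, j)) 0
  | diag (i : Fin N) : OSRel F q N (FreeAlgebra.ι F (i, i)) 1
  | refl (p r : Fin N × Fin N) :
      OSRel F q N (reflLHS F q (Sfree F N) p r) (reflRHS F q (Sfree F N) p r)

abbrev AlgOS (F : Type) [Field F] (q : F) (N : ℕ) := RingQuot (OSRel F q N)

def sOS (F : Type) [Field F] (q : F) (N : ℕ) (i j : Fin N) : AlgOS F q N :=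
  RingQuot.mkAlgHom F (OSRel F q N) (FreeAlgebra.ι F (i, j))

/-! The quantized enveloping algebra `U_q(gl_N)` by its RTT presentation. -/

abbrev GlGen (N : ℕ) := (Fin N × Fin N) ⊕ (Fin N × Fin N)

def Tfree (F : Type) [Field F] (N : ℕ) :
    Matrix (Fin N) (Fin N) (FreeAlgebra F (GlGen N)) :=
  Matrix.of fun i j => FreeAlgebra.ι F (Sum.inl (i, j))

def Tbfree (F : Type) [Field F] (N : ℕ) :
    Matrix (Fin N) (Fin N) (FreeAlgebra F (GlGen N)) :=
  Matrix.of fun i j => FreeAlgebra.ι F (Sum.inr (i, j))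

/-- `R X₁ Y₂` -/
def rttLHS (F : Type) [Field F] (q : F) {N : ℕ} {A : Type} [Ring A] [Algebra F A]
    (X Y : Matrix (Fin N) (Fin N) A) : Matrix (Fin N × Fin N) (Fin N × Fin N) A :=
  liftF F (Rc F q N) * amp1 X * amp2 Y

/-- `Y₂ X₁ R` -/
def rttRHS (F : Type) [Field F] (q : F) {N : ℕ} {A : Type} [Ring A] [Algebra F A]
    (X Y : Matrix (Fin N) (Fin N) A) : Matrix (Fin N × Fin N) (Fin N × Fin N) A :=
  amp2 Y * amp1 X * liftF F (Rc F q N)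

inductive GlRel (F : Type) [Field F] (q : F) (N : ℕ) :
    FreeAlgebra F (GlGen N) → FreeAlgebra F (GlGen N) → Prop
  | t_zero (i j : Fin N) (h : i < j) : GlRel F q N (Tfree F N i j) 0
  | tb_zero (i j : Fin N) (h : j < i) : GlRel F q N (Tbfree F N i j) 0
  | t_tb (i : Fin N) : GlRel F q N (Tfree F N i i * Tbfree F N i i) 1
  | tb_t (i : Fin N) : GlRel F q N (Tbfree F N i i * Tfree F N i i) 1
  | rtt (p r : Fin N × Fin N) :
      GlRel F q N (rttLHS F q (Tfree F N) (Tfree F N) p r)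
        (rttRHS F q (Tfree F N) (Tfree F N) p r)
  | rtbtb (p r : Fin N × Fin N) :
      GlRel F q N (rttLHS F q (Tbfree F N) (Tbfree F N) p r)
        (rttRHS F q (Tbfree F N) (Tbfree F N) p r)
  | rtbt (p r : Fin N × Fin N) :
      GlRel F q N (rttLHS F q (Tbfree F N) (Tfree F N) p r)
        (rttRHS F q (Tbfree F N) (Tfree F N) p r)

/-- The quantized enveloping algebra `U_q(gl_N)`. -/
abbrev UqGl (F : Type) [Field F] (q : F) (N : ℕ) := RingQuot (GlRel F q N)

def tE (F : Type) [Field F] (q : F) (N : ℕ) (i j : Fin N) : UqGl F q N :=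
  RingQuot.mkAlgHom F (GlRel F q N) (FreeAlgebra.ι F (Sum.inl (i, j)))

def tbE (F : Type) [Field F] (q : F) (N : ℕ) (i j : Fin N) : UqGl F q N :=
  RingQuot.mkAlgHom F (GlRel F q N) (FreeAlgebra.ι F (Sum.inr (i, j)))

/-- The entries `s_ij = Σ_a t_ia t̄_ja` of `S = T T̄ᵗ`. -/
def sE (F : Type) [Field F] (q : F) (N : ℕ) (i j : Fin N) : UqGl F q N :=
  ∑ a : Fin N, tE F q N i a * tbE F q N j a

/-- The twisted quantized enveloping algebra `U^tw_q(o_N)` as a subalgebra of `U_q(gl_N)`. -/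
def UtwO (F : Type) [Field F] (q : F) (N : ℕ) : Subalgebra F (UqGl F q N) :=
  Algebra.adjoin F {x | ∃ i j, x = sE F q N i j}

/-! Symplectic (finite) case. -/

/-- `2k` as an element of `Fin (2n)` (the 0-based version of the odd index `2k-1`). -/
def fe (n : ℕ) (k : Fin n) : Fin (2 * n) := ⟨2 * k.val, by have := k.isLt; omega⟩

/-- `2k+1` as an element of `Fin (2n)` (the 0-based version of the even index `2k`). -/
def fo (n : ℕ) (k : Fin n) : Fin (2 * n) := ⟨2 * k.val + 1, by have := k.isLt; omega⟩

/-- The entries `s_ij` of `S = T G T̄ᵗ` in `U_q(gl_2n)`. -/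
def sSp (F : Type) [Field F] (q : F) (n : ℕ) (i j : Fin (2 * n)) : UqGl F q (2 * n) :=
  algebraMap F _ q * ∑ a : Fin n, tE F q (2 * n) i (fe n a) * tbE F q (2 * n) j (fo n a)
    - ∑ a : Fin n, tE F q (2 * n) i (fo n a) * tbE F q (2 * n) j (fe n a)

abbrev SpGen (n : ℕ) := (Fin (2 * n) × Fin (2 * n)) ⊕ Fin n

def SpFreeS (F : Type) [Field F] (n : ℕ) :
    Matrix (Fin (2 * n)) (Fin (2 * n)) (FreeAlgebra F (SpGen n)) :=
  Matrix.of fun i j => FreeAlgebra.ι F (Sum.inl (i, j))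

/-- Defining relations of the presented algebra `𝒮` of the symplectic case. -/
inductive SpRel (F : Type) [Field F] (q : F) (n : ℕ) :
    FreeAlgebra F (SpGen n) → FreeAlgebra F (SpGen n) → Prop
  | tri (i j : Fin (2 * n)) (h : i < j) (h' : ¬(i.val % 2 = 0 ∧ j.val = i.val + 1)) :
      SpRel F q n (FreeAlgebra.ι F (Sum.inl (i, j))) 0
  | quad (k : Fin n) :
      SpRel F q n
        (FreeAlgebra.ι F (Sum.inl (fo n k, fo n k)) * FreeAlgebra.ι F (Sum.inl (fe n k, fe n k)))
        (algebraMap F _ (q ^ 2) *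
            (FreeAlgebra.ι F (Sum.inl (fo n k, fe n k)) *
              FreeAlgebra.ι F (Sum.inl (fe n k, fo n k)))
          + algebraMap F _ (q ^ 3))
  | invR (k : Fin n) :
      SpRel F q n
        (FreeAlgebra.ι F (Sum.inl (fe n k, fo n k)) * FreeAlgebra.ι F (Sum.inr k)) 1
  | invL (k : Fin n) :
      SpRel F q n
        (FreeAlgebra.ι F (Sum.inr k) * FreeAlgebra.ι F (Sum.inl (fe n k, fo n k))) 1
  | refl (p r : Fin (2 * n) × Fin (2 * n)) :
      SpRel F q n (reflLHS F q (SpFreeS F n) p r) (reflRHS F q (SpFreeS F n) p r)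

abbrev AlgSp (F : Type) [Field F] (q : F) (n : ℕ) := RingQuot (SpRel F q n)

def sSpP (F : Type) [Field F] (q : F) (n : ℕ) (i j : Fin (2 * n)) : AlgSp F q n :=
  RingQuot.mkAlgHom F (SpRel F q n) (FreeAlgebra.ι F (Sum.inl (i, j)))

def sInvP (F : Type) [Field F] (q : F) (n : ℕ) (k : Fin n) : AlgSp F q n :=
  RingQuot.mkAlgHom F (SpRel F q n) (FreeAlgebra.ι F (Sum.inr k))

/-- row `i = 2k` of the symplectic ordered monomial: positions `(i,0),…,(i,2k)`. -/
def rowA (n : ℕ) (k : Fin n) : List (Fin (2 * n) × Fin (2 * n)) :=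
  ((List.finRange (2 * n)).filter fun j => j.val ≤ 2 * k.val).map fun j => (fe n k, j)

/-- row `i' = 2k+1` of the symplectic ordered monomial: positions `(i',0),…,(i',2k-1)`. -/
def rowB (n : ℕ) (k : Fin n) : List (Fin (2 * n) × Fin (2 * n)) :=
  ((List.finRange (2 * n)).filter fun j => j.val + 2 ≤ 2 * k.val + 1).map fun j => (fo n k, j)

/-- The ordered monomials of the symplectic case, with an arbitrary integer exponent
on each `s_{i i'}` and nonnegative exponents elsewhere. -/
def monomSp {A : Type} [Ring A] (n : ℕ) (s : Fin (2 * n) × Fin (2 * n) → A) (sI : Fin n → A)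
    (kN : Fin (2 * n) × Fin (2 * n) → ℕ) (kZ : Fin n → ℤ) : A :=
  ((List.finRange n).map fun k =>
    ((rowA n k).map fun p => s p ^ kN p).prod *
      (if 0 ≤ kZ k then s (fe n k, fo n k) ^ (kZ k).toNat else sI k ^ (-(kZ k)).toNat) *
      s (fo n k, fo n k) ^ kN (fo n k, fo n k) *
      ((rowB n k).map fun p => s p ^ kN p).prod).prod

/-! Affine (twisted q-Yangian) machinery.  Series are treated coefficientwise. -/

/-- `z1 S r` is the coefficient matrix (in the first copy) of a series indexed by
nonnegative integers, extended by zero to `ℤ`. -/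
def z1 {A : Type} [Ring A] {N : ℕ} (S : ℕ → Matrix (Fin N) (Fin N) A) (r : ℤ) :
    Matrix (Fin N × Fin N) (Fin N × Fin N) A :=
  if 0 ≤ r then amp1 (S r.toNat) else 0

def z2 {A : Type} [Ring A] {N : ℕ} (S : ℕ → Matrix (Fin N) (Fin N) A) (r : ℤ) :
    Matrix (Fin N × Fin N) (Fin N × Fin N) A :=
  if 0 ≤ r then amp2 (S r.toNat) else 0

/-- Coefficient of `u^a v^b` in `R(u,v) S₁(u) Rᵗ(u⁻¹,v) S₂(v)`,
using `R(u,v) = u R̃ - v R` and `Rᵗ(u⁻¹,v) = u⁻¹ R̃ᵗ - v Rᵗ`. -/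
def affLHS (F : Type) [Field F] (q : F) {N : ℕ} {A : Type} [Ring A] [Algebra F A]
    (S : ℕ → Matrix (Fin N) (Fin N) A) (a b : ℤ) :
    Matrix (Fin N × Fin N) (Fin N × Fin N) A :=
  liftF F (Rtil F q N) * z1 S (-a) * liftF F (Rtilt F q N) * z2 S (-b)
    - liftF F (Rtil F q N) * z1 S (1 - a) * liftF F (Rct F q N) * z2 S (1 - b)
    - liftF F (Rc F q N) * z1 S (-1 - a) * liftF F (Rtilt F q N) * z2 S (1 - b)
    + liftF F (Rc F q N) * z1 S (-a) * liftF F (Rct F q N) * z2 S (2 - b)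

/-- Coefficient of `u^a v^b` in `S₂(v) Rᵗ(u⁻¹,v) S₁(u) R(u,v)`. -/
def affRHS (F : Type) [Field F] (q : F) {N : ℕ} {A : Type} [Ring A] [Algebra F A]
    (S : ℕ → Matrix (Fin N) (Fin N) A) (a b : ℤ) :
    Matrix (Fin N × Fin N) (Fin N × Fin N) A :=
  z2 S (-b) * liftF F (Rtilt F q N) * z1 S (-a) * liftF F (Rtil F q N)
    - z2 S (1 - b) * liftF F (Rtilt F q N) * z1 S (-1 - a) * liftF F (Rc F q N)
    - z2 S (1 - b) * liftF F (Rct F q N) * z1 S (1 - a) * liftF F (Rtil F q N)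
    + z2 S (2 - b) * liftF F (Rct F q N) * z1 S (-a) * liftF F (Rc F q N)

def SfreeA (F : Type) [Field F] (N : ℕ) (r : ℕ) :
    Matrix (Fin N) (Fin N) (FreeAlgebra F (ℕ × Fin N × Fin N)) :=
  Matrix.of fun i j => FreeAlgebra.ι F (r, i, j)

/-- Defining relations: only the affine reflection equation (coefficientwise). -/
inductive Rel9 (F : Type) [Field F] (q : F) (N : ℕ) :
    FreeAlgebra F (ℕ × Fin N × Fin N) → FreeAlgebra F (ℕ × Fin N × Fin N) → Prop
  | refl (a b : ℤ) (p r : Fin N × Fin N) :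
      Rel9 F q N (affLHS F q (SfreeA F N) a b p r) (affRHS F q (SfreeA F N) a b p r)

abbrev Alg9 (F : Type) [Field F] (q : F) (N : ℕ) := RingQuot (Rel9 F q N)

def s9 (F : Type) [Field F] (q : F) (N : ℕ) (r : ℕ) (i j : Fin N) : Alg9 F q N :=
  RingQuot.mkAlgHom F (Rel9 F q N) (FreeAlgebra.ι F (r, i, j))

/-- Defining relations of the presented twisted q-Yangian (orthogonal case). -/
inductive AORel (F : Type) [Field F] (q : F) (N : ℕ) :
    FreeAlgebra F (ℕ × Fin N × Fin N) → FreeAlgebra F (ℕ × Fin N × Fin N) → Prop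
  | tri (i j : Fin N) (h : i < j) : AORel F q N (FreeAlgebra.ι F (0, i, j)) 0
  | diag (i : Fin N) : AORel F q N (FreeAlgebra.ι F (0, i, i)) 1
  | refl (a b : ℤ) (p r : Fin N × Fin N) :
      AORel F q N (affLHS F q (SfreeA F N) a b p r) (affRHS F q (SfreeA F N) a b p r)

abbrev AlgAO (F : Type) [Field F] (q : F) (N : ℕ) := RingQuot (AORel F q N)

def sAO (F : Type) [Field F] (q : F) (N : ℕ) (r : ℕ) (i j : Fin N) : AlgAO F q N :=
  RingQuot.mkAlgHom F (AORel F q N) (FreeAlgebra.ι F (r, i, j))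

/-- Lexicographic (non-strict) comparison of triples. -/
def tripLe (x y : ℕ × ℕ × ℕ) : Prop :=
  x.1 < y.1 ∨ (x.1 = y.1 ∧ (x.2.1 < y.2.1 ∨ (x.2.1 = y.2.1 ∧ x.2.2 ≤ y.2.2)))

/-- A list of generator indices `(r,i,j)` is ordered if it is weakly increasing with
respect to the lexicographic order on `(r,i,j)`. -/
def sortedGens {N : ℕ} (l : List (ℕ × Fin N × Fin N)) : Prop :=
  l.Chain' fun x y => tripLe (x.1, x.2.1.val, x.2.2.val) (y.1, y.2.1.val, y.2.2.val)

/-! The quantum affine algebra `U_q(ĝl_N)` by its RTT presentation, coefficientwise. -/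

abbrev AffGen (N : ℕ) := (ℕ × Fin N × Fin N) ⊕ (ℕ × Fin N × Fin N)

def TfA (F : Type) [Field F] (N : ℕ) (r : ℕ) :
    Matrix (Fin N) (Fin N) (FreeAlgebra F (AffGen N)) :=
  Matrix.of fun i j => FreeAlgebra.ι F (Sum.inl (r, i, j))

def TbfA (F : Type) [Field F] (N : ℕ) (r : ℕ) :
    Matrix (Fin N) (Fin N) (FreeAlgebra F (AffGen N)) :=
  Matrix.of fun i j => FreeAlgebra.ι F (Sum.inr (r, i, j))

/-- Coefficient of `u^a v^b` in `R(u,v) X₁ Y₂` with prescribed coefficient extractions. -/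
def affRttL (F : Type) [Field F] (q : F) {N : ℕ} {A : Type} [Ring A] [Algebra F A]
    (X Y : ℕ → Matrix (Fin N) (Fin N) A) (a b a' b' : ℤ) :
    Matrix (Fin N × Fin N) (Fin N × Fin N) A :=
  liftF F (Rtil F q N) * z1 X a * z2 Y b - liftF F (Rc F q N) * z1 X a' * z2 Y b'

def affRttR (F : Type) [Field F] (q : F) {N : ℕ} {A : Type} [Ring A] [Algebra F A]
    (X Y : ℕ → Matrix (Fin N) (Fin N) A) (a b a' b' : ℤ) :
    Matrix (Fin N × Fin N) (Fin N × Fin N) A :=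
  z2 Y b * z1 X a * liftF F (Rtil F q N) - z2 Y b' * z1 X a' * liftF F (Rc F q N)

inductive AffGlRel (F : Type) [Field F] (q : F) (N : ℕ) :
    FreeAlgebra F (AffGen N) → FreeAlgebra F (AffGen N) → Prop
  | t0_tri (i j : Fin N) (h : i < j) : AffGlRel F q N (TfA F N 0 i j) 0
  | tb0_tri (i j : Fin N) (h : j < i) : AffGlRel F q N (TbfA F N 0 i j) 0
  | t_tb (i : Fin N) : AffGlRel F q N (TfA F N 0 i i * TbfA F N 0 i i) 1
  | tb_t (i : Fin N) : AffGlRel F q N (TbfA F N 0 i i * TfA F N 0 i i) 1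
  | rtt (a b : ℤ) (p r : Fin N × Fin N) :
      AffGlRel F q N
        (affRttL F q (TfA F N) (TfA F N) (1 - a) (-b) (-a) (1 - b) p r)
        (affRttR F q (TfA F N) (TfA F N) (1 - a) (-b) (-a) (1 - b) p r)
  | rtbtb (a b : ℤ) (p r : Fin N × Fin N) :
      AffGlRel F q N
        (affRttL F q (TbfA F N) (TbfA F N) (a - 1) b a (b - 1) p r)
        (affRttR F q (TbfA F N) (TbfA F N) (a - 1) b a (b - 1) p r)
  | rtbt (a b : ℤ) (p r : Fin N × Fin N) :
      AffGlRel F q N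
        (affRttL F q (TbfA F N) (TfA F N) (a - 1) (-b) a (1 - b) p r)
        (affRttR F q (TbfA F N) (TfA F N) (a - 1) (-b) a (1 - b) p r)

/-- The quantum affine algebra `U_q(ĝl_N)`. -/
abbrev UqAff (F : Type) [Field F] (q : F) (N : ℕ) := RingQuot (AffGlRel F q N)

def tA (F : Type) [Field F] (q : F) (N : ℕ) (r : ℕ) (i j : Fin N) : UqAff F q N :=
  RingQuot.mkAlgHom F (AffGlRel F q N) (FreeAlgebra.ι F (Sum.inl (r, i, j)))

def tbA (F : Type) [Field F] (q : F) (N : ℕ) (r : ℕ) (i j : Fin N) : UqAff F q N :=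
  RingQuot.mkAlgHom F (AffGlRel F q N) (FreeAlgebra.ι F (Sum.inr (r, i, j)))

/-- Coefficient of `u^{-r}` in `s_ij(u) = Σ_a t_ia(u) t̄_ja(u⁻¹)`. -/
def Scoef (F : Type) [Field F] (q : F) (N : ℕ) (r : ℕ) (i j : Fin N) : UqAff F q N :=
  ∑ a : Fin N, ∑ p ∈ Finset.range (r + 1), tA F q N p i a * tbA F q N (r - p) j a

/-- The twisted q-Yangian `Y^tw_q(o_N)` as a subalgebra of `U_q(ĝl_N)`. -/
def YtwO (F : Type) [Field F] (q : F) (N : ℕ) : Subalgebra F (UqAff F q N) :=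
  Algebra.adjoin F {x | ∃ r i j, x = Scoef F q N r i j}

/-- Coefficient of `u^{-r}` in `s_ij(u)`, the `(i,j)` entry of `S(u) = T(u) G T̄(u⁻¹)ᵗ`
in the symplectic case. -/
def ScoefSp (F : Type) [Field F] (q : F) (n : ℕ) (r : ℕ) (i j : Fin (2 * n)) :
    UqAff F q (2 * n) :=
  ∑ a : Fin n, ∑ p ∈ Finset.range (r + 1),
    (algebraMap F _ q * (tA F q (2 * n) p i (fe n a) * tbA F q (2 * n) (r - p) j (fo n a))
      - tA F q (2 * n) p i (fo n a) * tbA F q (2 * n) (r - p) j (fe n a))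

/-- The twisted q-Yangian `Y^tw_q(sp_2n)` as a subalgebra of `U_q(ĝl_2n)`,
with a prescribed family of inverses of `s^{(0)}_{ii'}`. -/
def YtwSp (F : Type) [Field F] (q : F) (n : ℕ) (inv : Fin n → UqAff F q (2 * n)) :
    Subalgebra F (UqAff F q (2 * n)) :=
  Algebra.adjoin F ({x | ∃ r i j, x = ScoefSp F q n r i j} ∪ Set.range inv)

abbrev ASpGen (n : ℕ) := (ℕ × Fin (2 * n) × Fin (2 * n)) ⊕ Fin n

def SfreeASp (F : Type) [Field F] (n : ℕ) (r : ℕ) :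
    Matrix (Fin (2 * n)) (Fin (2 * n)) (FreeAlgebra F (ASpGen n)) :=
  Matrix.of fun i j => FreeAlgebra.ι F (Sum.inl (r, i, j))

/-- Defining relations of the presented twisted q-Yangian (symplectic case). -/
inductive ASpRel (F : Type) [Field F] (q : F) (n : ℕ) :
    FreeAlgebra F (ASpGen n) → FreeAlgebra F (ASpGen n) → Prop
  | tri (i j : Fin (2 * n)) (h : i < j) (h' : ¬(i.val % 2 = 0 ∧ j.val = i.val + 1)) :
      ASpRel F q n (FreeAlgebra.ι F (Sum.inl (0, i, j))) 0
  | quad (k : Fin n) :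
      ASpRel F q n
        (FreeAlgebra.ι F (Sum.inl (0, fo n k, fo n k)) *
          FreeAlgebra.ι F (Sum.inl (0, fe n k, fe n k)))
        (algebraMap F _ (q ^ 2) *
            (FreeAlgebra.ι F (Sum.inl (0, fo n k, fe n k)) *
              FreeAlgebra.ι F (Sum.inl (0, fe n k, fo n k)))
          + algebraMap F _ (q ^ 3))
  | invR (k : Fin n) :
      ASpRel F q n
        (FreeAlgebra.ι F (Sum.inl (0, fe n k, fo n k)) * FreeAlgebra.ι F (Sum.inr k)) 1
  | invL (k : Fin n) :
      ASpRel F q n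
        (FreeAlgebra.ι F (Sum.inr k) * FreeAlgebra.ι F (Sum.inl (0, fe n k, fo n k))) 1
  | refl (a b : ℤ) (p r : Fin (2 * n) × Fin (2 * n)) :
      ASpRel F q n (affLHS F q (SfreeASp F n) a b p r) (affRHS F q (SfreeASp F n) a b p r)

abbrev AlgASp (F : Type) [Field F] (q : F) (n : ℕ) := RingQuot (ASpRel F q n)

def sASp (F : Type) [Field F] (q : F) (n : ℕ) (r : ℕ) (i j : Fin (2 * n)) : AlgASp F q n :=
  RingQuot.mkAlgHom F (ASpRel F q n) (FreeAlgebra.ι F (Sum.inl (r, i, j)))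

def sInvASp (F : Type) [Field F] (q : F) (n : ℕ) (k : Fin n) : AlgASp F q n :=
  RingQuot.mkAlgHom F (ASpRel F q n) (FreeAlgebra.ι F (Sum.inr k))

/-! q-antisymmetrizer and Sklyanin/quantum determinant machinery. -/

/-- The trigonometric R-matrix `R(u,v)`. -/
def Rtrig (F : Type) [Field F] (q : F) (N : ℕ) (u v : F) :
    Matrix (Fin N × Fin N) (Fin N × Fin N) F := Matrix.of fun p r =>
  (if p = r then (if p.1 = p.2 then q⁻¹ * u - q * v else u - v) else 0)
  + (if p.1 = r.2 ∧ p.2 = r.1 ∧ p.1 ≠ p.2 then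
      (q⁻¹ - q) * (if p.2 < p.1 then u else v) else 0)

/-- An operator on `ℂ^N ⊗ ℂ^N` acting in the `i`-th and `j`-th factors of `(ℂ^N)^{⊗ r}`. -/
def big2 (F : Type) [Field F] {N r : ℕ} (i j : Fin r)
    (M : Matrix (Fin N × Fin N) (Fin N × Fin N) F) :
    Matrix (Fin r → Fin N) (Fin r → Fin N) F :=
  Matrix.of fun f g =>
    if ∀ k, k ≠ i → k ≠ j → f k = g k then M (f i, f j) (g i, g j) else 0

/-- The list of the pairs `(i,j)`, `i < j`, in lexicographic order. -/
def pairsLex (r : ℕ) : List (Fin r × Fin r) :=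
  (List.finRange r).flatMap fun i =>
    ((List.finRange r).filter fun j => i < j).map fun j => (i, j)

/-- The number of inversions (the Coxeter length) of a permutation. -/
def invCount {r : ℕ} (σ : Equiv.Perm (Fin r)) : ℕ :=
  (Finset.univ.filter fun p : Fin r × Fin r => p.1 < p.2 ∧ σ p.2 < σ p.1).card

/-- The q-permutation operator `P^q` on `ℂ^N ⊗ ℂ^N`. -/
def PqSmall (F : Type) [Field F] (q : F) (N : ℕ) :
    Matrix (Fin N × Fin N) (Fin N × Fin N) F := Matrix.of fun p r =>
  if r.1 = p.2 ∧ r.2 = p.1 then (if p.1 = p.2 then 1 else if p.2 < p.1 then q else q⁻¹)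
  else 0

/-- The hypothesis that `Pq` is the extension of the q-permutation operators along
reduced decompositions: `P^q_{σ s_i} = P^q_σ P^q_{s_i}` whenever the length grows. -/
def PqExt (F : Type) [Field F] (q : F) (N r : ℕ)
    (Pq : Equiv.Perm (Fin r) → Matrix (Fin r → Fin N) (Fin r → Fin N) F) : Prop :=
  Pq 1 = 1 ∧
    ∀ (σ : Equiv.Perm (Fin r)) (i : ℕ) (h : i + 1 < r),
      invCount (σ * Equiv.swap ⟨i, Nat.lt_of_succ_lt h⟩ ⟨i + 1, h⟩) = invCount σ + 1 →
        Pq (σ * Equiv.swap ⟨i, Nat.lt_of_succ_lt h⟩ ⟨i + 1, h⟩) =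
          Pq σ * big2 F ⟨i, Nat.lt_of_succ_lt h⟩ ⟨i + 1, h⟩ (PqSmall F q N)

/-- The q-antisymmetrizer `A^q_r = Σ_σ sgn(σ) P^q_σ`. -/
def AqM (F : Type) [Field F] {N r : ℕ}
    (Pq : Equiv.Perm (Fin r) → Matrix (Fin r → Fin N) (Fin r → Fin N) F) :
    Matrix (Fin r → Fin N) (Fin r → Fin N) F :=
  ∑ σ : Equiv.Perm (Fin r), ((Equiv.Perm.sign σ : ℤ) : F) • Pq σ

/-- A matrix acting in the `k`-th factor of `(ℂ^N)^{⊗ N}`, with entries in `A`. -/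
def ampAt {A : Type} [Ring A] {N : ℕ} (k : Fin N) (M : Matrix (Fin N) (Fin N) A) :
    Matrix (Fin N → Fin N) (Fin N → Fin N) A :=
  Matrix.of fun f g => if ∀ l, l ≠ k → f l = g l then M (f k) (g k) else 0

/-- A scalar two-site operator viewed over `A`, acting at sites `i`, `j`. -/
def big2A (F : Type) [Field F] {A : Type} [Ring A] [Algebra F A] {N : ℕ} (i j : Fin N)
    (M : Matrix (Fin N × Fin N) (Fin N × Fin N) F) :
    Matrix (Fin N → Fin N) (Fin N → Fin N) A :=
  (big2 F i j M).map (algebraMap F A)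

/-- Coefficient of `u^m` in a product of formal series, each of which is supported in
degrees `≤ 1`; the series are given by their coefficient functions `ℤ → M`. -/
def seriesProdCoeff {M : Type} [Ring M] : List (ℤ → M) → ℤ → M
  | [], m => if m = 0 then 1 else 0
  | c :: t, m => ∑ k ∈ Finset.Icc (m - t.length) 1, c k * seriesProdCoeff t (m - k)

/-! Series factors entering the Sklyanin determinant. -/

/-- The matrix `S^{(r)}` of the coefficients of `S(u)` (orthogonal case). -/
def SmatA (F : Type) [Field F] (q : F) (N : ℕ) (r : ℕ) :
    Matrix (Fin N) (Fin N) (UqAff F q N) :=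
  Matrix.of fun i j => Scoef F q N r i j

/-- The series `S_k(q^{-2k+2} u)` acting at site `k` (0-based `k`), coefficientwise. -/
def SfacO (F : Type) [Field F] (q : F) (N : ℕ) (k : Fin N) (m : ℤ) :
    Matrix (Fin N → Fin N) (Fin N → Fin N) (UqAff F q N) :=
  if m ≤ 0 then q ^ (2 * (k.val : ℤ) * (-m)) • ampAt k (SmatA F q N (-m).toNat) else 0

/-- The series `R_{ij}ᵗ((q^{-2i+2}u)⁻¹, q^{-2j+2}u)` (0-based `i`, `j`), coefficientwise. -/
def RtfacO (F : Type) [Field F] (q : F) (N : ℕ) (i j : Fin N) (m : ℤ) :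
    Matrix (Fin N → Fin N) (Fin N → Fin N) (UqAff F q N) :=
  if m = -1 then q ^ (2 * (i.val : ℤ)) • big2A F i j (Rtilt F q N)
  else if m = 1 then (-(q ^ (-2 * (j.val : ℤ)))) • big2A F i j (Rct F q N)
  else 0

/-- The ordered list of factors `S₁(u) R₁₂ᵗ ⋯ R₁Nᵗ S₂(q⁻²u) ⋯ S_N(q^{-2N+2}u)`. -/
def sdetFacsO (F : Type) [Field F] (q : F) (N : ℕ) :
    List (ℤ → Matrix (Fin N → Fin N) (Fin N → Fin N) (UqAff F q N)) :=
  (List.finRange N).flatMap fun i =>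
    SfacO F q N i :: (((List.finRange N).filter fun j => i < j).map fun j => RtfacO F q N i j)

/-- The matrix `S^{(r)}` of the coefficients of `S(u)` (symplectic case). -/
def SmatASp (F : Type) [Field F] (q : F) (n : ℕ) (r : ℕ) :
    Matrix (Fin (2 * n)) (Fin (2 * n)) (UqAff F q (2 * n)) :=
  Matrix.of fun i j => ScoefSp F q n r i j

def SfacSp (F : Type) [Field F] (q : F) (n : ℕ) (k : Fin (2 * n)) (m : ℤ) :
    Matrix (Fin (2 * n) → Fin (2 * n)) (Fin (2 * n) → Fin (2 * n)) (UqAff F q (2 * n)) :=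
  if m ≤ 0 then q ^ (2 * (k.val : ℤ) * (-m)) • ampAt k (SmatASp F q n (-m).toNat) else 0

def sdetFacsSp (F : Type) [Field F] (q : F) (n : ℕ) :
    List (ℤ → Matrix (Fin (2 * n) → Fin (2 * n)) (Fin (2 * n) → Fin (2 * n))
      (UqAff F q (2 * n))) :=
  (List.finRange (2 * n)).flatMap fun i =>
    SfacSp F q n i ::
      (((List.finRange (2 * n)).filter fun j => i < j).map fun j => RtfacO F q (2 * n) i j)

/-- Coefficientwise quantum determinant `qdet T(u)`:
the coefficient of `u^m` (nonzero only for `m ≤ 0`). -/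
def qdetTc (F : Type) [Field F] (q : F) (N : ℕ) (m : ℤ) : UqAff F q N :=
  if m ≤ 0 then
    ∑ σ : Equiv.Perm (Fin N), ∑ rv ∈ Finset.Nat.antidiagonalTuple N (-m).toNat,
      (((-q)⁻¹ ^ invCount σ) * ∏ k : Fin N, q ^ (2 * (k.val : ℤ) * (rv k : ℤ))) •
        ((List.finRange N).map fun k => tA F q N (rv k) (σ k) k).prod
  else 0

/-- Coefficientwise quantum determinant `qdet T̄(q^{2N-2} u⁻¹)`:
the coefficient of `u^m` (nonzero only for `m ≤ 0`). -/
def qdetTbc (F : Type) [Field F] (q : F) (N : ℕ) (m : ℤ) : UqAff F q N :=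
  if m ≤ 0 then
    ∑ σ : Equiv.Perm (Fin N), ∑ rv ∈ Finset.Nat.antidiagonalTuple N (-m).toNat,
      (((-q)⁻¹ ^ invCount σ) *
          ∏ k : Fin N, q ^ ((2 * (N : ℤ) - 2 - 2 * (k.val : ℤ)) * (rv k : ℤ))) •
        ((List.finRange N).map fun k => tbA F q N (rv k) (σ k) k).prod
  else 0

/-- The linear factor `q^{2i-2}u⁻¹ - q^{-2j+2}u` of `γ_N(u)` (0-based `i`, `j`),
viewed as an `A`-valued series. -/
def gamFac (F : Type) [Field F] (q : F) (N : ℕ) (p : Fin N × Fin N) (m : ℤ) : UqAff F q N :=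
  if m = -1 then algebraMap F _ (q ^ (2 * (p.1.val : ℤ)))
  else if m = 1 then algebraMap F _ (-(q ^ (-2 * (p.2.val : ℤ)))) else 0

/-- The list of series whose product is `γ_N(u) qdet T(u) qdet T̄(q^{2N-2}u⁻¹)`
in the orthogonal case. -/
def rhsO (F : Type) [Field F] (q : F) (N : ℕ) : List (ℤ → UqAff F q N) :=
  ((pairsLex N).map fun p => gamFac F q N p) ++ [qdetTc F q N, qdetTbc F q N]

namespace Sklyanin

section Update

variable {ι n : Type} [DecidableEq ι]

/-- Replace the values of `f` at `i` and `j` by the two components of `p`. -/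
def upd2 (f : ι → n) (i j : ι) (p : n × n) : ι → n :=
  Function.update (Function.update f i p.1) j p.2

theorem upd2_left {i j : ι} (hij : i ≠ j) (f : ι → n) (p : n × n) : upd2 f i j p i = p.1 := by
  simp [upd2, Function.update_of_ne hij]

theorem upd2_right (i j : ι) (f : ι → n) (p : n × n) : upd2 f i j p j = p.2 := by
  simp [upd2]

theorem upd2_of_ne {i j k : ι} (hi : k ≠ i) (hj : k ≠ j) (f : ι → n) (p : n × n) :
    upd2 f i j p k = f k := by
  simp [upd2, Function.update_of_ne hi, Function.update_of_ne hj]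

theorem upd2_eq {i j : ι} (hij : i ≠ j) {f h : ι → n}
    (H : ∀ k, k ≠ i → k ≠ j → f k = h k) : upd2 f i j (h i, h j) = h := by
  funext k
  by_cases hj : k = j
  · subst hj; exact upd2_right _ _ _ _
  by_cases hi : k = i
  · subst hi; exact upd2_left hij _ _
  rw [upd2_of_ne hi hj, H k hi hj]

theorem upd2_swap {i j : ι} (hij : i ≠ j) (g : ι → n) :
    upd2 g i j (g j, g i) = g ∘ Equiv.swap i j := by
  have := upd2_eq (f := g) (h := g ∘ Equiv.swap i j) hij
    (fun k hi hj => by simp [Equiv.swap_apply_of_ne_of_ne hi hj])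
  simpa using this

theorem upd2_self {i j : ι} (hij : i ≠ j) (g : ι → n) : upd2 g i j (g i, g j) = g :=
  upd2_eq hij fun _ _ _ => rfl

theorem upd2_upd2 {i j : ι} (hij : i ≠ j) (g : ι → n) (p p' : n × n) :
    upd2 (upd2 g i j p) i j p' = upd2 g i j p' := by
  funext k
  by_cases hj : k = j
  · subst hj; simp only [upd2_right]
  by_cases hi : k = i
  · subst hi; simp only [upd2_left hij]
  simp only [upd2_of_ne hi hj]

theorem upd2_update {i j k : ι} (hi : k ≠ i) (hj : k ≠ j) (g : ι → n) (p : n × n) (x : n) :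
    upd2 (Function.update g k x) i j p = Function.update (upd2 g i j p) k x := by
  simp only [upd2]
  rw [Function.update_comm hi, Function.update_comm hj]

end Update

section Sites

variable {ι n B : Type} [Fintype ι] [DecidableEq ι] [Fintype n] [DecidableEq n] [Ring B]

/-- The one-site operator `M` acting at the site `i` of a tensor power. -/
def emb1 (i : ι) (M : Matrix n n B) : Matrix (ι → n) (ι → n) B :=
  Matrix.of fun f g => if ∀ l, l ≠ i → f l = g l then M (f i) (g i) else 0

/-- The two-site operator `M` acting at the sites `i`, `j` of a tensor power. -/
def emb2 (i j : ι) (M : Matrix (n × n) (n × n) B) : Matrix (ι → n) (ι → n) B :=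
  Matrix.of fun f g =>
    if ∀ k, k ≠ i → k ≠ j → f k = g k then M (f i, f j) (g i, g j) else 0

theorem sum_agree2 {V : Type} [AddCommMonoid V] {i j : ι} (hij : i ≠ j) (f : ι → n)
    (Φ : (ι → n) → V) :
    (∑ h, if ∀ k, k ≠ i → k ≠ j → h k = f k then Φ h else 0) = ∑ p, Φ (upd2 f i j p) := by
  rw [← Finset.sum_filter]
  refine Finset.sum_nbij' (fun h => (h i, h j)) (fun p => upd2 f i j p) ?_ ?_ ?_ ?_ ?_
  · simp
  · intro p _
    simp only [Finset.mem_filter, Finset.mem_univ, true_and]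
    intro k hi hj
    exact upd2_of_ne hi hj _ _
  · intro h hh
    simp only [Finset.mem_filter, Finset.mem_univ, true_and] at hh
    exact upd2_eq hij fun k hi hj => (hh k hi hj).symm
  · intro p _
    simp [upd2_left hij, upd2_right]
  · intro h hh
    simp only [Finset.mem_filter, Finset.mem_univ, true_and] at hh
    rw [upd2_eq hij fun k hi hj => (hh k hi hj).symm]

theorem sum_agree1 {V : Type} [AddCommMonoid V] (i : ι) (f : ι → n) (Φ : (ι → n) → V) :
    (∑ h, if ∀ k, k ≠ i → h k = f k then Φ h else 0) = ∑ p, Φ (Function.update f i p) := by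
  rw [← Finset.sum_filter]
  have key : ∀ h : ι → n, (∀ k, k ≠ i → h k = f k) → Function.update f i (h i) = h := by
    intro h hh
    funext k
    by_cases hk : k = i
    · subst hk; simp
    · rw [Function.update_of_ne hk, hh k hk]
  refine Finset.sum_nbij' (fun h => h i) (fun p => Function.update f i p) ?_ ?_ ?_ ?_ ?_
  · simp
  · intro p _
    simp only [Finset.mem_filter, Finset.mem_univ, true_and]
    intro k hk
    exact Function.update_of_ne hk _ _
  · intro h hh
    exact key h (by simpa using hh)
  · intro p _
    simp
  · intro h hh
    rw [key h (by simpa using hh)]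

theorem vecMul_emb2 {i j : ι} (hij : i ≠ j) (z : (ι → n) → B) (M : Matrix (n × n) (n × n) B)
    (g : ι → n) :
    Matrix.vecMul z (emb2 i j M) g = ∑ p, z (upd2 g i j p) * M p (g i, g j) := by
  have := sum_agree2 hij g (fun h => z h * M (h i, h j) (g i, g j))
  simp only [upd2_left hij, upd2_right] at this
  rw [← this]
  simp only [Matrix.vecMul, dotProduct, emb2, Matrix.of_apply, mul_ite, mul_zero]

theorem vecMul_emb1 (i : ι) (z : (ι → n) → B) (M : Matrix n n B) (g : ι → n) :
    Matrix.vecMul z (emb1 i M) g = ∑ k, z (Function.update g i k) * M k (g i) := by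
  have := sum_agree1 i g (fun h => z h * M (h i) (g i))
  simp only [Function.update_self] at this
  rw [← this]
  simp only [Matrix.vecMul, dotProduct, emb1, Matrix.of_apply, mul_ite, mul_zero]

theorem matrix_ext_of_vecMul {m k : Type} [Fintype m] [DecidableEq m] {M M' : Matrix m k B}
    (h : ∀ z i, Matrix.vecMul z M i = Matrix.vecMul z M' i) : M = M' := by
  ext i j
  have := h (Pi.single i 1) j
  simpa using this

theorem emb2_mul {i j : ι} (hij : i ≠ j) (M M' : Matrix (n × n) (n × n) B) :
    emb2 i j (M * M') = emb2 i j M * emb2 i j M' := by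
  refine matrix_ext_of_vecMul fun z g => ?_
  rw [← Matrix.vecMul_vecMul]
  simp only [vecMul_emb2 hij, upd2_upd2 hij, upd2_left hij, upd2_right, Matrix.mul_apply,
    Finset.mul_sum, Finset.sum_mul, Prod.mk.eta]
  rw [Finset.sum_comm]
  simp only [mul_assoc]

theorem emb1_one (i : ι) :
    emb1 i (1 : Matrix n n B) = 1 := by
  ext f g
  simp only [emb1, Matrix.of_apply, Matrix.one_apply]
  by_cases h : f = g
  · simp [h]
  · rw [if_neg h]
    split_ifs with h1 h2
    · exact absurd (funext fun k => if hk : k = i then hk ▸ h2 else h1 k hk) h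
    · rfl
    · rfl

theorem emb1_mul (i : ι) (M M' : Matrix n n B) : emb1 i (M * M') = emb1 i M * emb1 i M' := by
  refine matrix_ext_of_vecMul fun z g => ?_
  rw [← Matrix.vecMul_vecMul]
  simp only [vecMul_emb1, Function.update_idem, Function.update_self, Matrix.mul_apply,
    Finset.mul_sum, Finset.sum_mul]
  rw [Finset.sum_comm]
  simp only [mul_assoc]

theorem commute_emb1_emb1 {i j : ι} (hij : i ≠ j) (M M' : Matrix n n B)
    (h : ∀ a b c d, Commute (M a b) (M' c d)) : Commute (emb1 i M) (emb1 j M') := by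
  refine matrix_ext_of_vecMul fun z g => ?_
  rw [← Matrix.vecMul_vecMul, ← Matrix.vecMul_vecMul]
  simp only [vecMul_emb1, Function.update_of_ne hij, Function.update_of_ne hij.symm,
    Finset.sum_mul]
  rw [Finset.sum_comm]
  refine Finset.sum_congr rfl fun a _ => Finset.sum_congr rfl fun b _ => ?_
  rw [Function.update_comm hij.symm, mul_assoc, mul_assoc, (h _ _ _ _).eq]

theorem commute_emb2_emb1 {i j k : ι} (hij : i ≠ j) (hi : k ≠ i) (hj : k ≠ j)
    (M : Matrix (n × n) (n × n) B) (M' : Matrix n n B)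
    (h : ∀ a b c d, Commute (M a b) (M' c d)) : Commute (emb2 i j M) (emb1 k M') := by
  refine matrix_ext_of_vecMul fun z g => ?_
  rw [← Matrix.vecMul_vecMul, ← Matrix.vecMul_vecMul]
  simp only [vecMul_emb1, vecMul_emb2 hij, Function.update_of_ne hi.symm,
    Function.update_of_ne hj.symm, Finset.sum_mul, upd2_update hi hj, upd2_of_ne hi hj]
  rw [Finset.sum_comm]
  refine Finset.sum_congr rfl fun a _ => Finset.sum_congr rfl fun b _ => ?_
  rw [mul_assoc, mul_assoc, (h _ _ _ _).eq]

theorem commute_emb2_emb2 {i j k l : ι} (hij : i ≠ j) (hkl : k ≠ l) (hki : k ≠ i) (hkj : k ≠ j)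
    (hli : l ≠ i) (hlj : l ≠ j) (M M' : Matrix (n × n) (n × n) B)
    (h : ∀ a b c d, Commute (M a b) (M' c d)) : Commute (emb2 i j M) (emb2 k l M') := by
  refine matrix_ext_of_vecMul fun z g => ?_
  rw [← Matrix.vecMul_vecMul, ← Matrix.vecMul_vecMul]
  have comm : ∀ p p', upd2 (upd2 g k l p) i j p' = upd2 (upd2 g i j p') k l p := by
    intro p p'
    conv_lhs => rw [upd2.eq_def g, upd2_update hli hlj, upd2_update hki hkj]
    rfl
  simp only [vecMul_emb2 hij, vecMul_emb2 hkl, upd2_of_ne hki hkj, upd2_of_ne hli hlj,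
    upd2_of_ne hki.symm hli.symm, upd2_of_ne hkj.symm hlj.symm, Finset.sum_mul, comm]
  rw [Finset.sum_comm]
  refine Finset.sum_congr rfl fun a _ => Finset.sum_congr rfl fun b _ => ?_
  rw [mul_assoc, mul_assoc, (h _ _ _ _).eq]

end Sites

section Amp

variable {ι B : Type} [Fintype ι] [DecidableEq ι] [Ring B] {N : ℕ}

theorem emb2_amp1 {i j : ι} (hij : i ≠ j) (M : Matrix (Fin N) (Fin N) B) :
    emb2 i j (amp1 M) = emb1 i M := by
  refine matrix_ext_of_vecMul fun z g => ?_
  rw [vecMul_emb2 hij, vecMul_emb1, Fintype.sum_prod_type]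
  refine Finset.sum_congr rfl fun k _ => ?_
  rw [Finset.sum_eq_single (g j)]
  · have : Function.update (Function.update g i k) j (g j) = Function.update g i k := by
      conv_lhs => rw [← Function.update_of_ne hij.symm k g, Function.update_eq_self]
    simp [amp1, upd2, this]
  · intro b _ hb
    simp [amp1, hb]
  · simp

theorem emb2_amp2 {i j : ι} (hij : i ≠ j) (M : Matrix (Fin N) (Fin N) B) :
    emb2 i j (amp2 M) = emb1 j M := by
  refine matrix_ext_of_vecMul fun z g => ?_
  rw [vecMul_emb2 hij, vecMul_emb1, Fintype.sum_prod_type, Finset.sum_comm]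
  refine Finset.sum_congr rfl fun k _ => ?_
  rw [Finset.sum_eq_single (g i)]
  · simp [amp2, upd2]
  · intro b _ hb
    simp [amp2, hb]
  · simp

theorem ampAt_eq_emb1 (k : Fin N) (M : Matrix (Fin N) (Fin N) B) : ampAt k M = emb1 k M := by
  ext f g
  simp only [ampAt, emb1, Matrix.of_apply]
  congr

theorem big2A_eq_emb2 (F : Type) [Field F] [Algebra F B] (i j : Fin N)
    (M : Matrix (Fin N × Fin N) (Fin N × Fin N) F) :
    big2A F i j M = emb2 i j (liftF F M : Matrix _ _ B) := by
  ext f g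
  simp only [big2A, big2, liftF, emb2, Matrix.of_apply, Matrix.map_apply]
  split_ifs <;> simp

theorem big2_eq_emb2 {F : Type} [Field F] {r : ℕ} (i j : Fin r)
    (M : Matrix (Fin N × Fin N) (Fin N × Fin N) F) :
    big2 F i j M = emb2 i j M := by
  ext f g
  simp only [big2, emb2, Matrix.of_apply]
  congr

theorem emb2_sub (i j : ι) (M M' : Matrix (Fin N × Fin N) (Fin N × Fin N) B) :
    emb2 i j (M - M') = emb2 i j M - emb2 i j M' := by
  ext f g
  simp only [emb2, Matrix.of_apply, Matrix.sub_apply]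
  split_ifs <;> simp

theorem emb2_smul {S : Type} [SMulZeroClass S B] (i j : ι) (c : S)
    (M : Matrix (Fin N × Fin N) (Fin N × Fin N) B) :
    emb2 i j (c • M) = c • emb2 i j M := by
  ext f g
  simp only [emb2, Matrix.of_apply, Matrix.smul_apply]
  split_ifs <;> simp

theorem emb1_smul {S : Type} [SMulZeroClass S B] (i : ι) (c : S)
    (M : Matrix (Fin N) (Fin N) B) :
    emb1 i (c • M) = c • emb1 i M := by
  ext f g
  simp only [emb1, Matrix.of_apply, Matrix.smul_apply]
  split_ifs <;> simp

theorem map_emb2 {n B B' : Type} [Fintype n] [DecidableEq n] [Ring B] [Ring B'] (φ : B →+* B')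
    (i j : ι) (M : Matrix (n × n) (n × n) B) :
    (emb2 i j M).map φ = emb2 i j (M.map φ) := by
  ext f g
  simp only [emb2, Matrix.map_apply, Matrix.of_apply]
  split_ifs <;> simp

theorem map_emb1 {n B B' : Type} [Fintype n] [DecidableEq n] [Ring B] [Ring B'] (φ : B →+* B')
    (i : ι) (M : Matrix n n B) : (emb1 i M).map φ = emb1 i (M.map φ) := by
  ext f g
  simp only [emb1, Matrix.map_apply, Matrix.of_apply]
  split_ifs <;> simp

end Amp


section Kappa

variable {F : Type} [Field F] {N : ℕ}

/-- The scalar by which the q-permutation operator rescales a transposed basis vector. -/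
def kappa (q : F) (i j : Fin N) : F := if i = j then 1 else if i < j then q else q⁻¹

theorem kappa_ne_zero {q : F} (hq : q ≠ 0) (i j : Fin N) : kappa q i j ≠ 0 := by
  unfold kappa
  split_ifs <;> simp [hq]

theorem kappa_mul_kappa {q : F} (hq : q ≠ 0) (i j : Fin N) :
    kappa q i j * kappa q j i = 1 := by
  unfold kappa
  rcases lt_trichotomy i j with h | h | h
  · simp [h, h.ne, h.ne', h.not_gt, hq]
  · simp [h]
  · simp [h, h.ne, h.ne', h.not_gt, hq]

variable {ι B : Type} [Fintype ι] [DecidableEq ι] [Ring B] [Algebra F B]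

theorem vecMul_permutation {i j : ι} (hij : i ≠ j) (q : F) (z : (ι → Fin N) → B)
    (g : ι → Fin N) :
    Matrix.vecMul z (emb2 i j (liftF F (PqSmall F q N))) g
      = kappa q (g i) (g j) • z (g ∘ Equiv.swap i j) := by
  rw [vecMul_emb2 hij, Finset.sum_eq_single (g j, g i), upd2_swap hij]
  · simp only [liftF, Matrix.map_apply, PqSmall, Matrix.of_apply, and_self, if_true]
    rw [← Algebra.commutes, ← Algebra.smul_def]
    congr 1
    simp [kappa, eq_comm]
  · rintro ⟨a, b⟩ _ hp
    simp only [liftF, Matrix.map_apply, PqSmall, Matrix.of_apply]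
    rw [if_neg, map_zero, mul_zero]
    rintro ⟨h1, h2⟩
    exact hp (by simp [h1, h2])
  · simp

end Kappa

section Perm

/-- The transposition of the neighbouring sites `i` and `i + 1`. -/
abbrev adjSwap {r i : ℕ} (h : i + 1 < r) : Equiv.Perm (Fin r) :=
  Equiv.swap ⟨i, Nat.lt_of_succ_lt h⟩ ⟨i + 1, h⟩

theorem fin_ne_succ {r i : ℕ} (h : i + 1 < r) :
    (⟨i, Nat.lt_of_succ_lt h⟩ : Fin r) ≠ ⟨i + 1, h⟩ := by
  simp [Fin.ext_iff]

theorem perm_induction {r : ℕ} {P : Equiv.Perm (Fin r) → Prop} (one : P 1)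
    (step : ∀ σ (i : ℕ) (h : i + 1 < r), P σ → P (σ * adjSwap h)) (σ : Equiv.Perm (Fin r)) :
    P σ := by
  cases r with
  | zero => rwa [Subsingleton.elim σ 1]
  | succ r =>
    have hσ : σ ∈ Submonoid.closure
        (Set.range fun i : Fin r => Equiv.swap i.castSucc i.succ) := by
      rw [Equiv.Perm.mclosure_swap_castSucc_succ]; trivial
    induction hσ using Submonoid.closure_induction_right with
    | one => exact one
    | mul_right x _ y hy ih =>
      obtain ⟨i, rfl⟩ := hy
      exact step x i (Nat.succ_lt_succ i.isLt) ih

theorem invCount_mul_adjSwap {r i : ℕ} (h : i + 1 < r) (σ : Equiv.Perm (Fin r))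
    (hσ : σ ⟨i, Nat.lt_of_succ_lt h⟩ < σ ⟨i + 1, h⟩) :
    invCount (σ * adjSwap h) = invCount σ + 1 := by
  set a : Fin r := ⟨i, Nat.lt_of_succ_lt h⟩ with ha
  set b : Fin r := ⟨i + 1, h⟩ with hb
  set s := Equiv.swap a b with hs
  have hss : ∀ x, s (s x) = x := fun x => by simp [hs]
  have hlt : ∀ x y : Fin r, x < y → (x, y) ≠ (a, b) → s x < s y := by
    intro x y hxy hne
    simp only [hs, Equiv.swap_apply_def, ha, hb, ne_eq, Prod.mk.injEq, Fin.ext_iff,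
      Fin.lt_def] at *
    split_ifs <;> simp_all <;> omega
  have key : (Finset.univ.filter fun p : Fin r × Fin r =>
        p.1 < p.2 ∧ (σ * s) p.2 < (σ * s) p.1)
      = insert (a, b) ((Finset.univ.filter fun p : Fin r × Fin r =>
        p.1 < p.2 ∧ σ p.2 < σ p.1).map (s.prodCongr s).toEmbedding) := by
    ext ⟨x, y⟩
    have hmem : (x, y) ∈ ((Finset.univ.filter fun p : Fin r × Fin r =>
        p.1 < p.2 ∧ σ p.2 < σ p.1).map (s.prodCongr s).toEmbedding)
        ↔ s x < s y ∧ σ (s y) < σ (s x) := by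
      simp only [Finset.mem_map, Finset.mem_filter, Finset.mem_univ, true_and, Prod.exists]
      constructor
      · rintro ⟨u, v, huv, he⟩
        simp only [Equiv.coe_toEmbedding, Equiv.prodCongr_apply, Prod.map_apply,
          Prod.mk.injEq] at he
        obtain ⟨rfl, rfl⟩ := he
        simpa [hss] using huv
      · intro hxy
        exact ⟨s x, s y, hxy, by simp [hss]⟩
    rw [Finset.mem_insert, hmem, Finset.mem_filter]
    simp only [Finset.mem_univ, true_and, Equiv.Perm.mul_apply]
    constructor
    · rintro ⟨h1, h2⟩
      by_cases hne : (x, y) = (a, b)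
      · exact Or.inl hne
      · exact Or.inr ⟨hlt x y h1 hne, h2⟩
    · rintro (h1 | ⟨h1, h2⟩)
      · obtain ⟨rfl, rfl⟩ := Prod.mk.injEq .. ▸ h1
        refine ⟨by simp [ha, hb], ?_⟩
        simpa [hs] using hσ
      · refine ⟨?_, h2⟩
        have := hlt (s x) (s y) h1 (by
          intro he
          obtain ⟨e1, e2⟩ := Prod.mk.injEq .. ▸ he
          rw [e1, e2] at h2
          exact absurd h2 hσ.not_gt)
        simpa [hss] using this
  unfold invCount
  rw [key, Finset.card_insert_of_notMem, Finset.card_map]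
  simp only [Finset.mem_map, Finset.mem_filter, Finset.mem_univ, true_and, Prod.exists,
    Equiv.coe_toEmbedding, Equiv.prodCongr_apply, Prod.map_apply, Prod.mk.injEq, not_exists,
    not_and]
  intro u v huv h1 h2
  have e1 : u = b := by rw [← hss u, h1]; simp [hs]
  have e2 : v = a := by rw [← hss v, h2]; simp [hs]
  subst e1 e2
  have := huv.1
  simp [ha, hb] at this

end Perm

section AntiSym

variable {F : Type} [Field F] {V : Type} [AddCommGroup V] [Module F V] {N : ℕ}

/-- Covectors which are q-antisymmetric with respect to neighbouring sites. -/
def AntiSym (q : F) (z : (Fin N → Fin N) → V) : Prop :=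
  ∀ (i : ℕ) (h : i + 1 < N) (g : Fin N → Fin N),
    z g = -(kappa q (g ⟨i, Nat.lt_of_succ_lt h⟩) (g ⟨i + 1, h⟩) • z (g ∘ adjSwap h))

variable {q : F} {z : (Fin N → Fin N) → V}

theorem AntiSym.comp_adjSwap (hz : AntiSym q z) {i : ℕ} (h : i + 1 < N) (g : Fin N → Fin N) :
    z (g ∘ adjSwap h)
      = -(kappa q (g ⟨i + 1, h⟩) (g ⟨i, Nat.lt_of_succ_lt h⟩) • z g) := by
  rw [hz i h (g ∘ adjSwap h)]
  have : (g ∘ adjSwap h) ∘ adjSwap h = g := by ext x; simp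
  rw [this]
  simp

theorem AntiSym.eq_zero_of_not_injective (h2 : (2 : F) ≠ 0) (hz : AntiSym q z)
    (g : Fin N → Fin N) (hg : ¬ Function.Injective g) : z g = 0 := by
  have key : ∀ (d : ℕ) (g : Fin N → Fin N) (a : ℕ) (h : a + d + 1 < N),
      g ⟨a, by omega⟩ = g ⟨a + d + 1, h⟩ → z g = 0 := by
    intro d
    induction d with
    | zero =>
      intro g a h hab
      have h1 := hz a h g
      have hg' : g ∘ adjSwap h = g := by
        funext x
        simp only [Function.comp_apply, adjSwap, Equiv.swap_apply_def]
        split_ifs with h3 h4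
        · rw [h3]; exact hab.symm
        · rw [h4]; exact hab
        · rfl
      have hab' : g ⟨a, by omega⟩ = g ⟨a + 1, h⟩ := hab
      rw [hg', hab'] at h1
      simp only [kappa, if_true, one_smul] at h1
      have : (2 : F) • z g = 0 := by
        rw [two_smul]; nth_rewrite 1 [h1]; simp
      exact (smul_eq_zero.mp this).resolve_left h2
    | succ d ih =>
      intro g a h hab
      have ha : a + 1 < N := by omega
      rw [hz a ha g, ih (g ∘ adjSwap ha) (a + 1) (by omega), smul_zero, neg_zero]
      simp only [Function.comp_apply, adjSwap]
      rw [Equiv.swap_apply_right, hab, Equiv.swap_apply_of_ne_of_ne]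
      · congr 2; omega
      · simp only [ne_eq, Fin.mk.injEq]; omega
      · simp only [ne_eq, Fin.mk.injEq]; omega
  simp only [Function.Injective, not_forall] at hg
  obtain ⟨a, b, hab, hne⟩ := hg
  rcases lt_or_gt_of_ne hne with hlt | hlt
  · refine key (b - a - 1) g a (by omega) (hab.trans ?_)
    congr 1; ext; simp only; omega
  · refine key (a - b - 1) g b (by omega) (hab.symm.trans ?_)
    congr 1; ext; simp only; omega

theorem AntiSym.eq_zero (h2 : (2 : F) ≠ 0) (hz : AntiSym q z) (hid : z id = 0) : z = 0 := by
  funext g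
  by_cases hg : Function.Injective g
  · have hperm : ∀ σ : Equiv.Perm (Fin N), z σ = 0 := by
      intro σ
      induction σ using perm_induction with
      | one => exact hid
      | step σ i h ih =>
        rw [Equiv.Perm.coe_mul, hz.comp_adjSwap h, ih, smul_zero, neg_zero]
    exact hperm (Equiv.ofBijective g (Finite.injective_iff_bijective.mp hg))
  · exact hz.eq_zero_of_not_injective h2 g hg

theorem AntiSym.perm_ne_zero (hq : q ≠ 0) (hz : AntiSym q z) (hid : z id ≠ 0)
    (σ : Equiv.Perm (Fin N)) : z σ ≠ 0 := by
  induction σ using perm_induction with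
  | one => exact hid
  | step σ i h ih =>
    rw [Equiv.Perm.coe_mul, hz.comp_adjSwap h, neg_ne_zero]
    exact smul_ne_zero (kappa_ne_zero hq _ _) ih

theorem AntiSym.eq_smul (h2 : (2 : F) ≠ 0) (hz : AntiSym q z) {η : (Fin N → Fin N) → F}
    (hη : AntiSym q η) (h1 : η id = 1) (g : Fin N → Fin N) : z g = η g • z id := by
  have hw : AntiSym q fun g => z g - η g • z id := by
    intro i h g
    simp only
    rw [hz i h g, hη i h g]
    simp only [smul_eq_mul, neg_smul, mul_smul, smul_sub]
    abel
  exact sub_eq_zero.mp (congrFun (hw.eq_zero h2 (by simp [h1])) g)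

end AntiSym

section Antisymmetrizer

variable {F : Type} [Field F] {q : F} {N : ℕ}
  {Pq : Equiv.Perm (Fin N) → Matrix (Fin N → Fin N) (Fin N → Fin N) F}

theorem vecMul_big2 {i j : Fin N} (hij : i ≠ j) (q : F) (z : (Fin N → Fin N) → F)
    (g : Fin N → Fin N) :
    Matrix.vecMul z (big2 F i j (PqSmall F q N)) g
      = kappa q (g i) (g j) * z (g ∘ Equiv.swap i j) := by
  have := vecMul_permutation hij q z g
  rw [smul_eq_mul] at this
  rw [big2_eq_emb2, ← this]
  rfl

theorem big2_mul_self (hq : q ≠ 0) {i j : Fin N} (hij : i ≠ j) :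
    big2 F i j (PqSmall F q N) * big2 F i j (PqSmall F q N) = 1 := by
  refine matrix_ext_of_vecMul fun z g => ?_
  rw [← Matrix.vecMul_vecMul, vecMul_big2 hij, vecMul_big2 hij, Matrix.vecMul_one]
  have : (g ∘ Equiv.swap i j) ∘ Equiv.swap i j = g := by ext x; simp
  rw [this, ← mul_assoc]
  simp [kappa_mul_kappa hq]

theorem pqExt_mul_adjSwap (hq : q ≠ 0) (hP : PqExt F q N N Pq) (σ : Equiv.Perm (Fin N)) {i : ℕ}
    (h : i + 1 < N) :
    Pq (σ * adjSwap h)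
      = Pq σ * big2 F ⟨i, Nat.lt_of_succ_lt h⟩ ⟨i + 1, h⟩ (PqSmall F q N) := by
  have hne : σ ⟨i, Nat.lt_of_succ_lt h⟩ ≠ σ ⟨i + 1, h⟩ := fun he =>
    fin_ne_succ h (σ.injective he)
  rcases lt_or_gt_of_ne hne with hlt | hlt
  · exact hP.2 σ i h (invCount_mul_adjSwap h σ hlt)
  · have := hP.2 (σ * adjSwap h) i h (invCount_mul_adjSwap h _ (by simpa using hlt))
    rw [mul_assoc, Equiv.swap_mul_self, mul_one] at this
    rw [this, mul_assoc, big2_mul_self hq (fin_ne_succ h), mul_one]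

theorem pqExt_row_id_eq_zero (hq : q ≠ 0) (hP : PqExt F q N N Pq) (σ : Equiv.Perm (Fin N))
    (g : Fin N → Fin N) (hg : g ≠ σ) : Pq σ id g = 0 := by
  induction σ using perm_induction generalizing g with
  | one =>
    rw [hP.1, Matrix.one_apply_ne]
    exact fun he => hg he.symm
  | step σ i h ih =>
    have hrow := vecMul_big2 (fin_ne_succ h) q (Pq σ id) g
    rw [pqExt_mul_adjSwap hq hP, Matrix.mul_apply_eq_vecMul, hrow, ih, mul_zero]
    intro he
    apply hg
    rw [Equiv.Perm.coe_mul, ← he]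
    ext x; simp

/-- The row of the q-antisymmetrizer indexed by the identity. -/
def eta (Pq : Equiv.Perm (Fin N) → Matrix (Fin N → Fin N) (Fin N → Fin N) F) :
    (Fin N → Fin N) → F := fun g => AqM F Pq id g

theorem eta_id (hq : q ≠ 0) (hP : PqExt F q N N Pq) : eta Pq id = 1 := by
  simp only [eta, AqM, Matrix.sum_apply, Matrix.smul_apply]
  rw [Finset.sum_eq_single 1]
  · simp [hP.1]
  · intro σ _ hσ
    rw [pqExt_row_id_eq_zero hq hP σ, smul_zero]
    intro he
    exact hσ (Equiv.ext fun x => (congrFun he x).symm)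
  · simp

theorem AqM_mul_adjSwap (hq : q ≠ 0) (hP : PqExt F q N N Pq) {i : ℕ} (h : i + 1 < N) :
    AqM F Pq * big2 F ⟨i, Nat.lt_of_succ_lt h⟩ ⟨i + 1, h⟩ (PqSmall F q N) = -AqM F Pq := by
  simp only [AqM, Finset.sum_mul, smul_mul_assoc, ← pqExt_mul_adjSwap hq hP _ h]
  rw [← Finset.sum_neg_distrib, ← Equiv.sum_comp (Equiv.mulRight (adjSwap h))]
  refine Finset.sum_congr rfl fun σ _ => ?_
  simp only [Equiv.coe_mulRight, mul_assoc, Equiv.swap_mul_self, mul_one, Equiv.Perm.sign_mul,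
    Equiv.Perm.sign_swap (fin_ne_succ h)]
  simp

theorem antiSym_eta (hq : q ≠ 0) (hP : PqExt F q N N Pq) : AntiSym q (eta Pq) := by
  intro i h g
  have h1 := vecMul_big2 (fin_ne_succ h) q (AqM F Pq id) g
  rw [← Matrix.mul_apply_eq_vecMul, AqM_mul_adjSwap hq hP h, Matrix.neg_apply] at h1
  rw [smul_eq_mul]
  exact neg_eq_iff_eq_neg.mp h1

end Antisymmetrizer


section RMatrix

variable {F : Type} [Field F] {N : ℕ} {ι C : Type} [Fintype ι] [DecidableEq ι] [CommRing C]
  [Algebra F C]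

/-- The R-matrix `α R̃ - β R`. -/
def RM (q : F) (N : ℕ) (α β : C) : Matrix (Fin N × Fin N) (Fin N × Fin N) C :=
  α • liftF F (Rtil F q N) - β • liftF F (Rc F q N)

/-- The operator `1 - P^q`. -/
def EM (q : F) (N : ℕ) (B : Type) [Ring B] [Algebra F B] :
    Matrix (Fin N × Fin N) (Fin N × Fin N) B :=
  1 - liftF F (PqSmall F q N)

/-- Diagonal weights of `α R̃ - β R`. -/
def wDiag (q : F) (α β : C) (i j : Fin N) : C :=
  if i = j then α * algebraMap F C q⁻¹ - β * algebraMap F C q else α - β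

/-- Off-diagonal weights of `α R̃ - β R`. -/
def wOff (q : F) (α β : C) (i j : Fin N) : C :=
  if i < j then α * (algebraMap F C q⁻¹ - algebraMap F C q)
  else if j < i then -(β * (algebraMap F C q - algebraMap F C q⁻¹)) else 0

theorem RM_apply (q : F) (α β : C) (p r : Fin N × Fin N) :
    RM q N α β p r = (if p = r then wDiag q α β r.1 r.2 else 0)
      + (if p = r.swap then wOff q α β r.1 r.2 else 0) := by
  obtain ⟨a, b⟩ := p
  obtain ⟨c, d⟩ := r
  simp only [RM, liftF, Rtil, Rc, wDiag, wOff, Matrix.sub_apply, Matrix.smul_apply,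
    Matrix.map_apply, Matrix.of_apply, Prod.mk.injEq, Prod.swap_prod_mk, map_add, smul_eq_mul]
  by_cases h1 : a = c ∧ b = d
  · obtain ⟨rfl, rfl⟩ := h1
    rcases lt_trichotomy a b with h | h | h
    · simp [h.ne, h.ne', h.not_gt, h]
    · subst h; simp
    · simp [h.ne, h.ne', h.not_gt, h]
  · by_cases h2 : a = d ∧ b = c
    · obtain ⟨rfl, rfl⟩ := h2
      rcases lt_trichotomy a b with h | h | h
      · simp [h.ne, h.ne', h.not_gt, h]
      · subst h; simp at h1
      · simp [h.ne, h.ne', h.not_gt, h]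
    · have h3 : ∀ P : Prop, ¬ (a = d ∧ b = c ∧ P) := fun P h => h2 ⟨h.1, h.2.1⟩
      simp [h1, h2, h3]

theorem vecMul_RM {i j : ι} (hij : i ≠ j) (q : F) (α β : C) (z : (ι → Fin N) → C)
    (g : ι → Fin N) :
    Matrix.vecMul z (emb2 i j (RM q N α β)) g
      = wDiag q α β (g i) (g j) * z g + wOff q α β (g i) (g j) * z (g ∘ Equiv.swap i j) := by
  rw [vecMul_emb2 hij]
  simp only [RM_apply, mul_add, Finset.sum_add_distrib, mul_ite, mul_zero, Finset.sum_ite_eq',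
    Finset.mem_univ, if_true, Prod.swap_prod_mk]
  rw [upd2_self hij, upd2_swap hij, mul_comm, mul_comm (z (g ∘ _))]

theorem vecMul_EM {B : Type} [Ring B] [Algebra F B] {i j : ι} (hij : i ≠ j) (q : F)
    (z : (ι → Fin N) → B) (g : ι → Fin N) :
    Matrix.vecMul z (emb2 i j (EM q N B)) g
      = z g - kappa q (g i) (g j) • z (g ∘ Equiv.swap i j) := by
  have h1 : emb2 i j (1 : Matrix (Fin N × Fin N) (Fin N × Fin N) B) = 1 := by
    refine matrix_ext_of_vecMul fun z g => ?_
    rw [vecMul_emb2 hij, Matrix.vecMul_one]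
    simp [Matrix.one_apply, upd2_self hij]
  rw [EM, emb2_sub, h1, Matrix.vecMul_sub, Matrix.vecMul_one, Pi.sub_apply,
    vecMul_permutation hij]

/-- The Yang–Baxter equation with the second parameters specialised so that one of the
R-matrices degenerates to `1 - P^q`. -/
theorem yangBaxter {q : F} (hq : q ≠ 0) {o a b : ι} (hoa : o ≠ a) (hob : o ≠ b) (hab : a ≠ b)
    (α β : C) :
    emb2 a b (EM q N C) * (emb2 o b (RM q N α β) *
        emb2 o a (RM q N α (algebraMap F C q ^ 2 * β)))
      = emb2 o a (RM q N α (algebraMap F C q ^ 2 * β)) * emb2 o b (RM q N α β) *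
        emb2 a b (EM q N C) := by
  refine matrix_ext_of_vecMul fun z g => ?_
  have hqq : algebraMap F C q * algebraMap F C q⁻¹ = 1 := by
    rw [← map_mul, mul_inv_cancel₀ hq, map_one]
  have hκ : ∀ i j : Fin N, algebraMap F C (kappa q i j)
      = if i = j then 1 else if i < j then algebraMap F C q else algebraMap F C q⁻¹ := by
    intro i j
    unfold kappa
    split_ifs <;> simp
  set Q := algebraMap F C q with hQ
  set Q' := algebraMap F C q⁻¹ with hQ'
  have s1 : ∀ g : ι → Fin N, (g ∘ Equiv.swap a b) o = g o := fun g => by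
    simp [Equiv.swap_apply_of_ne_of_ne hoa hob]
  have s2 : ∀ g : ι → Fin N, (g ∘ Equiv.swap o a) b = g b := fun g => by
    simp [Equiv.swap_apply_of_ne_of_ne hob.symm hab.symm]
  have s3 : ∀ g : ι → Fin N, (g ∘ Equiv.swap o b) a = g a := fun g => by
    simp [Equiv.swap_apply_of_ne_of_ne hoa.symm hab]
  have s4 : ∀ (g : ι → Fin N) (i j : ι), (g ∘ Equiv.swap i j) i = g j := fun g i j => by simp
  have s5 : ∀ (g : ι → Fin N) (i j : ι), (g ∘ Equiv.swap i j) j = g i := fun g i j => by simp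
  simp only [← Matrix.vecMul_vecMul, vecMul_RM hoa, vecMul_RM hob, vecMul_EM hab,
    Algebra.smul_def, s1, s2, s3, s4, s5]
  have p1 : Equiv.swap a b * Equiv.swap o b = Equiv.swap o a * Equiv.swap a b := by
    ext k
    simp only [Equiv.Perm.mul_apply, Equiv.swap_apply_def]
    grind
  have p2 : Equiv.swap o b * Equiv.swap a b = Equiv.swap a b * Equiv.swap o a := by
    ext k
    simp only [Equiv.Perm.mul_apply, Equiv.swap_apply_def]
    grind
  have p3 : Equiv.swap o a * Equiv.swap o b = Equiv.swap a b * Equiv.swap o a := by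
    ext k
    simp only [Equiv.Perm.mul_apply, Equiv.swap_apply_def]
    grind
  have p4 : Equiv.swap o b * Equiv.swap o a = Equiv.swap o a * Equiv.swap a b := by
    ext k
    simp only [Equiv.Perm.mul_apply, Equiv.swap_apply_def]
    grind
  have p5 : Equiv.swap o a * (Equiv.swap a b * Equiv.swap o a) = Equiv.swap o b := by
    rw [← p3, ← mul_assoc, Equiv.swap_mul_self, one_mul]
  have p6 : Equiv.swap a b * (Equiv.swap o a * Equiv.swap a b) = Equiv.swap o b := by
    rw [← p1, ← mul_assoc, Equiv.swap_mul_self, one_mul]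
  simp only [Function.comp_assoc, ← Equiv.Perm.coe_mul, mul_assoc (Equiv.swap _ _), p1, p2, p3, p4,
    p5, p6]
  have hfix : ∀ i j : ι, g i = g j → g ∘ ⇑(Equiv.swap i j) = g := by
    intro i j h
    funext k
    simp only [Function.comp_apply, Equiv.swap_apply_def]
    grind
  have e1 : g a = g b → z (g ∘ ⇑(Equiv.swap a b)) = z g ∧
      z (g ∘ ⇑(Equiv.swap a b * Equiv.swap o a)) = z (g ∘ ⇑(Equiv.swap o a)) ∧
      z (g ∘ ⇑(Equiv.swap o b)) = z (g ∘ ⇑(Equiv.swap o a * Equiv.swap a b)) := by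
    intro h
    have h' := hfix a b h
    refine ⟨by rw [h'], ?_, ?_⟩
    · rw [Equiv.Perm.coe_mul, ← Function.comp_assoc, h']
    · conv_lhs => rw [← p6, Equiv.Perm.coe_mul, ← Function.comp_assoc, h']
  have e2 : g o = g a → z (g ∘ ⇑(Equiv.swap o a)) = z g ∧
      z (g ∘ ⇑(Equiv.swap o a * Equiv.swap a b)) = z (g ∘ ⇑(Equiv.swap a b)) ∧
      z (g ∘ ⇑(Equiv.swap o b)) = z (g ∘ ⇑(Equiv.swap a b * Equiv.swap o a)) := by
    intro h
    have h' := hfix o a h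
    refine ⟨by rw [h'], ?_, ?_⟩
    · rw [Equiv.Perm.coe_mul, ← Function.comp_assoc, h']
    · conv_lhs => rw [← p5, Equiv.Perm.coe_mul, ← Function.comp_assoc, h']
  have e3 : g o = g b → z (g ∘ ⇑(Equiv.swap o b)) = z g ∧
      z (g ∘ ⇑(Equiv.swap o a)) = z (g ∘ ⇑(Equiv.swap o a * Equiv.swap a b)) ∧
      z (g ∘ ⇑(Equiv.swap a b)) = z (g ∘ ⇑(Equiv.swap a b * Equiv.swap o a)) := by
    intro h
    have h' := hfix o b h
    refine ⟨by rw [h'], ?_, ?_⟩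
    · rw [← p4, Equiv.Perm.coe_mul, ← Function.comp_assoc, h']
    · rw [← p2, Equiv.Perm.coe_mul, ← Function.comp_assoc, h']
  clear hfix
  generalize z g = z0 at *
  generalize z (g ∘ ⇑(Equiv.swap a b)) = z1 at *
  generalize z (g ∘ ⇑(Equiv.swap o a)) = z2 at *
  generalize z (g ∘ ⇑(Equiv.swap o b)) = z3 at *
  generalize z (g ∘ ⇑(Equiv.swap a b * Equiv.swap o a)) = z4 at *
  generalize z (g ∘ ⇑(Equiv.swap o a * Equiv.swap a b)) = z5 at *
  generalize g o = x at *
  generalize g a = y at *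
  generalize g b = w at *
  simp only [wDiag, wOff, hκ, ← hQ, ← hQ']
  clear_value Q Q'
  clear s1 s2 s3 s4 s5 p1 p2 p3 p4 p5 p6 hκ hQ hQ'
  rcases eq_or_ne x y with hxy | hxy
  · obtain ⟨rfl, rfl, rfl⟩ := e2 hxy
    clear e2
    subst hxy
    rcases lt_trichotomy x w with h | h | h
    · clear e1 e3
      simp [h, h.ne, h.ne', h.not_gt]
      grind
    · subst h
      obtain ⟨rfl, rfl, -⟩ := e1 rfl
      clear e1 e3
      simp
      try grind
    · clear e1 e3
      simp [h, h.ne, h.ne', h.not_gt]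
      grind
  rcases eq_or_ne x w with hxw | hxw
  · obtain ⟨rfl, rfl, rfl⟩ := e3 hxw
    clear e1 e2 e3
    subst hxw
    rcases lt_or_gt_of_ne hxy with h | h <;>
    · simp [h, h.ne, h.ne', h.not_gt]
      grind
  rcases eq_or_ne y w with hyw | hyw
  · obtain ⟨rfl, rfl, rfl⟩ := e1 hyw
    clear e1 e2 e3
    subst hyw
    rcases lt_or_gt_of_ne hxy with h | h <;>
    · simp [h, h.ne, h.ne', h.not_gt]
      grind
  clear e1 e2 e3
  rcases lt_or_gt_of_ne hxy with h1 | h1 <;> rcases lt_or_gt_of_ne hyw with h2 | h2 <;>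
    rcases lt_or_gt_of_ne hxw with h3 | h3 <;> (try exact absurd h1 (by omega)) <;>
    simp [*, ne_of_lt, ne_of_gt, not_lt_of_gt] <;> grind

end RMatrix

section Fusion

variable {F V : Type} [Field F] [AddCommGroup V] [Module F V] {N : ℕ} {ι : Type} [DecidableEq ι]

/-- `q`-antisymmetry under the exchange of the sites `i` and `j`. -/
def AntiAt (q : F) (i j : ι) (z : (ι → Fin N) → V) : Prop :=
  ∀ g, z g = -(kappa q (g i) (g j) • z (g ∘ Equiv.swap i j))

variable [Fintype ι] {B : Type} [Ring B] [Algebra F B]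

theorem AntiAt.vecMul_of_semiconjBy {q : F} (hq : q ≠ 0) (h2 : (2 : F) ≠ 0) {i j : ι}
    (hij : i ≠ j) {z : (ι → Fin N) → B} (hz : AntiAt q i j z)
    {W W' : Matrix (ι → Fin N) (ι → Fin N) B} (hW : SemiconjBy (emb2 i j (EM q N B)) W W') :
    AntiAt q i j (Matrix.vecMul z W) := by
  have hzE : Matrix.vecMul z (emb2 i j (EM q N B)) = (2 : F) • z := by
    funext g
    rw [vecMul_EM hij, Pi.smul_apply, two_smul]
    nth_rewrite 3 [hz g]
    abel
  have hy : (2 : F) • Matrix.vecMul z W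
      = Matrix.vecMul (Matrix.vecMul z W') (emb2 i j (EM q N B)) := by
    rw [Matrix.vecMul_vecMul, ← hW.eq, ← Matrix.vecMul_vecMul, hzE, Matrix.smul_vecMul]
  intro g
  apply smul_right_injective B h2
  have h1 := congrFun hy g
  have h3 := congrFun hy (g ∘ Equiv.swap i j)
  simp only [Pi.smul_apply] at h1 h3
  have hss : (g ∘ Equiv.swap i j) ∘ Equiv.swap i j = g := by ext x; simp
  simp only
  rw [smul_neg, smul_comm (2 : F), h1, h3, vecMul_EM hij, vecMul_EM hij, hss]
  simp only [Function.comp_apply, Equiv.swap_apply_left, Equiv.swap_apply_right, smul_sub,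
    smul_smul, kappa_mul_kappa hq, one_smul]
  abel

theorem semiconjBy_prod_of_adjacent {R κ : Type} [Monoid R] {f : κ → R} {e : R} {l l' : List κ}
    {a b : κ} (h : ∀ c ∈ l, Commute e (f c)) (h' : ∀ c ∈ l', Commute e (f c))
    (hab : SemiconjBy e (f a * f b) (f b * f a)) :
    SemiconjBy e ((l ++ a :: b :: l').map f).prod ((l ++ b :: a :: l').map f).prod := by
  have hl : ∀ l : List κ, (∀ c ∈ l, Commute e (f c)) → Commute e (l.map f).prod := by
    intro l hl
    refine Commute.list_prod_right _ _ fun x hx => ?_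
    obtain ⟨c, hc, rfl⟩ := List.mem_map.mp hx
    exact hl c hc
  simp only [List.map_append, List.map_cons, List.prod_append, List.prod_cons]
  rw [← mul_assoc (f a), ← mul_assoc (f b)]
  exact SemiconjBy.mul_right (hl l h) (hab.mul_right (hl l' h'))

theorem finRange_split {i : ℕ} (h : i + 1 < N) : ∃ l l' : List (Fin N),
    List.finRange N = l ++ ⟨i, Nat.lt_of_succ_lt h⟩ :: ⟨i + 1, h⟩ :: l' ∧
    (∀ c ∈ l, c ≠ ⟨i, Nat.lt_of_succ_lt h⟩ ∧ c ≠ ⟨i + 1, h⟩) ∧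
    ∀ c ∈ l', c ≠ ⟨i, Nat.lt_of_succ_lt h⟩ ∧ c ≠ ⟨i + 1, h⟩ := by
  have hs : List.finRange N = (List.finRange N).take i ++
      ⟨i, Nat.lt_of_succ_lt h⟩ :: ⟨i + 1, h⟩ :: (List.finRange N).drop (i + 1 + 1) := by
    conv_lhs => rw [← List.take_append_drop i (List.finRange N)]
    rw [List.drop_eq_getElem_cons (by simp; omega), List.drop_eq_getElem_cons (by simpa using h)]
    simp
  refine ⟨_, _, hs, ?_⟩
  have hn := List.nodup_finRange N
  rw [hs] at hn
  simp only [List.nodup_append, List.nodup_cons, List.mem_cons] at hn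
  obtain ⟨-, ⟨h1, h2, -⟩, h3⟩ := hn
  push Not at h1
  refine ⟨fun c hc => ⟨h3 c hc _ (Or.inl rfl), h3 c hc _ (Or.inr (Or.inl rfl))⟩,
    fun c hc => ⟨?_, ?_⟩⟩
  · rintro rfl; exact h1.2 hc
  · rintro rfl; exact h2 hc

end Fusion

section Rows

variable {B : Type} [Ring B] {N : ℕ}

/-- The row vector `e_l ⊗ z`. -/
def consRow (l : Fin N) (z : (Fin N → Fin N) → B) : (Option (Fin N) → Fin N) → B :=
  fun f => if f none = l then z (f ∘ some) else 0

/-- Extend a multi-index by a value at the additional site. -/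
def consFn (k : Fin N) (g : Fin N → Fin N) : Option (Fin N) → Fin N := fun o => o.elim k g

theorem consFn_eta (f : Option (Fin N) → Fin N) : consFn (f none) (f ∘ some) = f := by
  funext o
  cases o <;> rfl

theorem consRow_consFn (l k : Fin N) (z : (Fin N → Fin N) → B) (g : Fin N → Fin N) :
    consRow l z (consFn k g) = if k = l then z g else 0 := rfl

theorem swap_some_comp (f : Option (Fin N) → Fin N) (a b : Fin N) :
    (f ∘ Equiv.swap (some a) (some b)) ∘ some = (f ∘ some) ∘ Equiv.swap a b := by
  funext c
  simp only [Function.comp_apply, Equiv.swap_apply_def, Option.some.injEq]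
  split_ifs <;> rfl

theorem swap_some_none (f : Option (Fin N) → Fin N) (a b : Fin N) :
    (f ∘ Equiv.swap (some a) (some b)) none = f none := by
  simp [Equiv.swap_apply_of_ne_of_ne]

theorem vecMul_consRow_emb1_some (l a : Fin N) (z : (Fin N → Fin N) → B)
    (M : Matrix (Fin N) (Fin N) B) :
    Matrix.vecMul (consRow l z) (emb1 (some a) M) = consRow l (Matrix.vecMul z (emb1 a M)) := by
  funext f
  simp only [vecMul_emb1, consRow, Function.update_of_ne (Option.some_ne_none a).symm]
  split_ifs
  · refine Finset.sum_congr rfl fun k _ => ?_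
    congr 2
    funext c
    simp [Function.update_apply]
  · simp

theorem vecMul_consRow_prod (l : Fin N) (z : (Fin N → Fin N) → B)
    (M : Fin N → Matrix (Fin N) (Fin N) B) (L : List (Fin N)) :
    Matrix.vecMul (consRow l z) (L.map fun a => emb1 (some a) (M a)).prod
      = consRow l (Matrix.vecMul z (L.map fun a => emb1 a (M a)).prod) := by
  induction L generalizing z with
  | nil => simp
  | cons a t ih =>
    simp only [List.map_cons, List.prod_cons, ← Matrix.vecMul_vecMul]
    rw [vecMul_consRow_emb1_some, ih]

theorem AntiAt.consRow {F : Type} [Field F] [Algebra F B] {q : F} {a b : Fin N}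
    {z : (Fin N → Fin N) → B} (hz : AntiAt q a b z) (l : Fin N) :
    AntiAt q (some a) (some b) (consRow l z) := by
  intro f
  simp only [Sklyanin.consRow, swap_some_comp, swap_some_none]
  split_ifs
  · exact hz _
  · simp

theorem AntiAt.comp_consFn {F : Type} [Field F] [Algebra F B] {q : F} {a b : Fin N}
    {y : (Option (Fin N) → Fin N) → B} (hy : AntiAt q (some a) (some b) y) (k : Fin N) :
    AntiAt q a b fun g => y (consFn k g) := by
  intro g
  have h := hy (consFn k g)
  rw [← consFn_eta (consFn k g ∘ _), swap_some_comp, swap_some_none] at h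
  exact h

end Rows

section Eigen

variable {F : Type} [Field F] {N : ℕ} {C : Type} [CommRing C] [Algebra F C]

theorem vecMul_RM_prod_eq_zero (q : F) (α : C) (β : Fin N → C) {ε : (Option (Fin N) → Fin N) → C}
    (hε : ∀ f, ¬ Function.Injective (f ∘ some) → ε f = 0) (t : List (Fin N)) {a b : Fin N}
    (hab : a ≠ b) (ha : a ∉ t) (hb : b ∉ t) (g : Option (Fin N) → Fin N)
    (hg : g (some a) = g (some b)) :
    Matrix.vecMul ε (t.reverse.map fun c => emb2 none (some c) (RM q N α (β c))).prod g = 0 := by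
  induction t generalizing g with
  | nil =>
    rw [List.reverse_nil, List.map_nil, List.prod_nil, Matrix.vecMul_one]
    exact hε g fun hi => hab (hi hg)
  | cons c t ih =>
    simp only [List.mem_cons, not_or] at ha hb
    have ha' : some a ≠ some c := fun h => ha.1 (Option.some_injective _ h)
    have hb' : some b ≠ some c := fun h => hb.1 (Option.some_injective _ h)
    rw [List.reverse_cons, List.map_append, List.prod_append, List.map_singleton,
      List.prod_singleton, ← Matrix.vecMul_vecMul, vecMul_RM (Option.some_ne_none c).symm,
      ih ha.2 hb.2 g hg, ih ha.2 hb.2 (g ∘ _), mul_zero, mul_zero, add_zero]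
    simp [Equiv.swap_apply_of_ne_of_ne, ha', hb', hg]

theorem vecMul_RM_prod (q : F) (α : C) (β : Fin N → C) {ε : (Option (Fin N) → Fin N) → C}
    (hε : ∀ f, ¬ Function.Injective (f ∘ some) → ε f = 0) (t : List (Fin N)) {z : Fin N}
    (hz : z ∉ t) (ht : t.Nodup) (g : Option (Fin N) → Fin N) (hi : Function.Injective (g ∘ some))
    (hg : g none = g (some z)) :
    Matrix.vecMul ε (t.reverse.map fun c => emb2 none (some c) (RM q N α (β c))).prod g
      = (t.map fun c => α - β c).prod * ε g := by
  induction t with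
  | nil => simp
  | cons c t ih =>
    simp only [List.mem_cons, not_or] at hz
    rw [List.nodup_cons] at ht
    have hz' : some z ≠ some c := fun h => hz.1 (Option.some_injective _ h)
    have hne : g none ≠ g (some c) := by
      rw [hg]
      exact fun h => hz.1 (hi h)
    rw [List.reverse_cons, List.map_append, List.prod_append, List.map_singleton,
      List.prod_singleton, ← Matrix.vecMul_vecMul, vecMul_RM (Option.some_ne_none c).symm,
      ih hz.2 ht.2, vecMul_RM_prod_eq_zero q α β hε t hz.1 hz.2 ht.1, mul_zero, add_zero, wDiag,
      if_neg hne, List.map_cons, List.prod_cons, mul_assoc]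
    simp [Equiv.swap_apply_of_ne_of_ne, hz', hg]

/-- The scalar by which the product of the R-matrices acts. -/
def eigenScalar (q : F) (α : C) (β : Fin N → C) : C :=
  match List.finRange N with
  | [] => 1
  | z :: t => (α * algebraMap F C q⁻¹ - β z * algebraMap F C q) * (t.map fun c => α - β c).prod

theorem semiconjBy_RM_prod {q : F} (hq : q ≠ 0) (α : C) (β : Fin N → C)
    (hβ : ∀ (i : ℕ) (h : i + 1 < N),
      β ⟨i, Nat.lt_of_succ_lt h⟩ = algebraMap F C q ^ 2 * β ⟨i + 1, h⟩) {i : ℕ} (h : i + 1 < N) :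
    ∃ W', SemiconjBy (emb2 (some ⟨i, Nat.lt_of_succ_lt h⟩) (some ⟨i + 1, h⟩) (EM q N C))
      ((List.finRange N).reverse.map fun c => emb2 none (some c) (RM q N α (β c))).prod W' := by
  obtain ⟨l, l', hs, hl, hl'⟩ := finRange_split h
  have hn : ∀ c : Fin N, (none : Option (Fin N)) ≠ some c := fun c => (Option.some_ne_none c).symm
  have hsome : ∀ {c d : Fin N}, c ≠ d → some c ≠ some d := fun hcd =>
    (Option.some_injective _).ne hcd
  have hcomm : ∀ c : Fin N, c ≠ ⟨i, Nat.lt_of_succ_lt h⟩ ∧ c ≠ ⟨i + 1, h⟩ →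
      Commute (emb2 (some ⟨i, Nat.lt_of_succ_lt h⟩) (some ⟨i + 1, h⟩) (EM q N C))
        (emb2 none (some c) (RM q N α (β c))) := fun c hc =>
    commute_emb2_emb2 (hsome (fin_ne_succ h)) (hn c) (hn _) (hn _) (hsome hc.1) (hsome hc.2) _ _
      fun _ _ _ _ => Commute.all _ _
  have hrev : (List.finRange N).reverse
      = l'.reverse ++ ⟨i + 1, h⟩ :: ⟨i, Nat.lt_of_succ_lt h⟩ :: l.reverse := by
    rw [hs]
    simp
  rw [hrev]
  refine ⟨_, semiconjBy_prod_of_adjacent (fun c hc => hcomm c (hl' c (List.mem_reverse.mp hc)))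
    (fun c hc => hcomm c (hl c (List.mem_reverse.mp hc))) ?_⟩
  have hyb := yangBaxter (N := N) hq (hn ⟨i, Nat.lt_of_succ_lt h⟩) (hn ⟨i + 1, h⟩)
    (hsome (fin_ne_succ h)) α (β ⟨i + 1, h⟩)
  rw [← hβ i h] at hyb
  exact hyb

theorem vecMul_consRow_RM_prod {q : F} (hq : q ≠ 0) (h2 : (2 : F) ≠ 0) (α : C) (β : Fin N → C)
    (hβ : ∀ (i : ℕ) (h : i + 1 < N),
      β ⟨i, Nat.lt_of_succ_lt h⟩ = algebraMap F C q ^ 2 * β ⟨i + 1, h⟩)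
    {η : (Fin N → Fin N) → F} (hη : AntiSym q η) (h1 : η id = 1) (l : Fin N) :
    Matrix.vecMul (consRow l fun g => algebraMap F C (η g))
        ((List.finRange N).reverse.map fun c => emb2 none (some c) (RM q N α (β c))).prod
      = eigenScalar q α β • consRow l fun g => algebraMap F C (η g) := by
  have hηC : AntiSym q fun g => algebraMap F C (η g) := by
    intro i h g
    simp only
    rw [hη i h g, map_neg, smul_eq_mul, map_mul, Algebra.smul_def]
  set ε : (Option (Fin N) → Fin N) → C := consRow l fun g => algebraMap F C (η g) with hε
  set y := Matrix.vecMul ε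
    ((List.finRange N).reverse.map fun c => emb2 none (some c) (RM q N α (β c))).prod with hy
  have hεi : ∀ f, ¬ Function.Injective (f ∘ some) → ε f = 0 := by
    intro f hf
    rw [hε, consRow, hηC.eq_zero_of_not_injective h2 _ hf, ite_self]
  have hyanti : ∀ k, AntiSym q fun g => y (consFn k g) := by
    intro k i h
    obtain ⟨W', hW'⟩ := semiconjBy_RM_prod hq α β hβ h
    refine AntiAt.comp_consFn (a := ⟨i, Nat.lt_of_succ_lt h⟩) (b := ⟨i + 1, h⟩) ?_ k
    exact AntiAt.vecMul_of_semiconjBy hq h2 ((Option.some_injective _).ne (fin_ne_succ h))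
      (AntiAt.consRow (hηC i h) l) hW'
  funext f
  rw [← consFn_eta f]
  generalize f none = k
  generalize f ∘ some = g
  have hyk := fun g => (hyanti k).eq_smul h2 hη h1 g
  rw [hyk g, Pi.smul_apply, hε, consRow_consFn]
  suffices hk : y (consFn k id) = if k = l then eigenScalar q α β else 0 by
    rw [hk]
    split_ifs
    · rw [Algebra.smul_def, smul_eq_mul, mul_comm]
    · simp
  obtain ⟨z, t, hzt⟩ : ∃ z t, List.finRange N = z :: t :=
    List.exists_cons_of_ne_nil (List.ne_nil_of_mem (List.mem_finRange k))
  have hnd := List.nodup_finRange N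
  rw [hzt, List.nodup_cons] at hnd
  set σ : Equiv.Perm (Fin N) := Equiv.swap z k with hσ
  have hval : y (consFn k σ) = eigenScalar q α β * ε (consFn k σ) := by
    rw [hy, hzt, List.reverse_cons, List.map_append, List.prod_append, List.map_singleton,
      List.prod_singleton, ← Matrix.vecMul_vecMul, vecMul_RM (Option.some_ne_none z).symm,
      vecMul_RM_prod q α β hεi t hnd.1 hnd.2 (consFn k σ) σ.injective (by simp [consFn, hσ])]
    have heq : consFn k σ none = consFn k σ (some z) := by simp [consFn, hσ]
    simp only [heq, wDiag, wOff, if_true, lt_irrefl, if_false, zero_mul, add_zero]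
    rw [eigenScalar, hzt, mul_assoc]
  have hne := hη.perm_ne_zero hq (by rw [h1]; exact one_ne_zero) σ
  have hun : IsUnit (algebraMap F C (η σ)) := (isUnit_iff_ne_zero.mpr hne).map _
  rw [hyk σ, hε, consRow_consFn, Algebra.smul_def] at hval
  refine hun.mul_left_cancel ?_
  rw [hval]
  split_ifs
  · rw [mul_comm]
  · simp

end Eigen

section Transfer

variable {F : Type} [Field F] {N : ℕ}

theorem prod_mul_prod_reverse {R κ : Type} [Monoid R] {r m : κ → R} {x : R} {l : List κ}
    (hl : l.Nodup) (hrxm : ∀ a ∈ l, r a * x * m a = m a * x * r a)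
    (hcomm : ∀ a ∈ l, ∀ b ∈ l, a ≠ b → Commute (r a) (m b)) :
    (l.reverse.map r).prod * x * (l.map m).prod = (l.map m).prod * x * (l.reverse.map r).prod := by
  induction l generalizing x with
  | nil => simp
  | cons a t ih =>
    rw [List.nodup_cons] at hl
    have hra : Commute (r a) (t.map m).prod := by
      refine Commute.list_prod_right _ _ fun y hy => ?_
      obtain ⟨b, hb, rfl⟩ := List.mem_map.mp hy
      exact hcomm a (by simp) b (by simp [hb]) (by rintro rfl; exact hl.1 hb)
    have hma : Commute (m a) (t.reverse.map r).prod := by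
      refine Commute.list_prod_right _ _ fun y hy => ?_
      obtain ⟨b, hb, rfl⟩ := List.mem_map.mp hy
      have hb' := List.mem_reverse.mp hb
      exact (hcomm b (by simp [hb']) a (by simp) (by rintro rfl; exact hl.1 hb')).symm
    have iht := ih (x := x) hl.2 (fun b hb => hrxm b (by simp [hb]))
      fun b hb c hc => hcomm b (by simp [hb]) c (by simp [hc])
    simp only [List.reverse_cons, List.map_append, List.prod_append, List.map_cons, List.map_nil,
      List.prod_cons, List.prod_nil, mul_one]
    calc (t.reverse.map r).prod * r a * x * (m a * (t.map m).prod)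
        = (t.reverse.map r).prod * (r a * x * m a) * (t.map m).prod := by simp only [mul_assoc]
      _ = (t.reverse.map r).prod * m a * x * (r a * (t.map m).prod) := by
          rw [hrxm a (by simp)]; simp only [mul_assoc]
      _ = m a * ((t.reverse.map r).prod * x * (t.map m).prod) * r a := by
          rw [← hma.eq, hra.eq]; simp only [mul_assoc]
      _ = _ := by rw [iht]; simp only [mul_assoc]

variable {B : Type} [Ring B] [Algebra F B]

theorem vecMul_eta_prod {q : F} (hq : q ≠ 0) (h2 : (2 : F) ≠ 0) {η : (Fin N → Fin N) → F}
    (hη : AntiSym q η) (h1 : η id = 1) (M : Fin N → Matrix (Fin N) (Fin N) B)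
    (hM : ∀ (i : ℕ) (h : i + 1 < N),
      EM q N B * (amp1 (M ⟨i, Nat.lt_of_succ_lt h⟩) * amp2 (M ⟨i + 1, h⟩))
        = amp2 (M ⟨i + 1, h⟩) * amp1 (M ⟨i, Nat.lt_of_succ_lt h⟩) * EM q N B)
    (g : Fin N → Fin N) :
    Matrix.vecMul (fun g => algebraMap F B (η g))
        ((List.finRange N).map fun a => emb1 a (M a)).prod g
      = η g • Matrix.vecMul (fun g => algebraMap F B (η g))
        ((List.finRange N).map fun a => emb1 a (M a)).prod id := by
  refine AntiSym.eq_smul h2 (fun i h => ?_) hη h1 g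
  obtain ⟨l, l', hs, hl, hl'⟩ := finRange_split h
  have hne := fin_ne_succ h
  have hcomm : ∀ c : Fin N, c ≠ ⟨i, Nat.lt_of_succ_lt h⟩ ∧ c ≠ ⟨i + 1, h⟩ →
      Commute (emb2 ⟨i, Nat.lt_of_succ_lt h⟩ ⟨i + 1, h⟩ (EM q N B)) (emb1 c (M c)) := by
    intro c hc
    refine commute_emb2_emb1 hne hc.1 hc.2 _ _ fun a b c' d => ?_
    have : EM q N B a b = algebraMap F B ((1 - PqSmall F q N) a b) := by
      simp [EM, liftF, Matrix.one_apply, apply_ite (algebraMap F B)]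
    rw [this]
    exact Algebra.commute_algebraMap_left _ _
  have hsem := congrArg (emb2 (⟨i, Nat.lt_of_succ_lt h⟩ : Fin N) ⟨i + 1, h⟩) (hM i h)
  rw [emb2_mul hne, emb2_mul hne, emb2_mul hne, emb2_mul hne, emb2_amp1 hne, emb2_amp2 hne]
    at hsem
  change AntiAt q (⟨i, Nat.lt_of_succ_lt h⟩ : Fin N) ⟨i + 1, h⟩ _
  rw [hs]
  refine AntiAt.vecMul_of_semiconjBy hq h2 hne (fun g => ?_)
    (semiconjBy_prod_of_adjacent (fun c hc => hcomm c (hl c hc))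
      (fun c hc => hcomm c (hl' c hc)) hsem)
  rw [hη i h g, map_neg, smul_eq_mul, map_mul, Algebra.smul_def]

theorem vecMul_consRow_emb1_none (l : Fin N) (η : (Fin N → Fin N) → F)
    (X : Matrix (Fin N) (Fin N) B) :
    Matrix.vecMul (consRow l fun g => algebraMap F B (η g)) (emb1 none X)
      = ∑ k, X l k • consRow k fun g => algebraMap F B (η g) := by
  funext f
  rw [vecMul_emb1, Finset.sum_apply]
  have h : ∀ k, Function.update f none k ∘ some = f ∘ some := fun k => by
    funext c
    simp
  simp only [consRow, Function.update_self, h, Pi.smul_apply, smul_eq_mul, ite_mul, zero_mul,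
    mul_ite, mul_zero, Finset.sum_ite_eq, Finset.sum_ite_eq', Finset.mem_univ, if_true]
  exact Algebra.commutes _ _

/-- The quantum determinant of a fused family commutes with the entries of `X`, up to a scalar. -/
theorem eigenScalar_mul_commutator {q : F} (hq : q ≠ 0) (h2 : (2 : F) ≠ 0)
    {η : (Fin N → Fin N) → F} (hη : AntiSym q η) (h1 : η id = 1) {C : Type} [CommRing C]
    [Algebra F C] [Algebra C B] [IsScalarTower F C B] (α : C) (β : Fin N → C)
    (hβ : ∀ (i : ℕ) (h : i + 1 < N),
      β ⟨i, Nat.lt_of_succ_lt h⟩ = algebraMap F C q ^ 2 * β ⟨i + 1, h⟩)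
    (M : Fin N → Matrix (Fin N) (Fin N) B) (X : Matrix (Fin N) (Fin N) B)
    (hM : ∀ (i : ℕ) (h : i + 1 < N),
      EM q N B * (amp1 (M ⟨i, Nat.lt_of_succ_lt h⟩) * amp2 (M ⟨i + 1, h⟩))
        = amp2 (M ⟨i + 1, h⟩) * amp1 (M ⟨i, Nat.lt_of_succ_lt h⟩) * EM q N B)
    (hX : ∀ a, (RM q N α (β a)).map (algebraMap C B) * amp1 X * amp2 (M a)
      = amp2 (M a) * amp1 X * (RM q N α (β a)).map (algebraMap C B)) (i j : Fin N) :
    algebraMap C B (eigenScalar q α β) * (X i j *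
        Matrix.vecMul (fun g => algebraMap F B (η g))
          ((List.finRange N).map fun a => emb1 a (M a)).prod id)
      = algebraMap C B (eigenScalar q α β) * (Matrix.vecMul (fun g => algebraMap F B (η g))
          ((List.finRange N).map fun a => emb1 a (M a)).prod id * X i j) := by
  set D := Matrix.vecMul (fun g => algebraMap F B (η g))
    ((List.finRange N).map fun a => emb1 a (M a)).prod id with hD
  set c := algebraMap C B (eigenScalar q α β) with hc
  have hcc : ∀ b, c * b = b * c := fun b => Algebra.commutes _ _
  set ε : Fin N → (Option (Fin N) → Fin N) → B := fun l => consRow l fun g => algebraMap F B (η g)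
    with hε
  set r : Fin N → Matrix (Option (Fin N) → Fin N) (Option (Fin N) → Fin N) B := fun a =>
    emb2 none (some a) ((RM q N α (β a)).map (algebraMap C B)) with hr
  have hn : ∀ c : Fin N, (none : Option (Fin N)) ≠ some c := fun c => (Option.some_ne_none c).symm
  have heig : ∀ l, Matrix.vecMul (ε l) ((List.finRange N).reverse.map r).prod = c • ε l := by
    intro l
    have h := congrArg (fun v => algebraMap C B ∘ v)
      (vecMul_consRow_RM_prod hq h2 α β hβ hη h1 l)
    have hεC : algebraMap C B ∘ (consRow l fun g => algebraMap F C (η g)) = ε l := by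
      funext f
      simp only [hε, consRow, Function.comp_apply, apply_ite (algebraMap C B), map_zero,
        ← IsScalarTower.algebraMap_apply]
    have h' : algebraMap C B ∘ (eigenScalar q α β • consRow l fun g => algebraMap F C (η g))
        = c • ε l := by
      rw [← hεC]
      funext f
      simp [hc]
    rw [h'] at h
    rw [← h]
    funext f
    rw [Function.comp_apply, RingHom.map_vecMul, hεC]
    congr 1
    have := map_list_prod (algebraMap C B).mapMatrix
      ((List.finRange N).reverse.map fun c => emb2 none (some c) (RM q N α (β c)))
    rw [RingHom.mapMatrix_apply] at this
    rw [this, List.map_map]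
    congr 2
    funext a
    simp only [hr, Function.comp_apply, RingHom.mapMatrix_apply, map_emb2]
  have hdet : ∀ l, Matrix.vecMul (ε l) ((List.finRange N).map fun a => emb1 (some a) (M a)).prod
      = D • ε l := by
    intro l
    rw [hε, vecMul_consRow_prod]
    funext f
    simp only [consRow, Pi.smul_apply, smul_eq_mul, mul_ite, mul_zero]
    split_ifs
    · rw [vecMul_eta_prod hq h2 hη h1 M hM, Algebra.smul_def]
      exact Algebra.commutes _ _
    · rfl
  have hcommute : ∀ a b : Fin N, a ≠ b → Commute (r a) (emb1 (some b) (M b)) := by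
    intro a b hab
    refine commute_emb2_emb1 (hn a) (hn b).symm ((Option.some_injective _).ne hab.symm) _ _ ?_
    intro _ _ _ _
    exact Algebra.commute_algebraMap_left _ _
  have hloc : ∀ a, r a * emb1 none X * emb1 (some a) (M a)
      = emb1 (some a) (M a) * emb1 none X * r a := by
    intro a
    have h := congrArg (emb2 none (some a)) (hX a)
    rwa [emb2_mul (hn a), emb2_mul (hn a), emb2_mul (hn a), emb2_mul (hn a), emb2_amp1 (hn a),
      emb2_amp2 (hn a)] at h
  have htrans := prod_mul_prod_reverse (x := emb1 none X) (List.nodup_finRange N)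
    (fun a _ => hloc a) fun a _ b _ hab => hcommute a b hab
  have hrow := congrArg (fun W => Matrix.vecMul (ε i) W (consFn j id)) htrans
  have hsum : ∀ v : Fin N → B, (∑ k, v k • ε k) (consFn j id) = v j := by
    intro v
    simp [hε, consRow_consFn, h1]
  simp only [← Matrix.vecMul_vecMul] at hrow
  rw [heig, hdet, Matrix.smul_vecMul, Matrix.smul_vecMul, Matrix.smul_vecMul,
    Matrix.smul_vecMul] at hrow
  rw [vecMul_consRow_emb1_none i η X] at hrow
  simp only [Matrix.sum_vecMul, Matrix.smul_vecMul] at hrow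
  rw [show (∑ k, X i k • Matrix.vecMul (consRow k fun g => algebraMap F B (η g))
      ((List.finRange N).map fun a => emb1 (some a) (M a)).prod)
      = ∑ k, (X i k * D) • ε k from Finset.sum_congr rfl fun k _ => by rw [hdet k, smul_smul],
    show (∑ k, X i k • Matrix.vecMul (consRow k fun g => algebraMap F B (η g))
      ((List.finRange N).reverse.map r).prod)
      = ∑ k, (X i k * c) • ε k from Finset.sum_congr rfl fun k _ => by rw [heig k, smul_smul],
    Pi.smul_apply, Pi.smul_apply, hsum, hsum, smul_eq_mul, smul_eq_mul, ← hcc, ← mul_assoc D,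
    ← hcc, mul_assoc] at hrow
  exact hrow

end Transfer

section Entries

variable {F : Type} [Field F] {N : ℕ} {S : Type} [Ring S]

theorem mul_amp1_amp2_apply (K : Matrix (Fin N × Fin N) (Fin N × Fin N) S)
    (X Y : Matrix (Fin N) (Fin N) S) (p r : Fin N × Fin N) :
    (K * amp1 X * amp2 Y) p r = ∑ s, K p s * (X s.1 r.1 * Y s.2 r.2) := by
  have h : ∀ s, (amp1 X * amp2 Y) s r = X s.1 r.1 * Y s.2 r.2 := by
    intro s
    simp only [Matrix.mul_apply, amp1, amp2, Matrix.of_apply]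
    rw [Finset.sum_eq_single (r.1, s.2)]
    · simp
    · rintro ⟨a, b⟩ - hne
      simp only [ne_eq, Prod.mk.injEq, not_and] at hne
      by_cases hb : s.2 = b
      · by_cases ha : a = r.1
        · exact absurd hb.symm (hne ha)
        · simp [ha]
      · simp [hb]
    · simp
  rw [mul_assoc, Matrix.mul_apply]
  exact Finset.sum_congr rfl fun s _ => by rw [h]

theorem amp2_amp1_mul_apply (K : Matrix (Fin N × Fin N) (Fin N × Fin N) S)
    (X Y : Matrix (Fin N) (Fin N) S) (p r : Fin N × Fin N) :
    (amp2 Y * amp1 X * K) p r = ∑ s, Y p.2 s.2 * X p.1 s.1 * K s r := by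
  have h : ∀ s, (amp2 Y * amp1 X) p s = Y p.2 s.2 * X p.1 s.1 := by
    intro s
    simp only [Matrix.mul_apply, amp1, amp2, Matrix.of_apply]
    rw [Finset.sum_eq_single (p.1, s.2)]
    · simp
    · rintro ⟨a, b⟩ - hne
      simp only [ne_eq, Prod.mk.injEq, not_and] at hne
      by_cases ha : p.1 = a
      · have hb := hne ha.symm
        simp [hb]
      · simp [ha]
    · simp
  rw [Matrix.mul_apply]
  exact Finset.sum_congr rfl fun s _ => by rw [h]

/-- Exchange of the two families in an RTT relation by the transposed flip. -/
theorem rtt_flip {K : Matrix (Fin N × Fin N) (Fin N × Fin N) S} {X Y : Matrix (Fin N) (Fin N) S}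
    (hK : ∀ p r x, Commute (K p r) x) (hflip : ∀ p r, K r.swap p.swap = K p r)
    (h : K * amp1 X * amp2 Y = amp2 Y * amp1 X * K) :
    K * amp1 Y.transpose * amp2 X.transpose
      = amp2 X.transpose * amp1 Y.transpose * K := by
  ext p r
  have h' := congrFun (congrFun h r.swap) p.swap
  rw [mul_amp1_amp2_apply, amp2_amp1_mul_apply] at h'
  rw [mul_amp1_amp2_apply, amp2_amp1_mul_apply]
  rw [← (Equiv.prodComm (Fin N) (Fin N)).sum_comp] at h'
  conv_rhs at h' => rw [← (Equiv.prodComm (Fin N) (Fin N)).sum_comp]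
  simp only [Equiv.prodComm_apply, hflip, Prod.fst_swap, Prod.snd_swap] at h'
  simp only [Matrix.transpose_apply]
  calc _ = ∑ x, Y r.1 x.1 * X r.2 x.2 * K p x :=
        Finset.sum_congr rfl fun s _ => (hK p s _).eq
    _ = _ := h'.symm
    _ = _ := Finset.sum_congr rfl fun s _ => (hK s r _).eq

end Entries

section TwoVariable

variable {F A S : Type} [Field F] [Ring A] [Algebra F A] [Ring S] [Algebra F S]

/-- A specialisation of `A`-valued formal series in two commuting variables. -/
structure Specialization (F A S : Type) [Field F] [Ring A] [Algebra F A] [Ring S]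
    [Algebra F S] where
  (toFun : (ℕ → ℕ → A) →ₗ[F] S)
  (fst snd : (ℕ → A) → S)
  (x y : S)
  (x_comm : ∀ s, Commute x s)
  (y_comm : ∀ s, Commute y s)
  (fst_mul_snd : ∀ u v, fst u * snd v = toFun fun i j => u i * v j)
  (snd_mul_fst : ∀ u v, snd v * fst u = toFun fun i j => v j * u i)
  (x_mul : ∀ f f' : ℕ → ℕ → A, (∀ j, f' 0 j = 0) → (∀ i j, f' (i + 1) j = f i j) →
    x * toFun f = toFun f')
  (y_mul : ∀ f f' : ℕ → ℕ → A, (∀ i, f' i 0 = 0) → (∀ i j, f' i (j + 1) = f i j) →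
    y * toFun f = toFun f')

/-- A sequence extended by zero to the integers. -/
def zext (u : ℕ → A) (m : ℤ) : A := if 0 ≤ m then u m.toNat else 0

theorem zext_natCast (u : ℕ → A) (m : ℕ) : zext u m = u m := by simp [zext]

variable {N : ℕ} (σ : Specialization F A S)

/-- The matrix of first specialised series. -/
def Specialization.mat1 (X : ℕ → Matrix (Fin N) (Fin N) A) : Matrix (Fin N) (Fin N) S :=
  Matrix.of fun i j => σ.fst fun r => X r i j

/-- The matrix of second specialised series. -/
def Specialization.mat2 (X : ℕ → Matrix (Fin N) (Fin N) A) : Matrix (Fin N) (Fin N) S :=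
  Matrix.of fun i j => σ.snd fun r => X r i j

theorem z1_eq (X : ℕ → Matrix (Fin N) (Fin N) A) (a : ℤ) :
    z1 X a = amp1 (Matrix.of fun i j => zext (fun k => X k i j) a) := by
  ext p r
  simp only [z1, zext, amp1]
  split_ifs <;> simp [*]

theorem z2_eq (X : ℕ → Matrix (Fin N) (Fin N) A) (a : ℤ) :
    z2 X a = amp2 (Matrix.of fun i j => zext (fun k => X k i j) a) := by
  ext p r
  simp only [z2, zext, amp2]
  split_ifs <;> simp [*]

theorem affRttL_apply (q : F) (X Y : ℕ → Matrix (Fin N) (Fin N) A) (a b a' b' : ℤ)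
    (p r : Fin N × Fin N) :
    affRttL F q X Y a b a' b' p r
      = ∑ s, (Rtil F q N p s • (zext (fun k => X k s.1 r.1) a * zext (fun k => Y k s.2 r.2) b)
        - Rc F q N p s • (zext (fun k => X k s.1 r.1) a' * zext (fun k => Y k s.2 r.2) b')) := by
  rw [affRttL, z1_eq, z1_eq, z2_eq, z2_eq, Matrix.sub_apply, mul_amp1_amp2_apply,
    mul_amp1_amp2_apply, ← Finset.sum_sub_distrib]
  simp only [liftF, Matrix.map_apply, Matrix.of_apply, Algebra.smul_def]

theorem affRttR_apply (q : F) (X Y : ℕ → Matrix (Fin N) (Fin N) A) (a b a' b' : ℤ)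
    (p r : Fin N × Fin N) :
    affRttR F q X Y a b a' b' p r
      = ∑ s, (Rtil F q N s r • (zext (fun k => Y k p.2 s.2) b * zext (fun k => X k p.1 s.1) a)
        - Rc F q N s r • (zext (fun k => Y k p.2 s.2) b' * zext (fun k => X k p.1 s.1) a')) := by
  rw [affRttR, z1_eq, z1_eq, z2_eq, z2_eq, Matrix.sub_apply, amp2_amp1_mul_apply,
    amp2_amp1_mul_apply, ← Finset.sum_sub_distrib]
  simp only [liftF, Matrix.map_apply, Matrix.of_apply, Algebra.smul_def, Algebra.commutes]

/-- Multiplication by `ξ` acts as the shift by `(m, n)`. -/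
def Specialization.IsShift (ξ : S) (m n : ℤ) : Prop :=
  ∀ f : ℤ → ℤ → A, (∀ i j, i < 0 ∨ j < 0 → f i j = 0) →
    ξ * σ.toFun (fun i j => f i j) = σ.toFun fun i j => f (i + m) (j + n)

theorem Specialization.isShift_one : σ.IsShift 1 0 0 := fun f _ => by simp

theorem Specialization.isShift_x : σ.IsShift σ.x (-1) 0 := fun f hf =>
  σ.x_mul _ _ (fun j => hf _ _ (by simp)) fun i j => by simp

theorem Specialization.isShift_y : σ.IsShift σ.y 0 (-1) := fun f hf =>
  σ.y_mul _ _ (fun j => hf _ _ (by simp)) fun i j => by simp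

theorem Specialization.isShift_x_mul_y : σ.IsShift (σ.x * σ.y) (-1) (-1) := fun f hf => by
  rw [mul_assoc, σ.isShift_y f hf]
  have := σ.isShift_x (fun i j => f (i + 0) (j + -1)) fun i j h => hf _ _ (by omega)
  simpa using this

/-- The scalar matrix `α R̃ - β R` over a noncommutative ring. -/
def RB (q : F) (N : ℕ) (α β : S) : Matrix (Fin N × Fin N) (Fin N × Fin N) S :=
  α • liftF F (Rtil F q N) - β • liftF F (Rc F q N)

theorem RB_apply (q : F) (α β : S) (p r : Fin N × Fin N) :
    RB q N α β p r = Rtil F q N p r • α - Rc F q N p r • β := by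
  simp only [RB, liftF, Matrix.sub_apply, Matrix.smul_apply, Matrix.map_apply, smul_eq_mul,
    Algebra.smul_def, Algebra.commutes]

theorem Specialization.rtt (q : F) (X Y : ℕ → Matrix (Fin N) (Fin N) A) {ξ ξ' : S}
    {m n m' n' : ℤ} (h : σ.IsShift ξ m n) (h' : σ.IsShift ξ' m' n') (hξ : ∀ s, Commute ξ s)
    (hξ' : ∀ s, Commute ξ' s)
    (hrel : ∀ (i j : ℕ) p r, affRttL F q X Y (i + m) (j + n) (i + m') (j + n') p r
      = affRttR F q X Y (i + m) (j + n) (i + m') (j + n') p r) :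
    RB q N ξ ξ' * amp1 (σ.mat1 X) * amp2 (σ.mat2 Y)
      = amp2 (σ.mat2 Y) * amp1 (σ.mat1 X) * RB q N ξ ξ' := by
  have hneg : ∀ (u : ℕ → A) (i : ℤ), i < 0 → zext u i = 0 := fun u i hi => by
    simp [zext, not_le.mpr hi]
  ext p r
  rw [mul_amp1_amp2_apply, amp2_amp1_mul_apply]
  have hl : ∀ s, RB q N ξ ξ' p s * (σ.mat1 X s.1 r.1 * σ.mat2 Y s.2 r.2)
      = σ.toFun fun i j =>
        Rtil F q N p s • (zext (fun k => X k s.1 r.1) (i + m) * zext (fun k => Y k s.2 r.2) (j + n))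
        - Rc F q N p s •
          (zext (fun k => X k s.1 r.1) (i + m') * zext (fun k => Y k s.2 r.2) (j + n')) := by
    intro s
    have hf := fun i j (hij : i < 0 ∨ j < 0) =>
      show zext (fun k => X k s.1 r.1) i * zext (fun k => Y k s.2 r.2) j = 0 by
        rcases hij with hij | hij <;> simp [hneg _ _ hij]
    have h1 := h _ hf
    have h2 := h' _ hf
    simp only [zext_natCast] at h1 h2
    simp only [mat1, mat2, Matrix.of_apply, σ.fst_mul_snd, RB_apply, sub_mul, smul_mul_assoc,
      h1, h2, ← map_smul, ← map_sub]
    rfl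
  have hr : ∀ s, σ.mat2 Y p.2 s.2 * σ.mat1 X p.1 s.1 * RB q N ξ ξ' s r
      = σ.toFun fun i j =>
        Rtil F q N s r • (zext (fun k => Y k p.2 s.2) (j + n) * zext (fun k => X k p.1 s.1) (i + m))
        - Rc F q N s r •
          (zext (fun k => Y k p.2 s.2) (j + n') * zext (fun k => X k p.1 s.1) (i + m')) := by
    intro s
    have hf := fun i j (hij : i < 0 ∨ j < 0) =>
      show zext (fun k => Y k p.2 s.2) j * zext (fun k => X k p.1 s.1) i = 0 by
        rcases hij with hij | hij <;> simp [hneg _ _ hij]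
    have h1 := h _ hf
    have h2 := h' _ hf
    simp only [zext_natCast] at h1 h2
    simp only [mat1, mat2, Matrix.of_apply, σ.snd_mul_fst, RB_apply, mul_sub, mul_smul_comm,
      ← (hξ _).eq, ← (hξ' _).eq, h1, h2, ← map_smul, ← map_sub]
    rfl
  rw [Finset.sum_congr rfl fun s _ => hl s, Finset.sum_congr rfl fun s _ => hr s, ← map_sum,
    ← map_sum]
  congr 1
  funext i j
  have := hrel i j p r
  rw [affRttL_apply, affRttR_apply] at this
  simpa only [Finset.sum_apply] using this

end TwoVariable

section Specializations

variable {F A : Type} [Field F] [Ring A] [Algebra F A]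

/-- The series `Σ dʳ uᵣ wʳ`. -/
def ser (d : F) (u : ℕ → A) : PowerSeries A := PowerSeries.mk fun r => d ^ r • u r

theorem smul_central {S : Type} [Ring S] [Algebra F S] (c : F) {x : S} (h : ∀ s, Commute x s)
    (s : S) : Commute (c • x) s := by
  rw [commute_iff_eq, smul_mul_assoc, (h s).eq, mul_smul_comm]

theorem powerSeries_X_central (s : PowerSeries A) : Commute PowerSeries.X s :=
  (PowerSeries.commute_X s).symm

theorem powerSeries_C_X_central (s : PowerSeries (PowerSeries A)) :
    Commute (PowerSeries.C (PowerSeries.X : PowerSeries A)) s := by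
  ext n : 1
  rw [PowerSeries.coeff_C_mul, PowerSeries.coeff_mul_C]
  exact (PowerSeries.commute_X _).eq.symm

/-- Both variables specialised to multiples of the same variable. -/
def diagSpec (A : Type) [Ring A] [Algebra F A] (c d : F) :
    Specialization F A (PowerSeries A) where
  toFun :=
    { toFun := fun f => PowerSeries.mk fun n =>
        ∑ p ∈ Finset.HasAntidiagonal.antidiagonal n, (c ^ p.1 * d ^ p.2) • f p.1 p.2
      map_add' := fun f g => by
        ext n
        simp [Finset.sum_add_distrib]
      map_smul' := fun a f => by
        ext n
        simp only [PowerSeries.coeff_mk, Pi.smul_apply, RingHom.id_apply, PowerSeries.coeff_smul,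
          Finset.smul_sum]
        exact Finset.sum_congr rfl fun p _ => smul_comm _ _ _ }
  fst := ser c
  snd := ser d
  x := c • PowerSeries.X
  y := d • PowerSeries.X
  x_comm := smul_central c powerSeries_X_central
  y_comm := smul_central d powerSeries_X_central
  fst_mul_snd := fun u v => by
    ext n
    simp only [ser, PowerSeries.coeff_mul, PowerSeries.coeff_mk, LinearMap.coe_mk, AddHom.coe_mk,
      smul_mul_smul_comm]
  snd_mul_fst := fun u v => by
    ext n
    simp only [ser, PowerSeries.coeff_mul, PowerSeries.coeff_mk, LinearMap.coe_mk, AddHom.coe_mk,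
      smul_mul_smul_comm]
    rw [← Finset.Nat.sum_antidiagonal_swap]
    exact Finset.sum_congr rfl fun p _ => by simp [mul_comm]
  x_mul := fun f f' h0 hs => by
    ext n
    rw [smul_mul_assoc]
    cases n with
    | zero => simp [h0]
    | succ n =>
      rw [PowerSeries.coeff_smul, PowerSeries.coeff_succ_X_mul]
      simp only [LinearMap.coe_mk, AddHom.coe_mk, PowerSeries.coeff_mk, Finset.smul_sum]
      rw [Finset.Nat.sum_antidiagonal_succ, h0, smul_zero, zero_add]
      refine Finset.sum_congr rfl fun p _ => ?_
      rw [hs, smul_smul]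
      ring_nf
  y_mul := fun f f' h0 hs => by
    ext n
    rw [smul_mul_assoc]
    cases n with
    | zero => simp [h0]
    | succ n =>
      rw [PowerSeries.coeff_smul, PowerSeries.coeff_succ_X_mul]
      simp only [LinearMap.coe_mk, AddHom.coe_mk, PowerSeries.coeff_mk, Finset.smul_sum]
      rw [Finset.Nat.sum_antidiagonal_succ', h0, smul_zero, zero_add]
      refine Finset.sum_congr rfl fun p _ => ?_
      rw [hs, smul_smul]
      ring_nf

/-- The first variable is the outer one. -/
def outerFstSpec (A : Type) [Ring A] [Algebra F A] (d : F) :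
    Specialization F A (PowerSeries (PowerSeries A)) where
  toFun :=
    { toFun := fun f => PowerSeries.mk fun i => ser d (f i)
      map_add' := fun f g => by
        ext i j
        simp [ser]
      map_smul' := fun a f => by
        ext i j
        simp only [ser, PowerSeries.coeff_mk, Pi.smul_apply, RingHom.id_apply,
          PowerSeries.coeff_smul]
        exact smul_comm _ _ _ }
  fst := fun u => PowerSeries.mk fun r => PowerSeries.C (u r)
  snd := fun v => PowerSeries.C (ser d v)
  x := PowerSeries.X
  y := d • PowerSeries.C PowerSeries.X
  x_comm := powerSeries_X_central
  y_comm := smul_central d powerSeries_C_X_central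
  fst_mul_snd := fun u v => by
    ext i j
    simp [ser, PowerSeries.coeff_mul_C, PowerSeries.coeff_C_mul]
  snd_mul_fst := fun u v => by
    ext i j
    simp [ser, PowerSeries.coeff_mul_C, PowerSeries.coeff_C_mul]
  x_mul := fun f f' h0 hs => by
    ext i j
    cases i with
    | zero => simp [ser, h0]
    | succ i =>
      rw [PowerSeries.coeff_succ_X_mul]
      simp [ser, hs]
  y_mul := fun f f' h0 hs => by
    ext i j
    rw [smul_mul_assoc, PowerSeries.coeff_smul, PowerSeries.coeff_C_mul]
    cases j with
    | zero => simp [ser, h0]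
    | succ j =>
      rw [PowerSeries.coeff_smul, PowerSeries.coeff_succ_X_mul]
      simp [ser, hs, smul_smul, pow_succ']

/-- The second variable is the outer one. -/
def outerSndSpec (A : Type) [Ring A] [Algebra F A] (c : F) :
    Specialization F A (PowerSeries (PowerSeries A)) where
  toFun :=
    { toFun := fun f => PowerSeries.mk fun j => ser c fun i => f i j
      map_add' := fun f g => by
        ext i j
        simp [ser]
      map_smul' := fun a f => by
        ext i j
        simp only [ser, PowerSeries.coeff_mk, Pi.smul_apply, RingHom.id_apply,
          PowerSeries.coeff_smul]
        exact smul_comm _ _ _ }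
  fst := fun u => PowerSeries.C (ser c u)
  snd := fun v => PowerSeries.mk fun r => PowerSeries.C (v r)
  x := c • PowerSeries.C PowerSeries.X
  y := PowerSeries.X
  x_comm := smul_central c powerSeries_C_X_central
  y_comm := powerSeries_X_central
  fst_mul_snd := fun u v => by
    ext i j
    simp [ser, PowerSeries.coeff_mul_C, PowerSeries.coeff_C_mul]
  snd_mul_fst := fun u v => by
    ext i j
    simp [ser, PowerSeries.coeff_mul_C, PowerSeries.coeff_C_mul]
  x_mul := fun f f' h0 hs => by
    ext j i
    rw [smul_mul_assoc, PowerSeries.coeff_smul, PowerSeries.coeff_C_mul]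
    cases i with
    | zero => simp [ser, h0]
    | succ i =>
      rw [PowerSeries.coeff_smul, PowerSeries.coeff_succ_X_mul]
      simp [ser, hs, smul_smul, pow_succ']
  y_mul := fun f f' h0 hs => by
    ext j i
    cases j with
    | zero => simp [ser, h0]
    | succ j =>
      rw [PowerSeries.coeff_succ_X_mul]
      simp [ser, hs]

end Specializations

section Relations

variable {F : Type} [Field F] {q : F} {N : ℕ}

/-- The coefficient matrices of `T(u)`. -/
def tMat (F : Type) [Field F] (q : F) (N : ℕ) (r : ℕ) : Matrix (Fin N) (Fin N) (UqAff F q N) :=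
  Matrix.of fun i j => tA F q N r i j

/-- The coefficient matrices of `T̄(u)`. -/
def tbMat (F : Type) [Field F] (q : F) (N : ℕ) (r : ℕ) : Matrix (Fin N) (Fin N) (UqAff F q N) :=
  Matrix.of fun i j => tbA F q N r i j

theorem map_affRttL {A B : Type} [Ring A] [Algebra F A] [Ring B] [Algebra F B] (φ : A →ₐ[F] B)
    (X Y : ℕ → Matrix (Fin N) (Fin N) A) (a b a' b' : ℤ) (p r : Fin N × Fin N) :
    φ (affRttL F q X Y a b a' b' p r)
      = affRttL F q (fun k => (X k).map φ) (fun k => (Y k).map φ) a b a' b' p r := by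
  simp only [affRttL_apply, map_sum, map_sub, map_smul, map_mul, zext, apply_ite φ, map_zero,
    Matrix.map_apply]

theorem map_affRttR {A B : Type} [Ring A] [Algebra F A] [Ring B] [Algebra F B] (φ : A →ₐ[F] B)
    (X Y : ℕ → Matrix (Fin N) (Fin N) A) (a b a' b' : ℤ) (p r : Fin N × Fin N) :
    φ (affRttR F q X Y a b a' b' p r)
      = affRttR F q (fun k => (X k).map φ) (fun k => (Y k).map φ) a b a' b' p r := by
  simp only [affRttR_apply, map_sum, map_sub, map_smul, map_mul, zext, apply_ite φ, map_zero,
    Matrix.map_apply]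

theorem rtt_coeff (a b : ℤ) (p r : Fin N × Fin N) :
    affRttL F q (tMat F q N) (tMat F q N) (1 - a) (-b) (-a) (1 - b) p r
      = affRttR F q (tMat F q N) (tMat F q N) (1 - a) (-b) (-a) (1 - b) p r := by
  have h := RingQuot.mkAlgHom_rel F (AffGlRel.rtt (F := F) (q := q) a b p r)
  rwa [map_affRttL, map_affRttR] at h

theorem rtbtb_coeff (a b : ℤ) (p r : Fin N × Fin N) :
    affRttL F q (tbMat F q N) (tbMat F q N) (a - 1) b a (b - 1) p r
      = affRttR F q (tbMat F q N) (tbMat F q N) (a - 1) b a (b - 1) p r := by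
  have h := RingQuot.mkAlgHom_rel F (AffGlRel.rtbtb (F := F) (q := q) a b p r)
  rwa [map_affRttL, map_affRttR] at h

theorem rtbt_coeff (a b : ℤ) (p r : Fin N × Fin N) :
    affRttL F q (tbMat F q N) (tMat F q N) (a - 1) (-b) a (1 - b) p r
      = affRttR F q (tbMat F q N) (tMat F q N) (a - 1) (-b) a (1 - b) p r := by
  have h := RingQuot.mkAlgHom_rel F (AffGlRel.rtbt (F := F) (q := q) a b p r)
  rwa [map_affRttL, map_affRttR] at h

variable {S : Type} [Ring S] [Algebra F S] (σ : Specialization F (UqAff F q N) S)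

theorem Specialization.rtt_t :
    RB q N σ.y σ.x * amp1 (σ.mat1 (tMat F q N)) * amp2 (σ.mat2 (tMat F q N))
      = amp2 (σ.mat2 (tMat F q N)) * amp1 (σ.mat1 (tMat F q N)) * RB q N σ.y σ.x := by
  refine σ.rtt q _ _ σ.isShift_y σ.isShift_x σ.y_comm σ.x_comm fun i j p r => ?_
  have h := rtt_coeff (F := F) (q := q) (1 - i) (1 - j) p r
  convert h using 2 <;> ring

theorem Specialization.rtt_tb :
    RB q N σ.x σ.y * amp1 (σ.mat1 (tbMat F q N)) * amp2 (σ.mat2 (tbMat F q N))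
      = amp2 (σ.mat2 (tbMat F q N)) * amp1 (σ.mat1 (tbMat F q N)) * RB q N σ.x σ.y := by
  refine σ.rtt q _ _ σ.isShift_x σ.isShift_y σ.x_comm σ.y_comm fun i j p r => ?_
  have h := rtbtb_coeff (F := F) (q := q) i j p r
  convert h using 2 <;> ring

theorem Specialization.rtt_tb_t :
    RB q N (σ.x * σ.y) 1 * amp1 (σ.mat1 (tbMat F q N)) * amp2 (σ.mat2 (tMat F q N))
      = amp2 (σ.mat2 (tMat F q N)) * amp1 (σ.mat1 (tbMat F q N)) * RB q N (σ.x * σ.y) 1 := by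
  refine σ.rtt q _ _ σ.isShift_x_mul_y σ.isShift_one
    (fun s => (σ.x_comm s).mul_left (σ.y_comm s)) (fun s => Commute.one_left s) fun i j p r => ?_
  have h := rtbt_coeff (F := F) (q := q) i (1 - j) p r
  convert h using 2 <;> ring

end Relations

section Regular

theorem powerSeries_isLeftRegular {A : Type} [Ring A] {f : PowerSeries A}
    (hf : IsLeftRegular (PowerSeries.constantCoeff f)) : IsLeftRegular f := by
  intro g h hgh
  have hz : f * (g - h) = 0 := by rw [mul_sub, sub_eq_zero]; exact hgh
  suffices hk : ∀ n, PowerSeries.coeff n (g - h) = 0 from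
    sub_eq_zero.mp (PowerSeries.ext fun n => by rw [hk, map_zero])
  intro n
  induction n using Nat.strong_induction_on with
  | _ n ih =>
    have hn := congrArg (PowerSeries.coeff n) hz
    rw [PowerSeries.coeff_mul, Finset.sum_eq_single (0, n), map_zero,
      PowerSeries.coeff_zero_eq_constantCoeff_apply] at hn
    · exact hf (by simpa using hn)
    · rintro ⟨a, b⟩ hab hne
      rw [Finset.HasAntidiagonal.mem_antidiagonal] at hab
      have : b ≠ n := fun hb => hne (by simp only [Prod.mk.injEq]; simp only at hab; omega)
      rw [ih b (by simp only at hab; omega), mul_zero]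
    · simp

variable {F A : Type} [Field F] [Ring A] [Algebra F A]

theorem isLeftRegular_smul {s : F} (hs : s ≠ 0) {x : A} (hx : IsLeftRegular x) :
    IsLeftRegular (s • x) := by
  intro g h hgh
  simp only [smul_mul_assoc] at hgh
  exact hx (by simpa [hs] using congrArg (s⁻¹ • ·) hgh)

theorem isLeftRegular_X : IsLeftRegular (PowerSeries.X : PowerSeries A) :=
  fun _ _ h => PowerSeries.X_mul_cancel h

theorem isLeftRegular_C_X_sub {s : F} (hs : s ≠ 0) (t : F) :
    IsLeftRegular (s • PowerSeries.C (PowerSeries.X : PowerSeries A) - t • PowerSeries.X) := by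
  refine powerSeries_isLeftRegular ?_
  have : PowerSeries.constantCoeff (s • PowerSeries.C (PowerSeries.X : PowerSeries A)
      - t • PowerSeries.X) = s • PowerSeries.X := by
    rw [← PowerSeries.coeff_zero_eq_constantCoeff_apply]
    simp
  rw [this]
  exact isLeftRegular_smul hs isLeftRegular_X

theorem isLeftRegular_X_mul_C_X_sub (s : F) {t : F} (ht : t ≠ 0) :
    IsLeftRegular (s • (PowerSeries.X * PowerSeries.C (PowerSeries.X : PowerSeries A))
      - t • 1) := by
  refine powerSeries_isLeftRegular ?_
  have : PowerSeries.constantCoeff (s • (PowerSeries.X * PowerSeries.C (PowerSeries.X :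
      PowerSeries A)) - t • 1) = (-t) • 1 := by
    rw [← PowerSeries.coeff_zero_eq_constantCoeff_apply]
    simp
  rw [this]
  exact isLeftRegular_smul (neg_ne_zero.mpr ht) isRegular_one.left

end Regular

section Commute

variable {F : Type} [Field F] {q : F} {N : ℕ}

theorem isLeftRegular_eigenScalar {C B : Type} [CommRing C] [Algebra F C] [Ring B] [Algebra C B]
    (hq : q ≠ 0) (α β : C) (t : Fin N → F) (ht : ∀ a, t a ≠ 0)
    (h : ∀ r s : F, r ≠ 0 → s ≠ 0 → IsLeftRegular (algebraMap C B (r • α - s • β))) :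
    IsLeftRegular (algebraMap C B (eigenScalar q α fun a => t a • β)) := by
  have hl : ∀ l : List (Fin N),
      IsLeftRegular (algebraMap C B (l.map fun c => α - t c • β).prod) := by
    intro l
    induction l with
    | nil => simpa using isRegular_one.left
    | cons c l ih =>
      rw [List.map_cons, List.prod_cons, map_mul]
      refine IsLeftRegular.mul ?_ ih
      simpa using h 1 (t c) one_ne_zero (ht c)
  rw [eigenScalar]
  split
  · simpa using isRegular_one.left
  · next z l _ =>
    rw [map_mul]
    refine IsLeftRegular.mul ?_ (hl l)
    have := h q⁻¹ (q * t z) (inv_ne_zero hq) (mul_ne_zero hq (ht z))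
    simpa only [Algebra.smul_def, map_mul, mul_comm, mul_left_comm] using this

variable {B : Type} [Ring B] [Algebra F B]

/-- The quantum determinant of the family `M` as an entry of `η M₁ ⋯ M_N`. -/
def detRow (η : (Fin N → Fin N) → F) (M : Fin N → Matrix (Fin N) (Fin N) B) : B :=
  Matrix.vecMul (fun g => algebraMap F B (η g))
    ((List.finRange N).map fun a => emb1 a (M a)).prod id

theorem RM_map_algebraMap {C : Type} [CommRing C] [Algebra F C] [Algebra C B]
    [IsScalarTower F C B] (α β : C) :
    (RM q N α β).map (algebraMap C B) = RB q N (algebraMap C B α) (algebraMap C B β) := by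
  ext p r
  simp only [RM, RB, liftF, Matrix.smul_apply, Matrix.map_apply, Matrix.sub_apply, smul_eq_mul,
    map_sub, map_mul, ← IsScalarTower.algebraMap_apply]

theorem RB_smul_smul (c : F) (α β : B) : RB q N (c • α) (c • β) = c • RB q N α β := by
  simp only [RB, smul_assoc, smul_sub]

theorem commute_detRow_algebraMap (hq : q ≠ 0) (h2 : (2 : F) ≠ 0) {η : (Fin N → Fin N) → F}
    (hη : AntiSym q η) (h1 : η id = 1) {C : Type} [CommRing C] [Algebra F C] [Algebra C B]
    [IsScalarTower F C B] (α β : C)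
    (h : ∀ r s : F, r ≠ 0 → s ≠ 0 → IsLeftRegular (algebraMap C B (r • α - s • β)))
    (M : Fin N → Matrix (Fin N) (Fin N) B) (X : Matrix (Fin N) (Fin N) B)
    (hM : ∀ (i : ℕ) (h : i + 1 < N),
      EM q N B * (amp1 (M ⟨i, Nat.lt_of_succ_lt h⟩) * amp2 (M ⟨i + 1, h⟩))
        = amp2 (M ⟨i + 1, h⟩) * amp1 (M ⟨i, Nat.lt_of_succ_lt h⟩) * EM q N B)
    (hX : ∀ a : Fin N,
      RB q N (q ^ (2 * a.val) • algebraMap C B α) (algebraMap C B β) * amp1 X * amp2 (M a)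
        = amp2 (M a) * amp1 X * RB q N (q ^ (2 * a.val) • algebraMap C B α) (algebraMap C B β))
    (i j : Fin N) : Commute (X i j) (detRow η M) := by
  refine isLeftRegular_eigenScalar (B := B) hq α β (fun a => (q ^ (2 * a.val))⁻¹)
    (fun a => inv_ne_zero (pow_ne_zero _ hq)) h
    (eigenScalar_mul_commutator hq h2 hη h1 α (fun a => (q ^ (2 * a.val))⁻¹ • β) ?_ M X hM ?_ i j)
  · intro i h
    rw [← map_pow, ← Algebra.smul_def, smul_smul]
    congr 1
    field_simp
    ring
  · intro a
    have hqa : q ^ (2 * a.val) ≠ 0 := pow_ne_zero _ hq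
    have hRB : RB q N (q ^ (2 * a.val) • algebraMap C B α) (algebraMap C B β)
        = q ^ (2 * a.val) •
          RB q N (algebraMap C B α) (algebraMap C B ((q ^ (2 * a.val))⁻¹ • β)) := by
      rw [← RB_smul_smul, Algebra.smul_def _ β, map_mul, ← IsScalarTower.algebraMap_apply,
        ← Algebra.smul_def, smul_inv_smul₀ hqa]
    have := hX a
    rw [hRB, Matrix.smul_mul, Matrix.smul_mul, Matrix.mul_smul] at this
    rw [RM_map_algebraMap]
    simpa only [inv_smul_smul₀ hqa] using congrArg ((q ^ (2 * a.val))⁻¹ • ·) this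

theorem commute_detRow (hq : q ≠ 0) (h2 : (2 : F) ≠ 0) {η : (Fin N → Fin N) → F}
    (hη : AntiSym q η) (h1 : η id = 1) {α β : B} (hα : ∀ s, Commute α s) (hβ : ∀ s, Commute β s)
    (h : ∀ r s : F, r ≠ 0 → s ≠ 0 → IsLeftRegular (r • α - s • β))
    (M : Fin N → Matrix (Fin N) (Fin N) B) (X : Matrix (Fin N) (Fin N) B)
    (hM : ∀ (i : ℕ) (h : i + 1 < N),
      EM q N B * (amp1 (M ⟨i, Nat.lt_of_succ_lt h⟩) * amp2 (M ⟨i + 1, h⟩))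
        = amp2 (M ⟨i + 1, h⟩) * amp1 (M ⟨i, Nat.lt_of_succ_lt h⟩) * EM q N B)
    (hX : ∀ a : Fin N, RB q N (q ^ (2 * a.val) • α) β * amp1 X * amp2 (M a)
      = amp2 (M a) * amp1 X * RB q N (q ^ (2 * a.val) • α) β) (i j : Fin N) :
    Commute (X i j) (detRow η M) :=
  let inst : Algebra (Subalgebra.center F B) B :=
    (Subalgebra.center F B).val.toRingHom.toAlgebra'
      fun c x => (Subalgebra.mem_center_iff.mp c.2 x).symm
  @commute_detRow_algebraMap F _ q N B _ _ hq h2 η hη h1 (Subalgebra.center F B) _ _ inst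
    (@IsScalarTower.of_algebraMap_eq F (Subalgebra.center F B) B _ _ _ _ inst _ fun _ => rfl)
    ⟨α, Subalgebra.mem_center_iff.mpr fun s => (hα s).eq.symm⟩
    ⟨β, Subalgebra.mem_center_iff.mpr fun s => (hβ s).eq.symm⟩ h M X hM hX i j

end Commute

section Flip

variable {F : Type} [Field F] {N : ℕ} {S : Type} [Ring S] [Algebra F S]

theorem RB_flip (q : F) (α β : S) (p r : Fin N × Fin N) :
    RB q N α β r.swap p.swap = RB q N α β p r := by
  obtain ⟨a, b⟩ := p
  obtain ⟨c, d⟩ := r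
  rw [RB_apply, RB_apply]
  congr 2 <;>
  · simp only [Rtil, Rc, Matrix.of_apply, Prod.swap_prod_mk, Prod.mk.injEq]
    congr 1
    · by_cases h : a = c ∧ b = d
      · obtain ⟨rfl, rfl⟩ := h
        simp [eq_comm]
      · rw [if_neg h, if_neg fun h' => h ⟨h'.2.symm, h'.1.symm⟩]
    · by_cases h : a = d ∧ b = c
      · obtain ⟨rfl, rfl⟩ := h
        simp
      · rw [if_neg fun h' => h ⟨h'.1.symm, h'.2.1.symm⟩, if_neg fun h' => h ⟨h'.1, h'.2.1⟩]

theorem RB_comm (q : F) {α β : S} (hα : ∀ s, Commute α s) (hβ : ∀ s, Commute β s)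
    (p r : Fin N × Fin N) (x : S) : Commute (RB q N α β p r) x := by
  rw [RB_apply]
  exact (smul_central _ hα x).sub_left (smul_central _ hβ x)

theorem RB_sq_smul {q : F} (hq : q ≠ 0) (ξ : S) :
    RB q N (q ^ 2 • ξ) ξ = ((q ^ 2 - 1) • ξ) • EM q N S := by
  ext p r
  obtain ⟨a, b⟩ := p
  obtain ⟨c, d⟩ := r
  rw [RB_apply, smul_smul, ← sub_smul, Matrix.smul_apply, smul_eq_mul]
  have h : Rtil F q N (a, b) (c, d) * q ^ 2 - Rc F q N (a, b) (c, d)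
      = (q ^ 2 - 1) * EM q N F (a, b) (c, d) := by
    simp only [Rtil, Rc, EM, liftF, PqSmall, Matrix.of_apply, Matrix.sub_apply, Matrix.map_apply,
      Matrix.one_apply, Prod.mk.injEq, Algebra.algebraMap_self, RingHom.id_apply]
    by_cases h1 : a = c ∧ b = d
    · obtain ⟨rfl, rfl⟩ := h1
      by_cases hab : a = b
      · subst hab
        simp only [and_self, lt_self_iff_false, and_false, if_true, if_false]
        field_simp
        ring
      · simp [hab]
        try ring
    · by_cases h2 : a = d ∧ b = c
      · obtain ⟨rfl, rfl⟩ := h2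
        have hab : a ≠ b := fun h => h1 ⟨h, h.symm⟩
        rcases lt_or_gt_of_ne hab with h | h
        · simp only [hab, hab.symm, h, h.not_gt, and_self, true_and, if_true, if_false]
          field_simp
          ring
        · simp only [hab, hab.symm, h, h.not_gt, and_self, true_and, if_true, if_false]
          field_simp
          ring
      · rw [if_neg h1, if_neg h1, if_neg fun h' => h2 ⟨h'.1, h'.2.1⟩,
          if_neg fun h' => h2 ⟨h'.1, h'.2.1⟩, if_neg h1, if_neg fun h' => h2 ⟨h'.2.symm, h'.1.symm⟩]
        simp
  have hE : EM q N S (a, b) (c, d) = algebraMap F S (EM q N F (a, b) (c, d)) := by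
    simp [EM, liftF, Matrix.one_apply, apply_ite (algebraMap F S)]
  rw [h, hE, ← Algebra.commutes, ← Algebra.smul_def, smul_smul, mul_comm]

variable {T : Type} [Ring T] [Algebra F T]

theorem map_EM (q : F) (φ : S →ₐ[F] T) : (EM q N S).map φ = EM q N T := by
  ext p r
  simp [EM, liftF, Matrix.one_apply, apply_ite φ]

theorem map_amp1 (φ : S →+* T) (M : Matrix (Fin N) (Fin N) S) :
    (amp1 M).map φ = amp1 (M.map φ) := by
  ext p r
  simp [amp1, apply_ite φ]

theorem map_amp2 (φ : S →+* T) (M : Matrix (Fin N) (Fin N) S) :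
    (amp2 M).map φ = amp2 (M.map φ) := by
  ext p r
  simp [amp2, apply_ite φ]

theorem EM_mul_of_RB {q : F} (hq : q ≠ 0) (hq1 : q ^ 2 ≠ 1) {ξ : S} (hξ : ∀ s, Commute ξ s)
    (hreg : IsLeftRegular ξ) {X Y : Matrix (Fin N) (Fin N) S}
    (h : RB q N (q ^ 2 • ξ) ξ * amp1 X * amp2 Y = amp2 Y * amp1 X * RB q N (q ^ 2 • ξ) ξ) :
    EM q N S * (amp1 X * amp2 Y) = amp2 Y * amp1 X * EM q N S := by
  have hc : ∀ s, Commute ((q ^ 2 - 1) • ξ) s := smul_central _ hξ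
  rw [RB_sq_smul hq, mul_assoc, Matrix.smul_mul] at h
  ext p r
  have hpr := congrFun (congrFun h p) r
  have hmul : (amp2 Y * amp1 X * ((q ^ 2 - 1) • ξ) • EM q N S) p r
      = (q ^ 2 - 1) • ξ * (amp2 Y * amp1 X * EM q N S) p r := by
    rw [Matrix.mul_apply, Matrix.mul_apply, Finset.mul_sum]
    refine Finset.sum_congr rfl fun s _ => ?_
    rw [Matrix.smul_apply, smul_eq_mul, ← mul_assoc, ← (hc _).eq, mul_assoc]
  rw [hmul, Matrix.smul_apply, smul_eq_mul] at hpr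
  exact isLeftRegular_smul (sub_ne_zero.mpr hq1) hreg hpr

theorem map_detRow (η : (Fin N → Fin N) → F) (φ : S →ₐ[F] T)
    (M : Fin N → Matrix (Fin N) (Fin N) S) :
    φ (detRow η M) = detRow η fun a => (M a).map φ := by
  rw [detRow, ← AlgHom.coe_toRingHom, RingHom.map_vecMul, detRow]
  have hη : (φ : S →+* T) ∘ (fun g => algebraMap F S (η g)) = fun g => algebraMap F T (η g) := by
    funext g
    simp
  rw [hη, ← RingHom.mapMatrix_apply, map_list_prod, List.map_map]
  congr 3
  funext a
  exact map_emb1 _ _ _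

end Flip

section Central

variable {F : Type} [Field F] {q : F} {N : ℕ}

/-- The matrix `T(d⁻¹ u)` as a power series in `u⁻¹`. -/
def tSer (F : Type) [Field F] (q : F) (N : ℕ) (d : F) :
    Matrix (Fin N) (Fin N) (PowerSeries (UqAff F q N)) :=
  (diagSpec (UqAff F q N) d d).mat1 (tMat F q N)

/-- The matrix `T̄(d u)` as a power series in `u`. -/
def tbSer (F : Type) [Field F] (q : F) (N : ℕ) (d : F) :
    Matrix (Fin N) (Fin N) (PowerSeries (UqAff F q N)) :=
  (diagSpec (UqAff F q N) d d).mat1 (tbMat F q N)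

theorem EM_mul_tSer (hq : q ≠ 0) (hq1 : q ^ 2 ≠ 1) {d : F} (hd : d ≠ 0) :
    EM q N _ * (amp1 (tSer F q N d) * amp2 (tSer F q N (q ^ 2 * d)))
      = amp2 (tSer F q N (q ^ 2 * d)) * amp1 (tSer F q N d) * EM q N _ := by
  refine EM_mul_of_RB hq hq1 (smul_central d powerSeries_X_central)
    (isLeftRegular_smul hd isLeftRegular_X) ?_
  have h := (diagSpec (UqAff F q N) d (q ^ 2 * d)).rtt_t (q := q)
  rw [smul_smul]
  exact h

theorem EM_mul_tbSer (hq : q ≠ 0) (hq1 : q ^ 2 ≠ 1) {d : F} (hd : d ≠ 0) :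
    EM q N _ * (amp1 (tbSer F q N d).transpose * amp2 (tbSer F q N (q ^ 2 * d)).transpose)
      = amp2 (tbSer F q N (q ^ 2 * d)).transpose * amp1 (tbSer F q N d).transpose * EM q N _ := by
  refine EM_mul_of_RB hq hq1 (smul_central d powerSeries_X_central)
    (isLeftRegular_smul hd isLeftRegular_X) ?_
  have h := (diagSpec (UqAff F q N) (q ^ 2 * d) d).rtt_tb (q := q)
  rw [smul_smul]
  exact rtt_flip (RB_comm q (diagSpec (UqAff F q N) (q ^ 2 * d) d).x_comm
    (diagSpec (UqAff F q N) (q ^ 2 * d) d).y_comm) (RB_flip q _ _) h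

/-- Constant power series, as an algebra homomorphism. -/
def powerSeriesC (F A : Type) [Field F] [Ring A] [Algebra F A] : A →ₐ[F] PowerSeries A where
  __ := (PowerSeries.C : A →+* PowerSeries A)
  commutes' _ := (PowerSeries.algebraMap_apply).symm

theorem EM_mul_map {A B : Type} [Ring A] [Algebra F A] [Ring B] [Algebra F B] (φ : A →ₐ[F] B)
    {X Y : Matrix (Fin N) (Fin N) A}
    (h : EM q N A * (amp1 X * amp2 Y) = amp2 Y * amp1 X * EM q N A) :
    EM q N B * (amp1 (X.map φ) * amp2 (Y.map φ))
      = amp2 (Y.map φ) * amp1 (X.map φ) * EM q N B := by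
  have := congrArg (φ : A →+* B).mapMatrix h
  simp only [map_mul, RingHom.mapMatrix_apply, map_amp1, map_amp2] at this
  rwa [AlgHom.coe_toRingHom, map_EM] at this

/-- `qdet T(u)` -/
def detT (q : F) (N : ℕ) (η : (Fin N → Fin N) → F) : PowerSeries (UqAff F q N) :=
  detRow η fun a => tSer F q N (q ^ (2 * a.val))

/-- The quantum determinant of `T̄(u)ᵗ`. -/
def detTb (q : F) (N : ℕ) (η : (Fin N → Fin N) → F) : PowerSeries (UqAff F q N) :=
  detRow η fun a => (tbSer F q N (q ^ (2 * a.val))).transpose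

theorem commute_C_detRow {A : Type} [Ring A] [Algebra F A] (hq : q ≠ 0) (h2 : (2 : F) ≠ 0)
    {η : (Fin N → Fin N) → F} (hη : AntiSym q η) (h1 : η id = 1)
    {α β : PowerSeries (PowerSeries A)} (hα : ∀ s, Commute α s) (hβ : ∀ s, Commute β s)
    (h : ∀ r s : F, r ≠ 0 → s ≠ 0 → IsLeftRegular (r • α - s • β))
    (M : ℕ → Matrix (Fin N) (Fin N) (PowerSeries A)) (X : ℕ → Matrix (Fin N) (Fin N) A)
    (hM : ∀ i, EM q N _ * (amp1 (M i) * amp2 (M (i + 1)))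
      = amp2 (M (i + 1)) * amp1 (M i) * EM q N _)
    {X' : Matrix (Fin N) (Fin N) (PowerSeries (PowerSeries A))}
    (hX' : ∀ i j, X' i j = PowerSeries.mk fun r => PowerSeries.C (X r i j))
    (hX : ∀ a : ℕ, RB q N (q ^ (2 * a) • α) β * amp1 X' *
        amp2 ((M a).map (powerSeriesC F (PowerSeries A)))
      = amp2 ((M a).map (powerSeriesC F (PowerSeries A))) * amp1 X' *
        RB q N (q ^ (2 * a) • α) β) (r : ℕ) (i j : Fin N) :
    Commute (PowerSeries.C (X r i j)) (detRow η fun a => M a.val) := by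
  have key := commute_detRow hq h2 hη h1 hα hβ h
    (fun a : Fin N => (M a.val).map (powerSeriesC F (PowerSeries A))) X'
    (fun i _ => EM_mul_map _ (hM i)) (fun a => hX a.val) i j
  rw [← map_detRow, hX'] at key
  have := congrArg (PowerSeries.coeff r) key.eq
  change PowerSeries.coeff r (_ * PowerSeries.C _) = PowerSeries.coeff r (PowerSeries.C _ * _)
    at this
  rwa [PowerSeries.coeff_mul_C, PowerSeries.coeff_C_mul, PowerSeries.coeff_mk] at this

theorem EM_mul_tSer_pow (hq : q ≠ 0) (hq1 : q ^ 2 ≠ 1) (i : ℕ) :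
    EM q N _ * (amp1 (tSer F q N (q ^ (2 * i))) * amp2 (tSer F q N (q ^ (2 * (i + 1)))))
      = amp2 (tSer F q N (q ^ (2 * (i + 1)))) * amp1 (tSer F q N (q ^ (2 * i))) * EM q N _ := by
  have := EM_mul_tSer (N := N) hq hq1 (pow_ne_zero (2 * i) hq)
  rwa [← pow_add, add_comm 2, ← Nat.mul_succ] at this

theorem EM_mul_tbSer_pow (hq : q ≠ 0) (hq1 : q ^ 2 ≠ 1) (i : ℕ) :
    EM q N _ * (amp1 (tbSer F q N (q ^ (2 * i))).transpose *
        amp2 (tbSer F q N (q ^ (2 * (i + 1)))).transpose)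
      = amp2 (tbSer F q N (q ^ (2 * (i + 1)))).transpose *
        amp1 (tbSer F q N (q ^ (2 * i))).transpose * EM q N _ := by
  have := EM_mul_tbSer (N := N) hq hq1 (pow_ne_zero (2 * i) hq)
  rwa [← pow_add, add_comm 2, ← Nat.mul_succ] at this

theorem commute_tA_detT (hq : q ≠ 0) (hq1 : q ^ 2 ≠ 1) (h2 : (2 : F) ≠ 0)
    {η : (Fin N → Fin N) → F} (hη : AntiSym q η) (h1 : η id = 1) (r : ℕ) (i j : Fin N) :
    Commute (PowerSeries.C (tA F q N r i j)) (detT q N η) := by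
  have hreg : ∀ r s : F, r ≠ 0 → s ≠ 0 → IsLeftRegular
      (r • PowerSeries.C (PowerSeries.X : PowerSeries (UqAff F q N)) - s • PowerSeries.X) :=
    fun _ s hr _ => isLeftRegular_C_X_sub hr s
  have hrel := fun a : ℕ => (outerFstSpec (UqAff F q N) (q ^ (2 * a))).rtt_t (q := q)
  have := @commute_C_detRow F _ q N (UqAff F q N) _ _ hq h2 η hη h1 (PowerSeries.C PowerSeries.X)
    PowerSeries.X powerSeries_C_X_central powerSeries_X_central hreg
    (fun a => tSer F q N (q ^ (2 * a))) (tMat F q N) (EM_mul_tSer_pow hq hq1)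
    ((outerFstSpec (UqAff F q N) (1 : F)).mat1 (tMat F q N)) (fun _ _ => rfl) hrel r i j
  exact this

theorem commute_tbA_detT (hq : q ≠ 0) (hq1 : q ^ 2 ≠ 1) (h2 : (2 : F) ≠ 0)
    {η : (Fin N → Fin N) → F} (hη : AntiSym q η) (h1 : η id = 1) (r : ℕ) (i j : Fin N) :
    Commute (PowerSeries.C (tbA F q N r i j)) (detT q N η) :=
  commute_C_detRow hq h2 hη h1 (α := PowerSeries.X * PowerSeries.C PowerSeries.X) (β := 1)
    (fun s => (powerSeries_X_central s).mul_left (powerSeries_C_X_central s)) Commute.one_left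
    (fun r _ _ hs => isLeftRegular_X_mul_C_X_sub r hs)
    (fun a => tSer F q N (q ^ (2 * a))) (tbMat F q N) (EM_mul_tSer_pow hq hq1)
    (X' := (outerFstSpec (UqAff F q N) (1 : F)).mat1 (tbMat F q N)) (fun _ _ => rfl)
    (fun a => by
      rw [← mul_smul_comm]
      exact (outerFstSpec (UqAff F q N) (q ^ (2 * a))).rtt_tb_t (q := q)) r i j

theorem commute_tA_detTb (hq : q ≠ 0) (hq1 : q ^ 2 ≠ 1) (h2 : (2 : F) ≠ 0)
    {η : (Fin N → Fin N) → F} (hη : AntiSym q η) (h1 : η id = 1) (r : ℕ) (i j : Fin N) :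
    Commute (PowerSeries.C (tA F q N r i j)) (detTb q N η) :=
  commute_C_detRow hq h2 hη h1 (α := PowerSeries.C PowerSeries.X * PowerSeries.X) (β := 1)
    (fun s => (powerSeries_C_X_central s).mul_left (powerSeries_X_central s)) Commute.one_left
    (fun r _ _ hs => by
      rw [(powerSeries_C_X_central _).eq]
      exact isLeftRegular_X_mul_C_X_sub r hs)
    (fun a => (tbSer F q N (q ^ (2 * a))).transpose) (fun r => (tMat F q N r).transpose)
    (EM_mul_tbSer_pow hq hq1)
    (X' := ((outerSndSpec (UqAff F q N) (1 : F)).mat2 (tMat F q N)).transpose) (fun _ _ => rfl)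
    (fun a => by
      rw [← smul_mul_assoc]
      let σ := outerSndSpec (UqAff F q N) (q ^ (2 * a))
      exact rtt_flip (RB_comm q (fun s => (σ.x_comm s).mul_left (σ.y_comm s)) Commute.one_left)
        (RB_flip q _ _) (σ.rtt_tb_t (q := q))) r j i

theorem commute_tbA_detTb (hq : q ≠ 0) (hq1 : q ^ 2 ≠ 1) (h2 : (2 : F) ≠ 0)
    {η : (Fin N → Fin N) → F} (hη : AntiSym q η) (h1 : η id = 1) (r : ℕ) (i j : Fin N) :
    Commute (PowerSeries.C (tbA F q N r i j)) (detTb q N η) := by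
  have hreg : ∀ r s : F, r ≠ 0 → s ≠ 0 → IsLeftRegular
      (r • PowerSeries.C (PowerSeries.X : PowerSeries (UqAff F q N)) - s • PowerSeries.X) :=
    fun _ s hr _ => isLeftRegular_C_X_sub hr s
  have hrel := fun a : ℕ =>
    rtt_flip (RB_comm q (outerSndSpec (UqAff F q N) (q ^ (2 * a))).x_comm
      (outerSndSpec (UqAff F q N) (q ^ (2 * a))).y_comm) (RB_flip q _ _)
      ((outerSndSpec (UqAff F q N) (q ^ (2 * a))).rtt_tb (q := q))
  have := @commute_C_detRow F _ q N (UqAff F q N) _ _ hq h2 η hη h1 (PowerSeries.C PowerSeries.X)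
    PowerSeries.X powerSeries_C_X_central powerSeries_X_central hreg
    (fun a => (tbSer F q N (q ^ (2 * a))).transpose) (fun r => (tbMat F q N r).transpose)
    (EM_mul_tbSer_pow hq hq1)
    ((outerSndSpec (UqAff F q N) (1 : F)).mat2 (tbMat F q N)).transpose (fun _ _ => rfl) hrel r j i
  exact this

theorem uqAff_induction {P : UqAff F q N → Prop} (halg : ∀ c, P (algebraMap F _ c))
    (ht : ∀ r i j, P (tA F q N r i j)) (htb : ∀ r i j, P (tbA F q N r i j))
    (hmul : ∀ x y, P x → P y → P (x * y)) (hadd : ∀ x y, P x → P y → P (x + y))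
    (x : UqAff F q N) : P x := by
  obtain ⟨y, rfl⟩ := RingQuot.mkAlgHom_surjective F (AffGlRel F q N) x
  induction y using FreeAlgebra.induction with
  | grade0 c => rw [AlgHom.commutes]; exact halg c
  | grade1 g =>
    rcases g with ⟨r, i, j⟩ | ⟨r, i, j⟩
    · exact ht r i j
    · exact htb r i j
  | mul a b ha hb => rw [map_mul]; exact hmul _ _ ha hb
  | add a b ha hb => rw [map_add]; exact hadd _ _ ha hb

theorem commute_C_of_generators {D : PowerSeries (UqAff F q N)}
    (ht : ∀ r i j, Commute (PowerSeries.C (tA F q N r i j)) D)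
    (htb : ∀ r i j, Commute (PowerSeries.C (tbA F q N r i j)) D) (x : UqAff F q N) :
    Commute (PowerSeries.C x) D := by
  refine uqAff_induction (P := fun x => Commute (PowerSeries.C x) D) (fun c => ?_) ht htb
    (fun x y hx hy => ?_) (fun x y hx hy => ?_) x
  · rw [← PowerSeries.algebraMap_apply]
    exact Algebra.commutes c D
  · rw [map_mul]; exact hx.mul_left hy
  · rw [map_add]; exact hx.add_left hy

end Central

section Rearrangement

/-- `∏ f a · ∏_{b after a} ρ a b`, taken along a list. -/
def interleavedProd {α M : Type} [Monoid M] (f : α → M) (ρ : α → α → M) : List α → M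
  | [] => 1
  | a :: l => f a * (l.map (ρ a)).prod * interleavedProd f ρ l

theorem prod_flatMap_filter_eq_interleavedProd {α M : Type} [Monoid M] [LinearOrder α]
    (f : α → M) (ρ : α → α → M) {l : List α} (hl : l.Pairwise (· < ·)) :
    (l.flatMap fun i => f i :: ((l.filter fun j => i < j).map (ρ i))).prod
      = interleavedProd f ρ l := by
  induction l with
  | nil => rfl
  | cons a l ih =>
    rw [List.pairwise_cons] at hl
    have hfilter : (a :: l).filter (fun j => a < j) = l := by
      rw [List.filter_cons_of_neg (by simp)]
      exact List.filter_eq_self.mpr fun b hb => by simpa using hl.1 b hb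
    have hrest : (l.flatMap fun i => f i :: (((a :: l).filter fun j => i < j).map (ρ i)))
        = l.flatMap fun i => f i :: ((l.filter fun j => i < j).map (ρ i)) := by
      refine List.flatMap_congr fun i hi => ?_
      rw [List.filter_cons_of_neg (by simpa using (hl.1 i hi).le)]
    rw [List.flatMap_cons, List.prod_append, hfilter, hrest, ih hl.2, List.prod_cons]
    rfl

theorem commute_interleavedProd {α M : Type} [Monoid M] {f : α → M} {ρ : α → α → M} {x : M}
    {l : List α} (hl : l.Nodup) (hf : ∀ a ∈ l, Commute x (f a))
    (hρ : ∀ a ∈ l, ∀ b ∈ l, a ≠ b → Commute x (ρ a b)) :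
    Commute x (interleavedProd f ρ l) := by
  induction l with
  | nil => exact Commute.one_right x
  | cons a l ih =>
    rw [List.nodup_cons] at hl
    refine ((hf a (by simp)).mul_right (Commute.list_prod_right _ _ fun y hy => ?_)).mul_right
      (ih hl.2 (fun b hb => hf b (by simp [hb]))
        fun b hb c hc => hρ b (by simp [hb]) c (by simp [hc]))
    obtain ⟨b, hb, rfl⟩ := List.mem_map.mp hy
    exact hρ a (by simp) b (by simp [hb]) fun h => hl.1 (h ▸ hb)

theorem mul_prod_map_mul_prod_map {α M : Type} [Monoid M] {ρ t : α → M} {b : M} {l : List α}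
    (hl : l.Nodup) (hb : ∀ c ∈ l, b * ρ c * t c = t c * ρ c * b)
    (hρt : ∀ c ∈ l, ∀ d ∈ l, c ≠ d → Commute (ρ c) (t d)) :
    b * ((l.map ρ).prod * (l.map t).prod) = (l.map t).prod * (l.map ρ).prod * b := by
  induction l with
  | nil => simp
  | cons a l ih =>
    rw [List.nodup_cons] at hl
    have ih' := ih hl.2 (fun c hc => hb c (by simp [hc]))
      fun c hc d hd => hρt c (by simp [hc]) d (by simp [hd])
    have h1 : Commute (l.map ρ).prod (t a) := Commute.list_prod_left _ _ fun y hy => by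
      obtain ⟨c, hc, rfl⟩ := List.mem_map.mp hy
      exact hρt c (by simp [hc]) a (by simp) fun h => hl.1 (h ▸ hc)
    have h2 : Commute (ρ a) (l.map t).prod := Commute.list_prod_right _ _ fun y hy => by
      obtain ⟨c, hc, rfl⟩ := List.mem_map.mp hy
      exact hρt a (by simp) c (by simp [hc]) fun h => hl.1 (h ▸ hc)
    simp only [List.map_cons, List.prod_cons]
    calc b * (ρ a * (l.map ρ).prod * (t a * (l.map t).prod))
        = b * ρ a * ((l.map ρ).prod * t a) * (l.map t).prod := by simp only [mul_assoc]
      _ = b * ρ a * t a * ((l.map ρ).prod * (l.map t).prod) := by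
          rw [h1.eq]; simp only [mul_assoc]
      _ = t a * ρ a * (b * ((l.map ρ).prod * (l.map t).prod)) := by
          rw [hb a (by simp)]; simp only [mul_assoc]
      _ = t a * (ρ a * (l.map t).prod) * (l.map ρ).prod * b := by
          rw [ih']; simp only [mul_assoc]
      _ = t a * (l.map t).prod * (ρ a * (l.map ρ).prod) * b := by
          rw [h2.eq]; simp only [mul_assoc]

theorem interleavedProd_eq {α M : Type} [Monoid M] {t g b : α → M} {ρ : α → α → M} {l : List α}
    (hl : l.Nodup) (hpair : l.Pairwise fun i j => b i * ρ i j * t j = t j * ρ i j * b i)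
    (htg : ∀ i j, i ≠ j → Commute (g i) (t j)) (hbg : ∀ i j, i ≠ j → Commute (b i) (g j))
    (htρ : ∀ i j k, i ≠ j → k ≠ i → k ≠ j → Commute (ρ i j) (t k))
    (hbρ : ∀ i j k, i ≠ j → k ≠ i → k ≠ j → Commute (b k) (ρ i j)) :
    interleavedProd (fun a => t a * g a * b a) ρ l
      = (l.map t).prod * interleavedProd g ρ l * (l.map b).prod := by
  induction l with
  | nil => simp [interleavedProd]
  | cons a l ih =>
    rw [List.nodup_cons] at hl
    rw [List.pairwise_cons] at hpair
    have hne : ∀ c ∈ l, a ≠ c := fun c hc h => hl.1 (h ▸ hc)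
    have h1 := mul_prod_map_mul_prod_map (ρ := ρ a) (t := t) (b := b a) hl.2 hpair.1
      fun c hc d hd hcd => htρ a c d (hne c hc) (hne d hd).symm hcd.symm
    have h2 : Commute (g a) (l.map t).prod := Commute.list_prod_right _ _ fun y hy => by
      obtain ⟨c, hc, rfl⟩ := List.mem_map.mp hy
      exact htg a c (hne c hc)
    have h3 : Commute (b a) (interleavedProd g ρ l) :=
      commute_interleavedProd hl.2 (fun c hc => hbg a c (hne c hc))
        fun c hc d hd hcd => hbρ c d a hcd (hne c hc) (hne d hd)
    simp only [interleavedProd, List.map_cons, List.prod_cons]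
    rw [ih hl.2 hpair.2]
    calc _ = t a * g a * (b a * ((l.map (ρ a)).prod * (l.map t).prod))
            * interleavedProd g ρ l * (l.map b).prod := by simp only [mul_assoc]
      _ = t a * (g a * (l.map t).prod) * (l.map (ρ a)).prod * (b a * interleavedProd g ρ l)
            * (l.map b).prod := by rw [h1]; simp only [mul_assoc]
      _ = _ := by rw [h2.eq, h3.eq]; simp only [mul_assoc]

theorem map_interleavedProd {α M M' : Type} [Monoid M] [Monoid M'] (φ : M →* M') (f : α → M)
    (ρ : α → α → M) (l : List α) :
    φ (interleavedProd f ρ l)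
      = interleavedProd (fun a => φ (f a)) (fun a b => φ (ρ a b)) l := by
  induction l with
  | nil => exact map_one φ
  | cons a l ih => simp [interleavedProd, ih, map_list_prod, Function.comp_def]

end Rearrangement

section PartialTranspose

variable {N : ℕ} {S : Type} [Ring S]

/-- Transposition in the first tensor factor. -/
def ptrans (K : Matrix (Fin N × Fin N) (Fin N × Fin N) S) :
    Matrix (Fin N × Fin N) (Fin N × Fin N) S :=
  Matrix.of fun p r => K (r.1, p.2) (p.1, r.2)

theorem amp1_mul_mul_amp2_apply (K : Matrix (Fin N × Fin N) (Fin N × Fin N) S)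
    (X Y : Matrix (Fin N) (Fin N) S) (p r : Fin N × Fin N) :
    (amp1 X * K * amp2 Y) p r
      = ∑ s : Fin N × Fin N, X p.1 s.1 * K (s.1, p.2) (r.1, s.2) * Y s.2 r.2 := by
  simp [Matrix.mul_apply, amp1, amp2, Fintype.sum_prod_type, Finset.sum_mul]
  rw [Finset.sum_comm]

theorem amp2_mul_mul_amp1_apply (K : Matrix (Fin N × Fin N) (Fin N × Fin N) S)
    (X Y : Matrix (Fin N) (Fin N) S) (p r : Fin N × Fin N) :
    (amp2 Y * K * amp1 X) p r
      = ∑ s : Fin N × Fin N, Y p.2 s.2 * K (p.1, s.2) (s.1, r.2) * X s.1 r.1 := by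
  simp [Matrix.mul_apply, amp1, amp2, Fintype.sum_prod_type, Finset.sum_mul]

theorem ptrans_exchange {K : Matrix (Fin N × Fin N) (Fin N × Fin N) S}
    {X Y : Matrix (Fin N) (Fin N) S} (hK : ∀ p r x, Commute (K p r) x)
    (h : K * amp1 X * amp2 Y = amp2 Y * amp1 X * K) :
    amp1 X.transpose * ptrans K * amp2 Y = amp2 Y * ptrans K * amp1 X.transpose := by
  ext p r
  have h' := congrFun (congrFun h (r.1, p.2)) (p.1, r.2)
  rw [mul_amp1_amp2_apply, amp2_amp1_mul_apply] at h'
  rw [amp1_mul_mul_amp2_apply, amp2_mul_mul_amp1_apply]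
  simp only [Matrix.transpose_apply, ptrans, Matrix.of_apply, Prod.mk.eta]
  calc _ = ∑ s, K (r.1, p.2) s * (X s.1 p.1 * Y s.2 r.2) :=
        Finset.sum_congr rfl fun s _ => by rw [← (hK _ _ _).eq, mul_assoc]
    _ = _ := h'
    _ = _ := Finset.sum_congr rfl fun s _ => by
      rw [mul_assoc, mul_assoc, (hK _ _ _).eq]

end PartialTranspose

section SeriesProducts

theorem seriesProdCoeff_eq_zero {M : Type} [Ring M] (L : List (ℤ → M)) {m : ℤ}
    (h : (L.length : ℤ) < m) : seriesProdCoeff L m = 0 := by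
  cases L with
  | nil => exact if_neg h.ne'
  | cons c t =>
    rw [List.length_cons] at h
    rw [seriesProdCoeff, Finset.Icc_eq_empty (by push_cast at h; omega), Finset.sum_empty]

variable {A m : Type} [Ring A] [Fintype m] [DecidableEq m]

theorem seriesProdCoeff_mem (Y : Subring A) (L : List (ℤ → Matrix m m A))
    (h : ∀ c ∈ L, ∀ k f g, c k f g ∈ Y) (k : ℤ) (f g : m) : seriesProdCoeff L k f g ∈ Y := by
  induction L generalizing k f g with
  | nil =>
    rw [seriesProdCoeff]
    split_ifs
    · rw [Matrix.one_apply]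
      split_ifs
      exacts [Y.one_mem, Y.zero_mem]
    · exact Y.zero_mem
  | cons c t ih =>
    rw [seriesProdCoeff, Matrix.sum_apply]
    refine Y.sum_mem fun i _ => ?_
    rw [Matrix.mul_apply]
    exact Y.sum_mem fun s _ => Y.mul_mem (h c (by simp) _ _ _)
      (ih (fun c' hc' => h c' (by simp [hc'])) _ _ _)

/-- A matrix Laurent series `Σ cₖ uᵏ` supported in degrees `≤ 1`, multiplied by `u⁻¹` and written
as a power series in `u⁻¹`. -/
def toSeries (c : ℤ → Matrix m m A) : Matrix m m (PowerSeries A) :=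
  Matrix.of fun f g => PowerSeries.mk fun n => c (1 - n) f g

theorem coeff_prod_toSeries (L : List (ℤ → Matrix m m A)) (n : ℕ) (f g : m) :
    PowerSeries.coeff n ((L.map toSeries).prod f g)
      = seriesProdCoeff L (L.length - n) f g := by
  induction L generalizing n f g with
  | nil =>
    change PowerSeries.coeff n ((1 : Matrix m m (PowerSeries A)) f g)
      = (if (0 : ℤ) - n = 0 then (1 : Matrix m m A) else 0) f g
    by_cases hn : n = 0
    · rw [if_pos (by simp [hn]), Matrix.one_apply, Matrix.one_apply, hn]
      split_ifs <;> simp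
    · rw [if_neg (by simp [hn]), Matrix.zero_apply, Matrix.one_apply]
      split_ifs <;> simp [PowerSeries.coeff_one, hn]
  | cons c t ih =>
    rw [List.map_cons, List.prod_cons, Matrix.mul_apply, map_sum, seriesProdCoeff,
      Matrix.sum_apply]
    simp only [PowerSeries.coeff_mul, ih, Matrix.mul_apply, toSeries, Matrix.of_apply,
      PowerSeries.coeff_mk]
    rw [Finset.sum_comm, Finset.Nat.sum_antidiagonal_eq_sum_range_succ_mk]
    refine Finset.sum_bij' (fun i _ => 1 - (i : ℤ)) (fun k _ => (1 - k).toNat) ?_ ?_ ?_ ?_ ?_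
    · intro i hi
      rw [Finset.mem_range] at hi
      rw [Finset.mem_Icc, List.length_cons]
      push_cast
      omega
    · intro k hk
      rw [Finset.mem_Icc, List.length_cons] at hk
      rw [Finset.mem_range]
      push_cast at hk
      omega
    · intro i hi
      simp
    · intro k hk
      rw [Finset.mem_Icc] at hk
      omega
    · intro i hi
      rw [Finset.mem_range] at hi
      refine Finset.sum_congr rfl fun s _ => ?_
      have : ((c :: t).length : ℤ) - n - (1 - i) = t.length - (n - i : ℕ) := by
        rw [List.length_cons, Nat.cast_sub (by omega)]
        push_cast
        ring
      rw [this]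

end SeriesProducts

section Counit

variable {F : Type} [Field F] {q : F} {N : ℕ}

/-- The values of the counit on the coefficients of `T(u)` and `T̄(u)`. -/
def counitMat (F : Type) [Field F] (N : ℕ) (r : ℕ) : Matrix (Fin N) (Fin N) F :=
  if r = 0 then 1 else 0

theorem z1_counitMat (a : ℤ) : z1 (counitMat F N) a = if a = 0 then 1 else 0 := by
  rcases lt_trichotomy a 0 with h | rfl | h
  · rw [z1, if_neg h.not_ge, if_neg h.ne]
  · ext p r
    by_cases h1 : p.1 = r.1 <;> by_cases h2 : p.2 = r.2 <;>
      simp [z1, counitMat, amp1, Matrix.one_apply, Prod.ext_iff, h1, h2]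
  · have : a.toNat ≠ 0 := by omega
    ext p r
    simp [z1, counitMat, amp1, this, h.ne', h.le]

theorem z2_counitMat (a : ℤ) : z2 (counitMat F N) a = if a = 0 then 1 else 0 := by
  rcases lt_trichotomy a 0 with h | rfl | h
  · rw [z2, if_neg h.not_ge, if_neg h.ne]
  · ext p r
    simp [z2, counitMat, amp2, Matrix.one_apply, Prod.ext_iff, ite_and]
  · have : a.toNat ≠ 0 := by omega
    ext p r
    simp [z2, counitMat, amp2, this, h.ne', h.le]

theorem affRtt_counitMat (q : F) (a b a' b' : ℤ) :
    affRttL F q (counitMat F N) (counitMat F N) a b a' b'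
      = affRttR F q (counitMat F N) (counitMat F N) a b a' b' := by
  simp only [affRttL, affRttR, z1_counitMat, z2_counitMat]
  split_ifs <;> simp

/-- The counit on the generators. -/
def counitFree (F : Type) [Field F] (N : ℕ) : FreeAlgebra F (AffGen N) →ₐ[F] F :=
  FreeAlgebra.lift F (Sum.elim (fun g => counitMat F N g.1 g.2.1 g.2.2)
    fun g => counitMat F N g.1 g.2.1 g.2.2)

theorem counitFree_TfA (r : ℕ) (i j : Fin N) :
    counitFree F N (TfA F N r i j) = counitMat F N r i j := by
  simp [counitFree, TfA]

theorem counitFree_TbfA (r : ℕ) (i j : Fin N) :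
    counitFree F N (TbfA F N r i j) = counitMat F N r i j := by
  simp [counitFree, TbfA]

theorem counitFree_rel {x y : FreeAlgebra F (AffGen N)} (h : AffGlRel F q N x y) :
    counitFree F N x = counitFree F N y := by
  have ht : (fun r => (TfA F N r).map (counitFree F N)) = counitMat F N :=
    funext fun r => Matrix.ext fun i j => counitFree_TfA r i j
  have htb : (fun r => (TbfA F N r).map (counitFree F N)) = counitMat F N :=
    funext fun r => Matrix.ext fun i j => counitFree_TbfA r i j
  cases h with
  | t0_tri i j h => simp [counitFree_TfA, counitMat, h.ne]
  | tb0_tri i j h => simp [counitFree_TbfA, counitMat, h.ne']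
  | t_tb i => simp [counitFree_TfA, counitFree_TbfA, counitMat]
  | tb_t i => simp [counitFree_TfA, counitFree_TbfA, counitMat]
  | rtt a b p r => rw [map_affRttL, map_affRttR, ht, affRtt_counitMat]
  | rtbtb a b p r => rw [map_affRttL, map_affRttR, htb, affRtt_counitMat]
  | rtbt a b p r => rw [map_affRttL, map_affRttR, ht, htb, affRtt_counitMat]

/-- The counit of `U_q(ĝl_N)`. -/
def counit (F : Type) [Field F] (q : F) (N : ℕ) : UqAff F q N →ₐ[F] F :=
  RingQuot.liftAlgHom F ⟨counitFree F N, fun _ _ h => counitFree_rel h⟩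

theorem counit_tA (r : ℕ) (i j : Fin N) : counit F q N (tA F q N r i j) = counitMat F N r i j := by
  rw [counit, tA, RingQuot.liftAlgHom_mkAlgHom_apply]
  exact counitFree_TfA r i j

theorem counit_tbA (r : ℕ) (i j : Fin N) :
    counit F q N (tbA F q N r i j) = counitMat F N r i j := by
  rw [counit, tbA, RingQuot.liftAlgHom_mkAlgHom_apply]
  exact counitFree_TbfA r i j

theorem map_counit_tSer (d : F) :
    (tSer F q N d).map (PowerSeries.map (counit F q N : UqAff F q N →+* F)) = 1 := by
  ext i j n
  simp only [tSer, Specialization.mat1, diagSpec, ser, Matrix.map_apply, Matrix.of_apply,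
    PowerSeries.coeff_map, PowerSeries.coeff_mk, tMat]
  change counit F q N (d ^ n • tA F q N n i j) = _
  rw [map_smul, counit_tA, counitMat]
  by_cases hn : n = 0 <;> by_cases hij : i = j <;>
    simp [hn, hij, Matrix.one_apply, PowerSeries.coeff_one]

theorem map_counit_tbSer (d : F) :
    (tbSer F q N d).map (PowerSeries.map (counit F q N : UqAff F q N →+* F)) = 1 := by
  ext i j n
  simp only [tbSer, Specialization.mat1, diagSpec, ser, Matrix.map_apply, Matrix.of_apply,
    PowerSeries.coeff_map, PowerSeries.coeff_mk, tbMat]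
  change counit F q N (d ^ n • tbA F q N n i j) = _
  rw [map_smul, counit_tbA, counitMat]
  by_cases hn : n = 0 <;> by_cases hij : i = j <;>
    simp [hn, hij, Matrix.one_apply, PowerSeries.coeff_one]

end Counit

section Factors

variable {F : Type} [Field F] {A : Type} [Ring A] [Algebra F A] {N : ℕ}

theorem toSeries_emb1 (k : Fin N) (c : ℤ → Matrix (Fin N) (Fin N) A) :
    toSeries (fun m => emb1 k (c m)) = emb1 k (toSeries c) := by
  ext f g n
  simp only [toSeries, emb1, Matrix.of_apply, PowerSeries.coeff_mk]
  split_ifs <;> simp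

theorem toSeries_emb2 (i j : Fin N) (c : ℤ → Matrix (Fin N × Fin N) (Fin N × Fin N) A) :
    toSeries (fun m => emb2 i j (c m)) = emb2 i j (toSeries c) := by
  ext f g n
  simp only [toSeries, emb2, Matrix.of_apply, PowerSeries.coeff_mk]
  split_ifs <;> simp

/-- The factor `T(u) G T̄(u⁻¹)ᵗ` at the site `k`, with `u` rescaled by `q⁻²ᵏ`. -/
theorem toSeries_sFactor (q : F) {t tb S : ℕ → Matrix (Fin N) (Fin N) A}
    (G : Matrix (Fin N) (Fin N) F)
    (hS : ∀ r i j, S r i j = ∑ p ∈ Finset.HasAntidiagonal.antidiagonal r, ∑ a, ∑ b,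
      G a b • (t p.1 i a * tb p.2 j b)) (k : Fin N) :
    toSeries (fun m : ℤ =>
        if m ≤ 0 then q ^ (2 * (k.val : ℤ) * (-m)) • ampAt k (S (-m).toNat) else 0)
      = emb1 k ((diagSpec A (q ^ (2 * k.val)) (q ^ (2 * k.val))).mat1 t) *
        emb1 k ((PowerSeries.X : PowerSeries A) • liftF F G) *
        emb1 k ((diagSpec A (q ^ (2 * k.val)) (q ^ (2 * k.val))).mat1 tb).transpose := by
  have hemb : (fun m : ℤ =>
        if m ≤ 0 then q ^ (2 * (k.val : ℤ) * (-m)) • ampAt k (S (-m).toNat) else 0)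
      = fun m : ℤ => emb1 k
        (if m ≤ 0 then q ^ (2 * (k.val : ℤ) * (-m)) • S (-m).toNat else 0) := by
    funext m
    split_ifs
    · rw [ampAt_eq_emb1, emb1_smul]
    · ext f g
      simp [emb1]
  rw [hemb, toSeries_emb1, ← emb1_mul, ← emb1_mul]
  congr 1
  ext i j n
  have hX : (((diagSpec A (q ^ (2 * k.val)) (q ^ (2 * k.val))).mat1 t *
        ((PowerSeries.X : PowerSeries A) • liftF F G) *
        ((diagSpec A (q ^ (2 * k.val)) (q ^ (2 * k.val))).mat1 tb).transpose :
          Matrix _ _ (PowerSeries A)) i j)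
      = PowerSeries.X * ∑ a, ∑ b, G a b • (ser (q ^ (2 * k.val)) (fun r => t r i a) *
          ser (q ^ (2 * k.val)) (fun r => tb r j b)) := by
    rw [Matrix.mul_apply, Finset.sum_comm, Finset.mul_sum]
    refine Finset.sum_congr rfl fun b _ => ?_
    rw [Matrix.mul_apply, Finset.mul_sum, Finset.sum_mul]
    refine Finset.sum_congr rfl fun a _ => ?_
    rw [Matrix.smul_apply, smul_eq_mul, ← mul_assoc, ← (powerSeries_X_central _).eq, mul_assoc,
      mul_assoc, liftF, Matrix.map_apply, ← Algebra.smul_def, mul_smul_comm]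
    rfl
  rw [hX, toSeries, Matrix.of_apply, PowerSeries.coeff_mk]
  cases n with
  | zero => simp [PowerSeries.coeff_zero_X_mul]
  | succ n =>
    rw [PowerSeries.coeff_succ_X_mul, if_pos (by push_cast; omega)]
    have h1 : -(1 - ((n + 1 : ℕ) : ℤ)) = n := by push_cast; ring
    have h2 : q ^ (2 * (k.val : ℤ) * (n : ℤ)) = (q ^ (2 * k.val)) ^ n := by
      rw [← pow_mul, ← zpow_natCast]; push_cast; rfl
    rw [h1, Int.toNat_natCast, Matrix.smul_apply, hS, h2, Finset.sum_comm, Finset.smul_sum,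
      map_sum]
    refine Finset.sum_congr rfl fun a _ => ?_
    rw [Finset.sum_comm, Finset.smul_sum, map_sum]
    refine Finset.sum_congr rfl fun b _ => ?_
    rw [PowerSeries.coeff_smul, PowerSeries.coeff_mul, Finset.smul_sum, Finset.smul_sum]
    refine Finset.sum_congr rfl fun p hp => ?_
    rw [Finset.HasAntidiagonal.mem_antidiagonal] at hp
    rw [ser, ser, PowerSeries.coeff_mk, PowerSeries.coeff_mk, smul_mul_smul_comm, ← pow_add, hp,
      smul_comm]

/-- The twisted R-matrix factor, up to a power of `q`. -/
def rFactor (q : F) (N : ℕ) (S : Type) [Ring S] [Algebra F S] (x : S) (i j : ℕ) :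
    Matrix (Fin N × Fin N) (Fin N × Fin N) S :=
  (q ^ (2 * j))⁻¹ • ptrans (RB q N ((q ^ (2 * i) • x) * (q ^ (2 * j) • x)) 1)

theorem toSeries_rFactor {q : F} (hq : q ≠ 0) (i j : Fin N) :
    toSeries (fun m : ℤ => if m = -1 then q ^ (2 * (i.val : ℤ)) • big2A F i j (Rtilt F q N)
        else if m = 1 then (-(q ^ (-2 * (j.val : ℤ)))) • big2A F i j (Rct F q N) else 0)
      = emb2 i j (rFactor q N (PowerSeries A) PowerSeries.X i.val j.val) := by
  have hemb : (fun m : ℤ => if m = -1 then q ^ (2 * (i.val : ℤ)) • big2A F i j (Rtilt F q N)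
        else if m = 1 then (-(q ^ (-2 * (j.val : ℤ)))) • big2A F i j (Rct F q N) else 0)
      = fun m : ℤ => emb2 i j
      (if m = -1 then q ^ (2 * (i.val : ℤ)) • (liftF F (Rtilt F q N) : Matrix _ _ A)
        else if m = 1 then (-(q ^ (-2 * (j.val : ℤ)))) • liftF F (Rct F q N) else 0) := by
    funext m
    split_ifs
    · rw [big2A_eq_emb2, emb2_smul]
    · rw [big2A_eq_emb2, emb2_smul]
    · ext f g
      simp [emb2]
  rw [hemb, toSeries_emb2]
  congr 1
  ext p r n
  rw [toSeries, Matrix.of_apply, PowerSeries.coeff_mk, rFactor, Matrix.smul_apply, ptrans,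
    Matrix.of_apply, RB_apply, smul_mul_smul_comm, PowerSeries.coeff_smul, map_sub,
    PowerSeries.coeff_smul, PowerSeries.coeff_smul, PowerSeries.coeff_smul, ← pow_two,
    PowerSeries.coeff_X_pow, PowerSeries.coeff_one]
  have hi : q ^ (2 * (i.val : ℤ)) = q ^ (2 * i.val) := by rw [← zpow_natCast]; push_cast; rfl
  have hj : q ^ (-2 * (j.val : ℤ)) = (q ^ (2 * j.val))⁻¹ := by
    rw [← zpow_natCast, ← zpow_neg]; push_cast; rw [neg_mul]
  rw [hi, hj]
  rcases n with _ | _ | _ | n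
  · simp [liftF, Rct, Algebra.smul_def]
  · simp
  · have h1 : 1 - ((0 + 1 + 1 : ℕ) : ℤ) = -1 := by norm_num
    rw [if_pos h1, Matrix.smul_apply, if_pos rfl, if_neg (by norm_num), smul_zero, sub_zero]
    simp only [liftF, Rtilt, Matrix.map_apply, Matrix.of_apply, Algebra.smul_def, mul_one,
      ← map_mul]
    congr 1
    field_simp
  · have h1 : 1 - ((n + 1 + 1 + 1 : ℕ) : ℤ) ≠ -1 := by push_cast; omega
    have h2 : 1 - ((n + 1 + 1 + 1 : ℕ) : ℤ) ≠ 1 := by push_cast; omega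
    rw [if_neg h1, if_neg h2]
    simp

/-- The canonical map `F⟦X⟧ → A⟦X⟧`. -/
def scalarSeries (F A : Type) [Field F] [Ring A] [Algebra F A] :
    PowerSeries F →ₐ[F] PowerSeries A where
  __ := (PowerSeries.map (algebraMap F A) : PowerSeries F →+* PowerSeries A)
  commutes' c := by
    change PowerSeries.map (algebraMap F A) _ = _
    rw [PowerSeries.algebraMap_apply, PowerSeries.algebraMap_apply, PowerSeries.map_C]
    rfl

theorem scalarSeries_X : scalarSeries F A PowerSeries.X = PowerSeries.X := PowerSeries.map_X _

theorem scalarSeries_central (p : PowerSeries F) (b : PowerSeries A) :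
    Commute (scalarSeries F A p) b := by
  rw [commute_iff_eq]
  ext n
  change PowerSeries.coeff n (PowerSeries.map (algebraMap F A) p * b)
    = PowerSeries.coeff n (b * PowerSeries.map (algebraMap F A) p)
  rw [PowerSeries.coeff_mul, PowerSeries.coeff_mul, ← Finset.Nat.sum_antidiagonal_swap]
  refine Finset.sum_congr rfl fun k _ => ?_
  simp [Algebra.commutes]

theorem map_liftF {S T : Type} [Ring S] [Algebra F S] [Ring T] [Algebra F T] {m : Type}
    (φ : S →ₐ[F] T) (M : Matrix m m F) : (liftF F M : Matrix m m S).map φ = liftF F M := by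
  ext i j
  simp [liftF]

theorem map_rFactor {S T : Type} [Ring S] [Algebra F S] [Ring T] [Algebra F T]
    (φ : S →ₐ[F] T) (q : F) (x : S) (i j : ℕ) :
    (rFactor q N S x i j).map φ = rFactor q N T (φ x) i j := by
  ext p r
  simp only [rFactor, ptrans, Matrix.map_apply, Matrix.smul_apply, Matrix.of_apply, RB_apply,
    map_smul, map_sub, map_mul, map_one]

theorem rFactor_comm {S : Type} [Ring S] [Algebra F S] (q : F) {x : S} (hx : ∀ s, Commute x s)
    (i j : ℕ) (p r : Fin N × Fin N) (s : S) : Commute (rFactor q N S x i j p r) s :=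
  smul_central _ (RB_comm q (fun s => (smul_central _ hx s).mul_left (smul_central _ hx s))
    Commute.one_left _ _) s

end Factors


section Factorization

variable {F : Type} [Field F] {N : ℕ}

/-- The scalar part of the product defining the Sklyanin determinant. -/
def scalarPart (q : F) (G : Matrix (Fin N) (Fin N) F) (S : Type) [Ring S] [Algebra F S] (x : S) :
    Matrix (Fin N → Fin N) (Fin N → Fin N) S :=
  interleavedProd (fun k => emb1 k (x • liftF F G))
    (fun i j => emb2 i j (rFactor q N S x i.val j.val)) (List.finRange N)

theorem map_scalarPart {S T : Type} [Ring S] [Algebra F S] [Ring T] [Algebra F T]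
    (φ : S →ₐ[F] T) (q : F) (G : Matrix (Fin N) (Fin N) F) (x : S) :
    (scalarPart q G S x).map φ = scalarPart q G T (φ x) := by
  have h := map_interleavedProd ((φ : S →+* T).mapMatrix :
      Matrix (Fin N → Fin N) (Fin N → Fin N) S →+* _).toMonoidHom
    (fun k => emb1 k (x • liftF F G)) (fun i j => emb2 i j (rFactor q N S x i.val j.val))
    (List.finRange N)
  have hg : ∀ k : Fin N, (emb1 k (x • liftF F G)).map φ = emb1 k (φ x • (liftF F G)) := by
    intro k
    have := map_emb1 (φ : S →+* T) k (x • (liftF F G : Matrix (Fin N) (Fin N) S))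
    refine this.trans ?_
    congr 1
    rw [← map_liftF φ G]
    ext i j
    simp
  have hρ : ∀ i j : Fin N, (emb2 i j (rFactor q N S x i.val j.val)).map φ
      = emb2 i j (rFactor q N T (φ x) i.val j.val) := by
    intro i j
    have := map_emb2 (φ : S →+* T) i j (rFactor q N S x i.val j.val)
    refine this.trans ?_
    congr 1
    exact map_rFactor φ q x _ _
  refine h.trans ?_
  rw [scalarPart]
  congr 1
  · exact funext hg
  · exact funext fun i => funext fun j => hρ i j

variable {q : F}

theorem emb_exchange_rFactor {S : Type} [Ring S] [Algebra F S] {i j : Fin N} (hij : i ≠ j)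
    {X Y : Matrix (Fin N) (Fin N) S} {x : S} (hx : ∀ s, Commute x s)
    (h : RB q N ((q ^ (2 * i.val) • x) * (q ^ (2 * j.val) • x)) 1 * amp1 X * amp2 Y
      = amp2 Y * amp1 X * RB q N ((q ^ (2 * i.val) • x) * (q ^ (2 * j.val) • x)) 1) :
    emb1 i X.transpose * emb2 i j (rFactor q N S x i.val j.val) * emb1 j Y
      = emb1 j Y * emb2 i j (rFactor q N S x i.val j.val) * emb1 i X.transpose := by
  have h' := congrArg (emb2 i j) (ptrans_exchange
    (RB_comm q (fun s => (smul_central _ hx s).mul_left (smul_central _ hx s)) Commute.one_left) h)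
  rw [emb2_mul hij, emb2_mul hij, emb2_mul hij, emb2_mul hij, emb2_amp1 hij, emb2_amp2 hij] at h'
  simp only [rFactor, emb2_smul, Matrix.mul_smul, Matrix.smul_mul, h']

theorem interleavedProd_eq_mul_scalarPart {S : Type} [Ring S] [Algebra F S] (q : F) {x : S}
    (hx : ∀ s, Commute x s) (G : Matrix (Fin N) (Fin N) F) (T Tb : Fin N → Matrix (Fin N) (Fin N) S)
    (h : ∀ i j : Fin N, RB q N ((q ^ (2 * i.val) • x) * (q ^ (2 * j.val) • x)) 1 * amp1 (Tb i) *
        amp2 (T j)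
      = amp2 (T j) * amp1 (Tb i) * RB q N ((q ^ (2 * i.val) • x) * (q ^ (2 * j.val) • x)) 1) :
    interleavedProd (fun k => emb1 k (T k) * emb1 k (x • liftF F G) * emb1 k (Tb k).transpose)
        (fun i j => emb2 i j (rFactor q N S x i.val j.val)) (List.finRange N)
      = ((List.finRange N).map fun k => emb1 k (T k)).prod * scalarPart q G S x *
        ((List.finRange N).map fun k => emb1 k (Tb k).transpose).prod := by
  have hG : ∀ (a b : Fin N) (s : S), Commute ((x • liftF F G) a b) s := fun a b s =>
    (hx s).mul_left (Algebra.commute_algebraMap_left _ s)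
  refine interleavedProd_eq (t := fun k => emb1 k (T k)) (b := fun k => emb1 k (Tb k).transpose)
    (g := fun k => emb1 k (x • liftF F G)) (List.nodup_finRange N)
    ((List.nodup_finRange N).imp fun hij => emb_exchange_rFactor hij hx (h _ _)) ?_ ?_ ?_ ?_
  · exact fun i j hij => commute_emb1_emb1 hij _ _ fun a b c d => hG a b _
  · exact fun i j hij => commute_emb1_emb1 hij _ _ fun a b c d => (hG c d _).symm
  · exact fun i j k hij hki hkj => commute_emb2_emb1 hij hki hkj _ _ fun a b c d =>
      rFactor_comm q hx _ _ _ _ _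
  · exact fun i j k hij hki hkj => (commute_emb2_emb1 hij hki hkj _ _ fun a b c d =>
      rFactor_comm q hx _ _ _ _ _).symm

theorem rtt_tbSer_tSer (i j : Fin N) :
    RB q N ((q ^ (2 * i.val) • (PowerSeries.X : PowerSeries (UqAff F q N))) *
        (q ^ (2 * j.val) • PowerSeries.X)) 1 * amp1 (tbSer F q N (q ^ (2 * i.val))) *
        amp2 (tSer F q N (q ^ (2 * j.val)))
      = amp2 (tSer F q N (q ^ (2 * j.val))) * amp1 (tbSer F q N (q ^ (2 * i.val))) *
        RB q N ((q ^ (2 * i.val) • (PowerSeries.X : PowerSeries (UqAff F q N))) *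
          (q ^ (2 * j.val) • PowerSeries.X)) 1 := by
  have h := (diagSpec (UqAff F q N) (q ^ (2 * i.val)) (q ^ (2 * j.val))).rtt_tb_t (q := q)
  exact h

theorem interleavedProd_sFactors (q : F) (G : Matrix (Fin N) (Fin N) F) :
    interleavedProd (fun k => emb1 k (tSer F q N (q ^ (2 * k.val))) *
          emb1 k ((PowerSeries.X : PowerSeries (UqAff F q N)) • liftF F G) *
          emb1 k (tbSer F q N (q ^ (2 * k.val))).transpose)
        (fun i j => emb2 i j (rFactor q N (PowerSeries (UqAff F q N)) PowerSeries.X i.val j.val))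
        (List.finRange N)
      = ((List.finRange N).map fun k => emb1 k (tSer F q N (q ^ (2 * k.val)))).prod *
        scalarPart q G (PowerSeries (UqAff F q N)) PowerSeries.X *
        ((List.finRange N).map fun k => emb1 k (tbSer F q N (q ^ (2 * k.val))).transpose).prod := by
  have h := @interleavedProd_eq_mul_scalarPart F _ N (PowerSeries (UqAff F q N)) _ _ q
    PowerSeries.X powerSeries_X_central G (fun k => tSer F q N (q ^ (2 * k.val)))
    (fun k => tbSer F q N (q ^ (2 * k.val))) rtt_tbSer_tSer
  exact h

end Factorization

section Retraction

theorem eq_mul_mul_of_retraction {P B m : Type} [CommRing P] [Ring B] [Fintype m] [DecidableEq m]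
    (φ : P →+* B) (ψ : B →+* P) (hψφ : ∀ p, ψ (φ p) = p) (hφ : ∀ p b, Commute (φ p) b)
    {η : m → P} {o : m} (ho : η o = 1) (x : P) (K : Matrix m m P) {T T' : Matrix m m B}
    {D D' s : B}
    (hT : Matrix.vecMul (fun g => φ (η g)) T = D • fun g => φ (η g))
    (hT' : Matrix.vecMul (fun g => φ (η g)) T' = D' • fun g => φ (η g))
    (hψT : T.map ψ = 1) (hψT' : T'.map ψ = 1)
    (h : φ x • Matrix.vecMul (fun g => φ (η g)) (T * K.map φ * T') = s • fun g => φ (η g)) :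
    s = D * φ (ψ s) * D' := by
  have hmap : ∀ (v : m → B) (M : Matrix m m B) g,
      ψ (Matrix.vecMul v M g) = Matrix.vecMul (fun i => ψ (v i)) (M.map ψ) g :=
    fun v M g => RingHom.map_vecMul ψ M v g
  have hD : ψ D = 1 := by
    have := congrArg ψ (congrFun hT o)
    rw [hmap, hψT, Matrix.vecMul_one] at this
    simpa [hψφ, ho] using this.symm
  have hK : (K.map φ).map ψ = K := by
    ext i j
    exact hψφ _
  have hvK : Matrix.vecMul (fun g => φ (η g)) (K.map φ) = fun g => φ (Matrix.vecMul η K g) :=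
    funext fun g => (RingHom.map_vecMul φ K η g).symm
  have hlin : Matrix.vecMul (fun g => φ (η g)) (T * K.map φ * T')
      = D • Matrix.vecMul (fun g => φ (Matrix.vecMul η K g)) T' := by
    rw [← Matrix.vecMul_vecMul, ← Matrix.vecMul_vecMul, hT, Matrix.smul_vecMul,
      Matrix.smul_vecMul, hvK]
  rw [hlin] at h
  have hκ : ∀ g, x * Matrix.vecMul η K g = ψ s * η g := by
    intro g
    have := congrArg ψ (congrFun h g)
    simp only [Pi.smul_apply, smul_eq_mul, map_mul, hmap, hψT', Matrix.vecMul_one, hψφ, hD,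
      one_mul] at this
    exact this
  have hv : (φ x • fun g => φ (Matrix.vecMul η K g)) = φ (ψ s) • fun g => φ (η g) := by
    funext g
    simp only [Pi.smul_apply, smul_eq_mul, ← map_mul, hκ]
  rw [smul_smul, (hφ x D).eq, ← smul_smul, ← Matrix.smul_vecMul, hv, Matrix.smul_vecMul, hT',
    smul_smul] at h
  have ho' := congrFun h o
  simpa [ho, mul_assoc] using ho'.symm

end Retraction

section Rows

variable {F : Type} [Field F] {A : Type} [Ring A] [Algebra F A]

theorem X_smul_vecMul_prod_toSeries {m : Type} [Fintype m] [DecidableEq m] (Z : Matrix m m F)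
    (o : m) (L : List (ℤ → Matrix m m A)) (sd : ℤ → A)
    (hsd : ∀ k : ℤ, seriesProdCoeff
      ((fun k' : ℤ => if k' = 0 then Z.map (algebraMap F A) else 0) :: L) k
        = sd k • Z.map (algebraMap F A)) :
    (PowerSeries.X : PowerSeries A) •
        Matrix.vecMul (fun g => algebraMap F (PowerSeries A) (Z o g)) (L.map toSeries).prod
      = (PowerSeries.mk fun n : ℕ => sd (L.length + 1 - n)) •
        fun g => algebraMap F (PowerSeries A) (Z o g) := by
  have hhead : toSeries (fun k' : ℤ => if k' = 0 then Z.map (algebraMap F A) else 0)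
      = Matrix.of fun f g => PowerSeries.X * algebraMap F (PowerSeries A) (Z f g) := by
    ext f g n
    rw [toSeries, Matrix.of_apply, PowerSeries.coeff_mk, Matrix.of_apply,
      PowerSeries.algebraMap_apply, PowerSeries.coeff_mul_C, PowerSeries.coeff_X]
    by_cases hn : n = 1
    · simp [hn]
    · have : 1 - (n : ℤ) ≠ 0 := by omega
      simp [this, hn]
  funext g
  ext n
  have h := coeff_prod_toSeries
    ((fun k' : ℤ => if k' = 0 then Z.map (algebraMap F A) else 0) :: L) n o g
  rw [hsd, List.map_cons, List.prod_cons, hhead, Matrix.mul_apply] at h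
  rw [Pi.smul_apply, Pi.smul_apply, smul_eq_mul, smul_eq_mul, PowerSeries.algebraMap_apply,
    PowerSeries.coeff_mul_C, PowerSeries.coeff_mk]
  rw [Matrix.smul_apply, Matrix.map_apply, smul_eq_mul, List.length_cons] at h
  push_cast at h
  rw [← h]
  congr 1
  simp only [Matrix.vecMul, dotProduct, Finset.mul_sum, Matrix.of_apply, mul_assoc]

variable {N : ℕ} {S : Type} [Ring S] [Algebra F S]

theorem vecMul_eta_prod_eq_detRow_smul {q : F} (hq : q ≠ 0) (h2 : (2 : F) ≠ 0)
    {η : (Fin N → Fin N) → F} (hη : AntiSym q η) (h1 : η id = 1)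
    (M : Fin N → Matrix (Fin N) (Fin N) S)
    (hM : ∀ (i : ℕ) (h : i + 1 < N),
      EM q N S * (amp1 (M ⟨i, Nat.lt_of_succ_lt h⟩) * amp2 (M ⟨i + 1, h⟩))
        = amp2 (M ⟨i + 1, h⟩) * amp1 (M ⟨i, Nat.lt_of_succ_lt h⟩) * EM q N S) :
    Matrix.vecMul (fun g => algebraMap F S (η g))
        ((List.finRange N).map fun a => emb1 a (M a)).prod
      = detRow η M • fun g => algebraMap F S (η g) := by
  funext g
  rw [vecMul_eta_prod hq h2 hη h1 M hM g, Algebra.smul_def, Algebra.commutes]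
  rfl

theorem map_prod_emb1_eq_one {T : Type} [Ring T] (φ : S →+* T)
    (M : Fin N → Matrix (Fin N) (Fin N) S) (h : ∀ a, (M a).map φ = 1) :
    (((List.finRange N).map fun a => emb1 a (M a)).prod).map φ = 1 := by
  change φ.mapMatrix _ = 1
  rw [map_list_prod, List.map_map]
  refine List.prod_eq_one fun x hx => ?_
  obtain ⟨a, -, rfl⟩ := List.mem_map.mp hx
  change (emb1 a (M a)).map φ = 1
  rw [map_emb1, h, emb1_one]

theorem commute_of_eq_mul_mul {D D' s : PowerSeries A} (p : PowerSeries F)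
    (hs : s = D * scalarSeries F A p * D') (hD : ∀ x, Commute (PowerSeries.C x) D)
    (hD' : ∀ x, Commute (PowerSeries.C x) D') (n : ℕ) (x : A) :
    Commute (PowerSeries.coeff n s) x := by
  have h : Commute (PowerSeries.C x) s := hs ▸
    ((hD x).mul_right (scalarSeries_central p _).symm).mul_right (hD' x)
  have := congrArg (PowerSeries.coeff n) h.eq
  rw [PowerSeries.coeff_C_mul, PowerSeries.coeff_mul_C] at this
  exact this.symm

theorem exists_eq_mul_scalarSeries_mul {m : Type} [Fintype m] [DecidableEq m] (ε : A →ₐ[F] F)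
    {η : m → F} {o : m} (ho : η o = 1) (K : Matrix m m (PowerSeries F))
    {T T' K' : Matrix m m (PowerSeries A)} {D D' s : PowerSeries A}
    (hT : Matrix.vecMul (fun g => algebraMap F (PowerSeries A) (η g)) T
      = D • fun g => algebraMap F (PowerSeries A) (η g))
    (hT' : Matrix.vecMul (fun g => algebraMap F (PowerSeries A) (η g)) T'
      = D' • fun g => algebraMap F (PowerSeries A) (η g))
    (hεT : T.map (PowerSeries.map (ε : A →+* F)) = 1)
    (hεT' : T'.map (PowerSeries.map (ε : A →+* F)) = 1)
    (hK : K.map (scalarSeries F A) = K')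
    (h : (PowerSeries.X : PowerSeries A) •
        Matrix.vecMul (fun g => algebraMap F (PowerSeries A) (η g)) (T * K' * T')
      = s • fun g => algebraMap F (PowerSeries A) (η g)) :
    ∃ p, s = D * scalarSeries F A p * D' := by
  have hη : (fun g => algebraMap F (PowerSeries A) (η g))
      = fun g => (scalarSeries F A : PowerSeries F →+* PowerSeries A)
        (algebraMap F (PowerSeries F) (η g)) :=
    funext fun g => ((scalarSeries F A).commutes (η g)).symm
  rw [hη] at hT hT' h
  rw [← hK, ← scalarSeries_X (F := F) (A := A)] at h
  refine ⟨_, eq_mul_mul_of_retraction (scalarSeries F A : PowerSeries F →+* PowerSeries A)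
    (PowerSeries.map (ε : A →+* F)) (fun p => ?_) scalarSeries_central
    (η := fun g => algebraMap F (PowerSeries F) (η g)) (o := o) (by rw [ho, map_one])
    PowerSeries.X K hT hT' hεT hεT' h⟩
  ext n
  exact (PowerSeries.coeff_map _ _ _).trans
    ((congrArg ε (PowerSeries.coeff_map (algebraMap F A) n p)).trans (ε.commutes _))

end Rows

section Centrality

variable {F : Type} [Field F] {N : ℕ}

/-- The factors of the product defining the Sklyanin determinant of `S(u) = Σ S⁽ʳ⁾ u⁻ʳ`. -/
def sdetFacs (q : F) (S : ℕ → Matrix (Fin N) (Fin N) (UqAff F q N)) :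
    List (ℤ → Matrix (Fin N → Fin N) (Fin N → Fin N) (UqAff F q N)) :=
  (List.finRange N).flatMap fun i =>
    (fun m : ℤ =>
        if m ≤ 0 then q ^ (2 * (i.val : ℤ) * (-m)) • ampAt i (S (-m).toNat) else 0) ::
      (((List.finRange N).filter fun j => i < j).map fun j => RtfacO F q N i j)

variable {q : F}

theorem prod_toSeries_sdetFacs (hq : q ≠ 0) {S : ℕ → Matrix (Fin N) (Fin N) (UqAff F q N)}
    (G : Matrix (Fin N) (Fin N) F)
    (hS : ∀ r i j, S r i j = ∑ p ∈ Finset.HasAntidiagonal.antidiagonal r, ∑ a, ∑ b,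
      G a b • (tA F q N p.1 i a * tbA F q N p.2 j b)) :
    ((sdetFacs q S).map toSeries).prod
      = ((List.finRange N).map fun k => emb1 k (tSer F q N (q ^ (2 * k.val)))).prod *
        scalarPart q G (PowerSeries (UqAff F q N)) PowerSeries.X *
        ((List.finRange N).map fun k => emb1 k (tbSer F q N (q ^ (2 * k.val))).transpose).prod := by
  rw [← interleavedProd_sFactors, ← prod_flatMap_filter_eq_interleavedProd _ _
    (List.pairwise_lt_finRange N), sdetFacs, List.map_flatMap]
  congr 2
  funext i
  rw [List.map_cons, List.map_map]
  have h1 := @toSeries_sFactor F _ (UqAff F q N) _ _ N q (tMat F q N) (tbMat F q N) S G hS i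
  have h2 : ∀ j, (toSeries ∘ fun j => RtfacO F q N i j) j = _ := fun j =>
    @toSeries_rFactor F _ (UqAff F q N) _ _ N q hq i j
  rw [funext h2]
  exact congrArg₂ List.cons h1 rfl

theorem commute_sdet (hq : q ≠ 0) (hq1 : q ^ 2 ≠ 1) (h2 : (2 : F) ≠ 0)
    {Pq : Equiv.Perm (Fin N) → Matrix (Fin N → Fin N) (Fin N → Fin N) F} (hP : PqExt F q N N Pq)
    {S : ℕ → Matrix (Fin N) (Fin N) (UqAff F q N)} (G : Matrix (Fin N) (Fin N) F)
    (hS : ∀ r i j, S r i j = ∑ p ∈ Finset.HasAntidiagonal.antidiagonal r, ∑ a, ∑ b,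
      G a b • (tA F q N p.1 i a * tbA F q N p.2 j b))
    {sd : ℤ → UqAff F q N}
    (hsd : ∀ m : ℤ, seriesProdCoeff ((fun m' : ℤ => if m' = 0 then
        (AqM F Pq).map (algebraMap F (UqAff F q N)) else 0) :: sdetFacs q S) m
      = sd m • (AqM F Pq).map (algebraMap F (UqAff F q N))) (m : ℤ) (x : UqAff F q N) :
    Commute (sd m) x := by
  have hη := antiSym_eta hq hP
  have h1 := eta_id hq hP
  rcases lt_or_ge (((sdetFacs q S).length : ℤ) + 1) m with hm | hm
  · have h := congrFun (congrFun (hsd m) id) id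
    rw [seriesProdCoeff_eq_zero _ (by rw [List.length_cons]; exact_mod_cast hm)] at h
    have h1' : (AqM F Pq).map (algebraMap F (UqAff F q N)) id id = 1 := by
      rw [Matrix.map_apply]
      exact (congrArg _ h1).trans (map_one _)
    rw [Matrix.smul_apply, h1', smul_eq_mul, mul_one] at h
    rw [← h]
    exact Commute.zero_left x
  obtain ⟨n, hn⟩ := Int.eq_ofNat_of_zero_le (sub_nonneg.mpr hm)
  have hrow := X_smul_vecMul_prod_toSeries (AqM F Pq) id (sdetFacs q S) sd hsd
  rw [prod_toSeries_sdetFacs hq G hS] at hrow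
  have hT := vecMul_eta_prod_eq_detRow_smul hq h2 hη h1
    (fun a : Fin N => tSer F q N (q ^ (2 * a.val))) (fun i _ => EM_mul_tSer_pow hq hq1 i)
  have hTb := vecMul_eta_prod_eq_detRow_smul hq h2 hη h1
    (fun a : Fin N => (tbSer F q N (q ^ (2 * a.val))).transpose)
    (fun i _ => EM_mul_tbSer_pow hq hq1 i)
  have hε := fun (M : Fin N → Matrix (Fin N) (Fin N) (PowerSeries (UqAff F q N)))
      (hM : ∀ a, (M a).map (PowerSeries.map (counit F q N : UqAff F q N →+* F)) = 1) =>
    map_prod_emb1_eq_one _ M hM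
  obtain ⟨p, hp⟩ := exists_eq_mul_scalarSeries_mul (counit F q N) (o := id) h1
    (scalarPart q G (PowerSeries F) PowerSeries.X) hT hTb
    (hε _ fun a => map_counit_tSer _)
    (hε _ fun a => by rw [Matrix.transpose_map, map_counit_tbSer, Matrix.transpose_one])
    ((map_scalarPart (scalarSeries F (UqAff F q N)) q G PowerSeries.X).trans
      (congrArg _ scalarSeries_X)) hrow
  have h := commute_of_eq_mul_mul p hp
    (commute_C_of_generators (commute_tA_detT hq hq1 h2 hη h1)
      (commute_tbA_detT hq hq1 h2 hη h1))
    (commute_C_of_generators (commute_tA_detTb hq hq1 h2 hη h1)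
      (commute_tbA_detTb hq hq1 h2 hη h1)) n x
  rw [PowerSeries.coeff_mk] at h
  rwa [show ((sdetFacs q S).length : ℤ) + 1 - n = m by omega] at h

end Centrality


section Membership

variable {F : Type} [Field F] {N : ℕ} {q : F}

theorem ampAt_mem {A : Type} [Ring A] [Algebra F A] (Y : Subalgebra F A) (k : Fin N)
    (M : Matrix (Fin N) (Fin N) A) (hM : ∀ i j, M i j ∈ Y) (f g) : ampAt k M f g ∈ Y := by
  rw [ampAt, Matrix.of_apply]
  split_ifs
  · exact hM _ _
  · exact Y.zero_mem

theorem RtfacO_mem (Y : Subalgebra F (UqAff F q N)) (i j : Fin N) (m : ℤ) (f g) :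
    RtfacO F q N i j m f g ∈ Y := by
  rw [RtfacO]
  split_ifs
  · exact Y.smul_mem (Y.algebraMap_mem _) _
  · exact Y.smul_mem (Y.algebraMap_mem _) _
  · exact Y.zero_mem

theorem sdetFacs_mem (Y : Subalgebra F (UqAff F q N))
    {S : ℕ → Matrix (Fin N) (Fin N) (UqAff F q N)} (hS : ∀ r i j, S r i j ∈ Y) :
    ∀ c ∈ sdetFacs q S, ∀ k f g, c k f g ∈ Y := by
  intro c hc k f g
  obtain ⟨i, -, hi⟩ := List.mem_flatMap.mp hc
  rcases List.mem_cons.mp hi with rfl | hi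
  · dsimp only
    split_ifs
    · exact Y.smul_mem (ampAt_mem Y i _ (hS _) f g) _
    · exact Y.zero_mem
  · obtain ⟨j, -, rfl⟩ := List.mem_map.mp hi
    exact RtfacO_mem Y i j k f g

theorem sdet_mem (hq : q ≠ 0)
    {Pq : Equiv.Perm (Fin N) → Matrix (Fin N → Fin N) (Fin N → Fin N) F} (hP : PqExt F q N N Pq)
    (Y : Subalgebra F (UqAff F q N)) {S : ℕ → Matrix (Fin N) (Fin N) (UqAff F q N)}
    (hS : ∀ r i j, S r i j ∈ Y) {sd : ℤ → UqAff F q N}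
    (hsd : ∀ m : ℤ, seriesProdCoeff ((fun m' : ℤ => if m' = 0 then
        (AqM F Pq).map (algebraMap F (UqAff F q N)) else 0) :: sdetFacs q S) m
      = sd m • (AqM F Pq).map (algebraMap F (UqAff F q N))) (m : ℤ) : sd m ∈ Y := by
  have h := congrFun (congrFun (hsd m) id) id
  have h1 : (AqM F Pq).map (algebraMap F (UqAff F q N)) id id = 1 := by
    rw [Matrix.map_apply]
    exact (congrArg _ (eta_id hq hP)).trans (map_one _)
  rw [Matrix.smul_apply, h1, smul_eq_mul, mul_one] at h
  rw [← h]
  refine seriesProdCoeff_mem Y.toSubring _ (fun c hc k f g => ?_) m id id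
  rcases List.mem_cons.mp hc with rfl | hc
  · dsimp only
    split_ifs
    · exact Y.algebraMap_mem _
    · exact Y.zero_mem
  · exact sdetFacs_mem Y hS c hc k f g

end Membership

section Cases

variable {A : Type} [Ring A] {F : Type} [Field F] [Algebra F A]

theorem sum_range_eq_orthogonal {N : ℕ} (t tb : ℕ → Matrix (Fin N) (Fin N) A) (r : ℕ)
    (i j : Fin N) :
    ∑ a, ∑ p ∈ Finset.range (r + 1), t p i a * tb (r - p) j a
      = ∑ p ∈ Finset.HasAntidiagonal.antidiagonal r, ∑ a, ∑ b,
        (1 : Matrix (Fin N) (Fin N) F) a b • (t p.1 i a * tb p.2 j b) := by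
  rw [Finset.sum_comm, Finset.Nat.sum_antidiagonal_eq_sum_range_succ_mk]
  simp [Matrix.one_apply, ite_smul]

/-- The matrix `G` of the symplectic case. -/
def sympG (q : F) (n : ℕ) : Matrix (Fin (2 * n)) (Fin (2 * n)) F :=
  ∑ a : Fin n, (Matrix.single (fe n a) (fo n a) q - Matrix.single (fo n a) (fe n a) 1)

theorem sum_sympG_smul (q : F) (n : ℕ) (x : Fin (2 * n) → Fin (2 * n) → A) :
    ∑ a, ∑ b, sympG q n a b • x a b
      = ∑ a : Fin n, (q • x (fe n a) (fo n a) - x (fo n a) (fe n a)) := by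
  have hs : ∀ (i j : Fin (2 * n)) (c : F),
      ∑ a, ∑ b, Matrix.single i j c a b • x a b = c • x i j := fun i j c => by
    rw [Finset.sum_eq_single i, Finset.sum_eq_single j]
    · rw [Matrix.single_apply_same]
    · intro b _ hb
      rw [Matrix.single_apply_of_ne _ _ _ _ _ (fun h => hb h.2.symm), zero_smul]
    · simp
    · intro a _ ha
      exact Finset.sum_eq_zero fun b _ => by
        rw [Matrix.single_apply_of_ne _ _ _ _ _ (fun h => ha h.1.symm), zero_smul]
    · simp
  simp only [sympG, Matrix.sum_apply, Matrix.sub_apply, Finset.sum_smul, sub_smul]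
  rw [Finset.sum_congr rfl fun a _ => Finset.sum_comm, Finset.sum_comm]
  refine Finset.sum_congr rfl fun k _ => ?_
  simp only [Finset.sum_sub_distrib, hs, one_smul]

theorem sum_range_eq_symplectic (q : F) {n : ℕ} (t tb : ℕ → Matrix (Fin (2 * n)) (Fin (2 * n)) A)
    (r : ℕ) (i j : Fin (2 * n)) :
    ∑ a : Fin n, ∑ p ∈ Finset.range (r + 1),
        (algebraMap F A q * (t p i (fe n a) * tb (r - p) j (fo n a))
          - t p i (fo n a) * tb (r - p) j (fe n a))
      = ∑ p ∈ Finset.HasAntidiagonal.antidiagonal r, ∑ a, ∑ b,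
        sympG q n a b • (t p.1 i a * tb p.2 j b) := by
  rw [Finset.sum_comm, Finset.Nat.sum_antidiagonal_eq_sum_range_succ_mk]
  refine Finset.sum_congr rfl fun p _ => ?_
  rw [sum_sympG_smul q n fun a b => t p i a * tb (r - p) j b]
  simp only [Algebra.smul_def]

end Cases

theorem qq_ne_zero : qq ≠ 0 := RatFunc.X_ne_zero

theorem qq_sq_ne_one : qq ^ 2 ≠ 1 := by
  intro h
  have h' : algebraMap (Polynomial ℂ) FF (Polynomial.X ^ 2) = algebraMap _ _ 1 := by
    rw [map_pow, map_one, RatFunc.algebraMap_X]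
    exact h
  have := congrArg Polynomial.natDegree (RatFunc.algebraMap_injective ℂ h')
  simp at this

theorem two_ne_zero_FF : (2 : FF) ≠ 0 := by
  have : CharZero FF := charZero_of_injective_algebraMap (algebraMap ℂ FF).injective
  exact two_ne_zero

end Sklyanin

set_option synthInstance.maxHeartbeats 1000000 in
set_option maxHeartbeats 1000000 in
/-- the coefficients of the Sklyanin determinant `sdet S(u)` (defined
coefficientwise by `A^q_N S₁(u) R₁₂ᵗ ⋯ R_{N-1,N}ᵗ S_N(q^{-2N+2}u) = sdet S(u) · A^q_N`)
belong to the center of the twisted q-Yangian: they lie in `Y^tw_q(o_N)`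
(resp. `Y^tw_q(sp_2n)`) and commute with all of its elements. -/
theorem stmt19 :
    (∀ (N : ℕ) (Pq : Equiv.Perm (Fin N) → Matrix (Fin N → Fin N) (Fin N → Fin N) FF),
      PqExt FF qq N N Pq →
      ∀ sd : ℤ → UqAff FF qq N,
        (∀ m : ℤ, seriesProdCoeff
            ((fun m' : ℤ => if m' = 0 then
                (AqM FF Pq).map (algebraMap FF (UqAff FF qq N)) else 0)
              :: sdetFacsO FF qq N) m
          = sd m • (AqM FF Pq).map (algebraMap FF (UqAff FF qq N))) →
        ∀ m : ℤ, sd m ∈ YtwO FF qq N ∧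
          ∀ x ∈ YtwO FF qq N, sd m * x = x * sd m) ∧
    (∀ (n : ℕ)
        (Pq : Equiv.Perm (Fin (2 * n)) →
          Matrix (Fin (2 * n) → Fin (2 * n)) (Fin (2 * n) → Fin (2 * n)) FF),
      PqExt FF qq (2 * n) (2 * n) Pq →
      ∀ inv : Fin n → UqAff FF qq (2 * n),
        (∀ k : Fin n, ScoefSp FF qq n 0 (fe n k) (fo n k) * inv k = 1 ∧
          inv k * ScoefSp FF qq n 0 (fe n k) (fo n k) = 1) →
      ∀ sd : ℤ → UqAff FF qq (2 * n),
        (∀ m : ℤ, seriesProdCoeff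
            ((fun m' : ℤ => if m' = 0 then
                (AqM FF Pq).map (algebraMap FF (UqAff FF qq (2 * n))) else 0)
              :: sdetFacsSp FF qq n) m
          = sd m • (AqM FF Pq).map (algebraMap FF (UqAff FF qq (2 * n)))) →
        ∀ m : ℤ, sd m ∈ YtwSp FF qq n inv ∧
          ∀ x ∈ YtwSp FF qq n inv, sd m * x = x * sd m) := by
  refine ⟨fun N Pq hP sd hsd m => ⟨?_, fun x _ => ?_⟩, fun n Pq hP inv _ sd hsd m =>
    ⟨?_, fun x _ => ?_⟩⟩
  · exact Sklyanin.sdet_mem Sklyanin.qq_ne_zero hP (YtwO FF qq N) (S := SmatA FF qq N)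
      (fun r i j => Algebra.subset_adjoin ⟨r, i, j, rfl⟩) hsd m
  · exact (Sklyanin.commute_sdet Sklyanin.qq_ne_zero Sklyanin.qq_sq_ne_one Sklyanin.two_ne_zero_FF
      hP (S := SmatA FF qq N) 1
      (fun r i j => Sklyanin.sum_range_eq_orthogonal (Sklyanin.tMat FF qq N)
        (Sklyanin.tbMat FF qq N) r i j) hsd m x).eq
  · exact Sklyanin.sdet_mem Sklyanin.qq_ne_zero hP (YtwSp FF qq n inv) (S := SmatASp FF qq n)
      (fun r i j => Algebra.subset_adjoin (Or.inl ⟨r, i, j, rfl⟩)) hsd m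
  · exact (Sklyanin.commute_sdet Sklyanin.qq_ne_zero Sklyanin.qq_sq_ne_one Sklyanin.two_ne_zero_FF
      hP (S := SmatASp FF qq n)
      (Sklyanin.sympG qq n)
      (fun r i j => Sklyanin.sum_range_eq_symplectic qq (Sklyanin.tMat FF qq (2 * n))
        (Sklyanin.tbMat FF qq (2 * n)) r i j)
      hsd m x).eq
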